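/- arXiv:math/0408382 — 2 statements merged into one kernel-verified Lean document; each statement's English description precedes it below -/
import Mathlib

section
/- Let g ≥ 1 and let η₁,…,η_g be odd analytic theta characteristics in dimension g such that the function τ ↦ J(η₁,…,η_g)(τ) on H_g is not identically zero and belongs to the ring of Thetanullwerte. Then: (1) there exist even characteristics η_{g+1},…,η_{2g+2} such that {η₁,…,η_g,η_{g+1},…,η_{2g+2}} is a fundamental system; and (2) letting 𝒮 be the collection of all (g+2)-element sets s of even characteristics such that {η₁,…,η_g} ∪ s is a fundamental system, there exist signs ε_s ∈ {+1, −1} for s ∈ 𝒮 such that for all τ ∈ H_g, J(η₁,…,η_g)(τ) = π^g · ∑_{s ∈ 𝒮} ε_s · ∏_{η ∈ s} θ[η](0; τ). -/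
open scoped Classical BigOperators

noncomputable section

/-- An analytic theta characteristic in dimension `g`: a pair `[η'; η'']` of
vectors in `ℝ^g` (whose entries are intended to lie in `{0, 1/2}`). -/
abbrev ThetaChar (g : ℕ) : Type := (Fin g → ℝ) × (Fin g → ℝ)

/-- All entries of both vectors of the characteristic lie in `{0, 1/2}`. -/
def IsChar {g : ℕ} (η : ThetaChar g) : Prop :=
  (∀ i, η.1 i = 0 ∨ η.1 i = 1 / 2) ∧ (∀ i, η.2 i = 0 ∨ η.2 i = 1 / 2)

/-- Membership in the Siegel upper half-space `H_g`: a symmetric complex `g×g`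
matrix whose imaginary part is positive definite. -/
def IsSiegel {g : ℕ} (τ : Matrix (Fin g) (Fin g) ℂ) : Prop :=
  τ.IsSymm ∧ (τ.map Complex.im).PosDef

/-- The theta function with characteristic `η`:
`θ[η](z;τ) = ∑_{n ∈ ℤ^g} exp(πi·ᵗ(n+η')τ(n+η') + 2πi·ᵗ(n+η')(z+η''))`. -/
def theta {g : ℕ} (η : ThetaChar g) (z : Fin g → ℂ)
    (τ : Matrix (Fin g) (Fin g) ℂ) : ℂ :=
  ∑' n : Fin g → ℤ,
    Complex.exp
      ((Real.pi : ℂ) * Complex.I *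
          ∑ i, ∑ j, ((n i : ℂ) + (η.1 i : ℂ)) * τ i j * ((n j : ℂ) + (η.1 j : ℂ)) +
        2 * (Real.pi : ℂ) * Complex.I *
          ∑ i, ((n i : ℂ) + (η.1 i : ℂ)) * (z i + (η.2 i : ℂ)))

/-- `η` is an even characteristic: `4·ᵗη'η''` is an even integer. -/
def IsEvenChar {g : ℕ} (η : ThetaChar g) : Prop :=
  ∃ k : ℤ, (4 * ∑ i, η.1 i * η.2 i : ℝ) = 2 * (k : ℝ)

/-- `η` is an odd characteristic. -/
def IsOddChar {g : ℕ} (η : ThetaChar g) : Prop := ¬ IsEvenChar η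

/-- Entrywise sum of two characteristics, taken modulo 1. -/
def charAdd {g : ℕ} (η ζ : ThetaChar g) : ThetaChar g :=
  (fun i => Int.fract (η.1 i + ζ.1 i), fun i => Int.fract (η.2 i + ζ.2 i))

/-- Entrywise difference of two characteristics, taken modulo 1. -/
def charSub {g : ℕ} (η ζ : ThetaChar g) : ThetaChar g :=
  (fun i => Int.fract (η.1 i - ζ.1 i), fun i => Int.fract (η.2 i - ζ.2 i))

/-- The Jacobian Nullwert `J(η₁,…,η_g)(τ)`: the determinant of the matrix of
partial derivatives `∂θ[η_k]/∂z_l` at `z = 0`. -/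
def jacobianNullwert {g : ℕ} (η : Fin g → ThetaChar g)
    (τ : Matrix (Fin g) (Fin g) ℂ) : ℂ :=
  Matrix.det (Matrix.of fun k l : Fin g =>
    fderiv ℂ (fun z : Fin g → ℂ => theta (η k) z τ) 0 (Pi.single l 1))

/-- The sign `e(η)`: `+1` if `η` is even, `-1` if odd. -/
def eSign {g : ℕ} (η : ThetaChar g) : ℤ := if IsEvenChar η then 1 else -1

/-- The triple `{a,b,c}` is azygetic: `e(a)e(b)e(c)e(a+b+c) = -1`. -/
def Azygetic {g : ℕ} (a b c : ThetaChar g) : Prop :=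
  eSign a * eSign b * eSign c * eSign (charAdd (charAdd a b) c) = -1

/-- A fundamental system of analytic theta characteristics: a set of `2g+2`
characteristics, `g` of them odd and the remaining `g+2` even, such that every
three-element subset is azygetic. -/
def IsFundamentalSystem (g : ℕ) (F : Finset (ThetaChar g)) : Prop :=
  F.card = 2 * g + 2 ∧ (∀ η ∈ F, IsChar η) ∧
    (F.filter fun η => IsOddChar η).card = g ∧
    ∀ a ∈ F, ∀ b ∈ F, ∀ c ∈ F, a ≠ b → a ≠ c → b ≠ c → Azygetic a b c

/-- The Siegel upper half-space `H_g`, as a subtype. -/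
def Siegel (g : ℕ) : Type := {τ : Matrix (Fin g) (Fin g) ℂ // IsSiegel τ}

/-- The ring of Thetanullwerte: the `ℂ`-subalgebra of functions on `H_g`
generated by the Thetanullwerte `τ ↦ θ[η](0;τ)` for `η` even. -/
def thetanullwerteRing (g : ℕ) : Subalgebra ℂ (Siegel g → ℂ) :=
  Algebra.adjoin ℂ
    {f : Siegel g → ℂ | ∃ η : ThetaChar g, IsChar η ∧ IsEvenChar η ∧
      f = fun τ => theta η 0 τ.1}

namespace ThetaNull

/-- Characteristics with entries in `ℤ/2`, doubling the half-integral ones. -/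
abbrev BinChar (g : ℕ) : Type := (Fin g → ZMod 2) × (Fin g → ZMod 2)

variable {g : ℕ}

/-- The parity `ᵗa b` of a binary characteristic. -/
def parity (k : BinChar g) : ZMod 2 := ∑ i, k.1 i * k.2 i

/-- The symplectic pairing on binary characteristics. -/
def weil (x y : BinChar g) : ZMod 2 := ∑ i, (x.1 i * y.2 i + x.2 i * y.1 i)

/-- The quadratic form attached to a characteristic. -/
def quad (m x : BinChar g) : ZMod 2 := parity x + weil m x

lemma weil_add_left (x y z : BinChar g) : weil (x + y) z = weil x z + weil y z := by
  simp only [weil, ← Finset.sum_add_distrib, Prod.fst_add, Prod.snd_add, Pi.add_apply]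
  exact Finset.sum_congr rfl fun i _ => by ring

lemma weil_comm (x y : BinChar g) : weil x y = weil y x :=
  Finset.sum_congr rfl fun i _ => by ring

lemma weil_add_right (x y z : BinChar g) : weil x (y + z) = weil x y + weil x z := by
  rw [weil_comm, weil_add_left, weil_comm y, weil_comm z]

lemma weil_smul_left (c : ZMod 2) (x y : BinChar g) : weil (c • x) y = c * weil x y := by
  simp only [weil, Finset.mul_sum, Prod.smul_fst, Prod.smul_snd, Pi.smul_apply, smul_eq_mul]
  exact Finset.sum_congr rfl fun i _ => by ring

lemma weil_smul_right (c : ZMod 2) (x y : BinChar g) : weil x (c • y) = c * weil x y := by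
  rw [weil_comm, weil_smul_left, weil_comm]

@[simp] lemma weil_zero_left (x : BinChar g) : weil 0 x = 0 := by simp [weil]

@[simp] lemma weil_self (x : BinChar g) : weil x x = 0 :=
  Finset.sum_eq_zero fun i _ => by rw [mul_comm]; exact CharTwo.add_self_eq_zero _

lemma weil_sum_left {ι : Type*} (s : Finset ι) (f : ι → BinChar g) (y : BinChar g) :
    weil (∑ i ∈ s, f i) y = ∑ i ∈ s, weil (f i) y := by
  induction s using Finset.induction_on with
  | empty => simp
  | insert a s ha ih => rw [Finset.sum_insert ha, Finset.sum_insert ha, weil_add_left, ih]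

@[simp] lemma parity_zero : parity (0 : BinChar g) = 0 := by simp [parity]

lemma parity_add (x y : BinChar g) : parity (x + y) = parity x + parity y + weil x y := by
  simp only [parity, weil, ← Finset.sum_add_distrib, Prod.fst_add, Prod.snd_add, Pi.add_apply]
  exact Finset.sum_congr rfl fun i _ => by ring

lemma parity_smul (c : ZMod 2) (x : BinChar g) : parity (c • x) = c * parity x := by
  have h : c * c = c := by revert c; decide
  simp only [parity, Finset.mul_sum, Prod.smul_fst, Prod.smul_snd, Pi.smul_apply, smul_eq_mul]
  refine Finset.sum_congr rfl fun i _ => ?_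
  linear_combination (x.1 i * x.2 i) * h

lemma add_self (x : BinChar g) : x + x = 0 := by
  ext i <;> exact CharTwo.add_self_eq_zero _

lemma eq_of_add_eq_zero {x y : BinChar g} (h : x + y = 0) : x = y := by
  have := congrArg (· + y) h
  simpa [add_assoc, add_self] using this

lemma eq_zero_of_weil {x : BinChar g} (h : ∀ y, weil x y = 0) : x = 0 := by
  ext i
  · have := h (0, Pi.single i 1)
    simpa [weil, Pi.single_apply] using this
  · have := h (Pi.single i 1, 0)
    simpa [weil, Pi.single_apply] using this

lemma quad_add (m x y : BinChar g) : quad m (x + y) = quad m x + quad m y + weil x y := by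
  simp only [quad, parity_add, weil_add_right]; ring

lemma quad_add_left (m n x : BinChar g) : quad (m + n) x = quad m x + weil n x := by
  simp only [quad, weil_add_left]; ring

lemma zmod_two_eq_one {a : ZMod 2} (h : a ≠ 0) : a = 1 := by
  revert a; decide

/-- The transvection along `x`, acting on characteristics. -/
def transvFun (x m : BinChar g) : BinChar g := m + (1 + quad m x) • x

lemma quad_transvFun (x m : BinChar g) : quad (transvFun x m) x = quad m x := by
  rw [transvFun, quad_add_left, weil_smul_left, weil_self, mul_zero, add_zero]

lemma transvFun_involutive (x : BinChar g) : Function.Involutive (transvFun x) := by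
  intro m
  have h := quad_transvFun x m
  rw [transvFun, h, transvFun, add_assoc, add_self, add_zero]

/-- The transvection along `x` as a permutation of the characteristics. -/
def transv (x : BinChar g) : Equiv.Perm (BinChar g) := (transvFun_involutive x).toPerm

lemma transv_apply (x m : BinChar g) : transv x m = m + (1 + quad m x) • x := rfl

lemma parity_transv (x m : BinChar g) : parity (transv x m) = parity m := by
  rw [transv_apply, parity_add, parity_smul, weil_smul_right]
  simp only [quad]
  generalize parity x = a, weil m x = b, parity m = c
  revert a b c; decide

lemma transv_add_transv (x m n : BinChar g) :
    transv x m + transv x n = m + n + weil x (m + n) • x := by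
  have h : (1 + quad m x) + (1 + quad n x) = weil x (m + n) := by
    rw [weil_comm, weil_add_left]
    simp only [quad]
    generalize parity x = a, weil m x = b, weil n x = c
    revert a b c; decide
  rw [transv_apply, transv_apply, ← h, add_smul (1 + quad m x), add_add_add_comm]

/-- A permutation of the characteristics respecting parities and the affine symplectic
structure, with linear part `L`. -/
structure IsAffine (γ : Equiv.Perm (BinChar g)) (L : BinChar g → BinChar g) : Prop where
  parity_eq : ∀ m, parity (γ m) = parity m
  map_add : ∀ m x, γ (m + x) = γ m + L x

lemma IsAffine.quad_eq {γ : Equiv.Perm (BinChar g)} {L} (h : IsAffine γ L) (m x : BinChar g) :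
    quad (γ m) (L x) = quad m x := by
  have h1 : ∀ m x : BinChar g, quad m x = parity (m + x) + parity m := by
    intro m x
    rw [parity_add, quad]
    generalize parity x = a, weil m x = b, parity m = c
    revert a b c; decide
  rw [h1, h1, ← h.map_add, h.parity_eq, h.parity_eq]

lemma IsAffine.weil_eq {γ : Equiv.Perm (BinChar g)} {L} (h : IsAffine γ L) (x y : BinChar g) :
    weil (L x) (L y) = weil x y := by
  have h0 := h.quad_eq 0 y
  have h1 := h.quad_eq x y
  have h2 := h.map_add 0 x
  rw [zero_add] at h2
  rw [h2, quad_add_left, h0] at h1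
  have h3 := quad_add_left 0 x y
  rw [zero_add] at h3
  rw [h3] at h1
  exact add_left_cancel h1

lemma isAffine_transv (x : BinChar g) : IsAffine (transv x) (fun y => y + weil x y • x) where
  parity_eq := parity_transv x
  map_add m y := by
    have := transv_add_transv x (m + y) m
    rw [show m + y + m = y by rw [add_comm m y, add_assoc, add_self, add_zero]] at this
    rw [← this, add_comm (transv x (m + y)), ← add_assoc, add_self, zero_add]

lemma IsAffine.map_transv {γ : Equiv.Perm (BinChar g)} {L} (h : IsAffine γ L) (x m : BinChar g) :
    γ (transv x m) = transv (L x) (γ m) := by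
  have h0 : L 0 = 0 := by
    have := h.map_add 0 0
    simpa using this
  have hs : ∀ c : ZMod 2, L (c • x) = c • L x := by
    intro c
    by_cases hc : c = 0
    · simp [hc, h0]
    · simp [zmod_two_eq_one hc]
  rw [transv_apply, transv_apply, h.map_add, hs, h.quad_eq]

/-! ### Azygetic families -/

/-- Three characteristics are azygetic when the associated pairing is `1`. -/
def Azyg (a b c : BinChar g) : Prop := weil (a + b) (a + c) = 1

lemma IsAffine.azyg {γ : Equiv.Perm (BinChar g)} {L} (h : IsAffine γ L) {a b c : BinChar g}
    (habc : Azyg a b c) : Azyg (γ a) (γ b) (γ c) := by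
  have key : ∀ u v : BinChar g, γ u + γ v = L (u + v) := by
    intro u v
    have h1 := h.map_add u (u + v)
    rw [← add_assoc, add_self, zero_add] at h1
    rw [h1, ← add_assoc, add_self, zero_add]
  rw [Azyg, key, key, h.weil_eq]
  exact habc

/-- The standard fundamental system. -/
def stdChar (g : ℕ) (j : ℕ) : BinChar g :=
  (fun i => if j = 2 * i.1 + 1 ∨ j = 2 * i.1 + 2 then 1 else 0,
    fun i => if 2 * i.1 + 2 ≤ j then 1 else 0)

lemma stdChar_zero : stdChar g 0 = 0 := by
  ext i <;> simp [stdChar]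

lemma sum_stdChar_fst (c : ℕ) (f : Fin g → ZMod 2) (k : ℕ) (hk : k < g)
    (hck : c = 2 * k + 1 ∨ c = 2 * k + 2) :
    ∑ i, (stdChar g c).1 i * f i = f ⟨k, hk⟩ := by
  rw [Finset.sum_eq_single ⟨k, hk⟩]
  · simp [stdChar, hck]
  · intro i _ hi
    have : ¬ (c = 2 * i.1 + 1 ∨ c = 2 * i.1 + 2) := by
      intro h
      apply hi
      ext
      simp only
      omega
    simp [stdChar, this]
  · simp

lemma parity_stdChar_odd (k : ℕ) : parity (stdChar g (2 * k + 1)) = 0 := by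
  refine Finset.sum_eq_zero fun i _ => ?_
  simp only [stdChar, mul_ite, mul_one, mul_zero]
  split_ifs <;> first | rfl | omega

lemma parity_stdChar_even (k : ℕ) (hk : k < g) : parity (stdChar g (2 * k + 2)) = 1 := by
  rw [parity, sum_stdChar_fst _ _ k hk (by simp)]
  simp [stdChar]

lemma weil_stdChar_aux (i j : ℕ) (hi : 1 ≤ i) (hij : i < j) (hj : j ≤ 2 * g + 1) :
    weil (stdChar g i) (stdChar g j) = 1 := by
  have hk : (i - 1) / 2 < g := by omega
  rw [weil, Finset.sum_add_distrib, sum_stdChar_fst i _ ((i - 1) / 2) hk (by omega)]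
  by_cases hj' : j = 2 * g + 1
  · subst hj'
    have h2 : ∀ x : Fin g, (stdChar g (2 * g + 1)).1 x = 0 := by
      intro x
      have := x.2
      simp only [stdChar]
      rw [if_neg]; omega
    simp only [h2, mul_zero, Finset.sum_const_zero, add_zero]
    simp only [stdChar]
    rw [if_pos]; omega
  · have hl : (j - 1) / 2 < g := by omega
    have := sum_stdChar_fst j (stdChar g i).2 ((j - 1) / 2) hl (by omega)
    simp only [mul_comm] at this ⊢
    rw [this]
    simp only [stdChar]
    by_cases h : 2 * ((i - 1) / 2) + 2 ≤ j
    · rw [if_pos h, if_neg (by omega), add_zero]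
    · omega

lemma weil_stdChar {i j : ℕ} (hi : 1 ≤ i) (hi' : i ≤ 2 * g + 1) (hj : 1 ≤ j)
    (hj' : j ≤ 2 * g + 1) (hij : i ≠ j) : weil (stdChar g i) (stdChar g j) = 1 := by
  rcases lt_or_gt_of_ne hij with h | h
  · exact weil_stdChar_aux i j hi h hj'
  · rw [weil_comm]; exact weil_stdChar_aux j i hj h hi'

lemma eq_zero_of_weil_stdChar {x : BinChar g}
    (h : ∀ j, 1 ≤ j → j ≤ 2 * g → weil x (stdChar g j) = 0) : x = 0 := by
  have hfst : ∀ k : Fin g, x.1 k = 0 := by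
    intro k
    have h1 := h (2 * k + 1) (by omega) (by omega)
    have h2 := h (2 * k + 2) (by omega) (by omega)
    have h3 : weil x (stdChar g (2 * k + 1) + stdChar g (2 * k + 2)) = 0 := by
      rw [weil_add_right, h1, h2, add_zero]
    have h4 : stdChar g (2 * k + 1) + stdChar g (2 * k + 2) = (0, Pi.single k 1) := by
      ext i
      · simp only [stdChar, Prod.fst_add, Pi.add_apply, Pi.zero_apply]
        split_ifs <;> first | rfl | (exfalso; omega)
      · simp only [stdChar, Prod.snd_add, Pi.add_apply, Pi.single_apply, Fin.ext_iff]
        split_ifs <;> first | rfl | (exfalso; omega)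
    rw [h4] at h3
    simpa [weil, Pi.single_apply] using h3
  ext k
  · exact hfst k
  · have h1 := h (2 * k + 1) (by omega) (by omega)
    simp only [weil, hfst, zero_mul, zero_add] at h1
    have := sum_stdChar_fst (2 * k.1 + 1) x.2 k.1 k.2 (by simp)
    simp only [mul_comm] at this h1
    rw [this] at h1
    exact h1

/-- The group generated by all transvections. -/
def transvGroup (g : ℕ) : Subgroup (Equiv.Perm (BinChar g)) :=
  Subgroup.closure (Set.range transv)

lemma transv_mem (x : BinChar g) : transv x ∈ transvGroup g :=
  Subgroup.subset_closure ⟨x, rfl⟩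

lemma transv_inv (x : BinChar g) : (transv x)⁻¹ = transv x :=
  Function.Involutive.toPerm_symm _

lemma transvGroup_induction {P : Equiv.Perm (BinChar g) → Prop} (one : P 1)
    (step : ∀ x γ, P γ → P (transv x * γ)) {γ} (hγ : γ ∈ transvGroup g) : P γ := by
  refine Subgroup.closure_induction_left one ?_ ?_ hγ
  · rintro _ ⟨x, rfl⟩ y _ hy
    exact step x y hy
  · rintro _ ⟨x, rfl⟩ y _ hy
    rw [transv_inv]
    exact step x y hy

lemma IsAffine.comp {γ δ : Equiv.Perm (BinChar g)} {L M} (h : IsAffine γ L) (h' : IsAffine δ M) :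
    IsAffine (γ * δ) (L ∘ M) where
  parity_eq m := by simp [h.parity_eq, h'.parity_eq]
  map_add m x := by simp [h.map_add, h'.map_add]

lemma isAffine_one : IsAffine (1 : Equiv.Perm (BinChar g)) id :=
  ⟨fun _ => rfl, fun _ _ => rfl⟩

lemma exists_isAffine {γ} (hγ : γ ∈ transvGroup g) : ∃ L, IsAffine γ L := by
  refine transvGroup_induction (P := fun γ => ∃ L, IsAffine γ L) ⟨_, isAffine_one⟩ ?_ hγ
  rintro x γ ⟨L, hL⟩
  exact ⟨_, (isAffine_transv x).comp hL⟩

/-- A sequence of characteristics whose first `2g+2` terms are pairwise azygetic and have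
the parities of the standard fundamental system. -/
def IsFrame (f : ℕ → BinChar g) : Prop :=
  (∀ i j k, i ≤ 2 * g + 1 → j ≤ 2 * g + 1 → k ≤ 2 * g + 1 → i ≠ j → i ≠ k → j ≠ k →
    Azyg (f i) (f j) (f k)) ∧
  ∀ j ≤ 2 * g + 1, parity (f j) = parity (stdChar g j)

lemma IsFrame.map {f : ℕ → BinChar g} (h : IsFrame f) {γ} (hγ : γ ∈ transvGroup g) :
    IsFrame (fun j => γ (f j)) := by
  obtain ⟨L, hL⟩ := exists_isAffine hγ
  exact ⟨fun i j k hi hj hk hij hik hjk => hL.azyg (h.1 i j k hi hj hk hij hik hjk),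
    fun j hj => (hL.parity_eq _).trans (h.2 j hj)⟩

lemma transv_single_step (f : ℕ → BinChar g) (r : ℕ) (Y' : BinChar g)
    (hY : ∀ i, 1 ≤ i → i ≤ r → weil (f 0 + f (r + 1)) (f 0 + f i) = 1)
    (hY' : ∀ i, 1 ≤ i → i ≤ r → weil Y' (f 0 + f i) = 1)
    (hYY' : weil (f 0 + f (r + 1)) Y' = 1) :
    ∃ x, (∀ i, 1 ≤ i → i ≤ r → transv x (f 0) + transv x (f i) = f 0 + f i) ∧
      transv x (f 0) + transv x (f (r + 1)) = Y' := by
  refine ⟨f 0 + f (r + 1) + Y', fun i h1 h2 => ?_, ?_⟩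
  · rw [transv_add_transv, weil_add_left, hY i h1 h2, hY' i h1 h2,
      show (1 + 1 : ZMod 2) = 0 from rfl, zero_smul, add_zero]
  · rw [transv_add_transv, weil_add_left, weil_self, zero_add, weil_comm, hYY', one_smul,
      ← add_assoc, add_self, zero_add]

lemma weil_sum_azyg (y : ℕ → BinChar g) (r i : ℕ) (hi : 1 ≤ i) (hir : i ≤ r)
    (h : ∀ a b, 1 ≤ a → a ≤ r → 1 ≤ b → b ≤ r → a ≠ b → weil (y a) (y b) = 1) :
    weil (∑ a ∈ Finset.Icc 1 r, y a) (y i) = (r : ZMod 2) + 1 := by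
  have hmem : i ∈ Finset.Icc 1 r := Finset.mem_Icc.2 ⟨hi, hir⟩
  rw [weil_sum_left, ← Finset.add_sum_erase _ _ hmem, weil_self, zero_add,
    Finset.sum_congr rfl (g := fun _ => (1 : ZMod 2))]
  · rw [Finset.sum_const, Finset.card_erase_of_mem hmem, Nat.card_Icc, nsmul_eq_mul, mul_one]
    obtain ⟨s, rfl⟩ : ∃ s, r = s + 1 := ⟨r - 1, by omega⟩
    simp only [Nat.add_sub_cancel, Nat.cast_add, Nat.cast_one]
    rw [add_assoc, show (1 + 1 : ZMod 2) = 0 from rfl, add_zero]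
  · intro a ha
    simp only [Finset.mem_erase, Finset.mem_Icc] at ha
    exact h a i ha.2.1 ha.2.2 hi hir ha.1

lemma weil_sum_const (y : ℕ → BinChar g) (r : ℕ) (z : BinChar g)
    (h : ∀ a, 1 ≤ a → a ≤ r → weil (y a) z = 1) :
    weil (∑ a ∈ Finset.Icc 1 r, y a) z = (r : ZMod 2) := by
  rw [weil_sum_left, Finset.sum_congr rfl (g := fun _ => (1 : ZMod 2))]
  · simp
  · intro a ha
    exact h a (Finset.mem_Icc.1 ha).1 (Finset.mem_Icc.1 ha).2

lemma exists_intermediate (y y' : ℕ → BinChar g) (n r : ℕ) (hr : r + 2 ≤ n)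
    (h : ∀ a b, 1 ≤ a → a ≤ n → 1 ≤ b → b ≤ n → a ≠ b → weil (y a) (y b) = 1)
    (h' : ∀ a b, 1 ≤ a → a ≤ n → 1 ≤ b → b ≤ n → a ≠ b → weil (y' a) (y' b) = 1)
    (heq : ∀ i, 1 ≤ i → i ≤ r → y i = y' i) (hne : weil (y (r + 1)) (y' (r + 1)) ≠ 1) :
    ∃ z, (∀ i, 1 ≤ i → i ≤ r → weil z (y i) = 1) ∧ weil (y (r + 1)) z = 1 ∧
      weil z (y' (r + 1)) = 1 := by
  have h0 : weil (y (r + 1)) (y' (r + 1)) = 0 := by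
    by_contra hc; exact hne (zmod_two_eq_one hc)
  set P := ∑ a ∈ Finset.Icc 1 r, y a with hP
  have hPi : ∀ i, 1 ≤ i → i ≤ r → weil P (y i) = (r : ZMod 2) + 1 := fun i h1 h2 =>
    weil_sum_azyg y r i h1 h2 fun a b ha1 ha2 hb1 hb2 hab =>
      h a b ha1 (by omega) hb1 (by omega) hab
  have hPY : weil P (y (r + 1)) = r := weil_sum_const y r _ fun a h1 h2 =>
    h a _ h1 (by omega) (by omega) (by omega) (by omega)
  have hPY' : weil P (y' (r + 1)) = r := weil_sum_const y r _ fun a h1 h2 => by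
    rw [heq a h1 h2]; exact h' a _ h1 (by omega) (by omega) (by omega) (by omega)
  rcases Nat.even_or_odd r with hev | hodd
  · have hr0 : (r : ZMod 2) = 0 := (ZMod.natCast_eq_zero_iff_even).2 hev
    have hw : weil (y (r + 2)) (y (r + 1)) = 1 :=
      h _ _ (by omega) (by omega) (by omega) (by omega) (by omega)
    have hf : weil (y' (r + 2)) (y' (r + 1)) = 1 :=
      h' _ _ (by omega) (by omega) (by omega) (by omega) (by omega)
    have hwi : ∀ i, 1 ≤ i → i ≤ r → weil (y (r + 2)) (y i) = 1 := fun i h1 h2 =>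
      h _ _ (by omega) (by omega) (by omega) (by omega) (by omega)
    have hfi : ∀ i, 1 ≤ i → i ≤ r → weil (y' (r + 2)) (y i) = 1 := fun i h1 h2 => by
      rw [heq i h1 h2]
      exact h' _ _ (by omega) (by omega) (by omega) (by omega) (by omega)
    by_cases c1 : weil (y (r + 2)) (y' (r + 1)) = 0
    · by_cases c2 : weil (y' (r + 2)) (y (r + 1)) = 0
      · refine ⟨y (r + 2) + y' (r + 2) + P, fun i h1 h2 => ?_, ?_, ?_⟩
        · rw [weil_add_left, weil_add_left, hwi i h1 h2, hfi i h1 h2, hPi i h1 h2, hr0]; rfl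
        · rw [weil_comm, weil_add_left, weil_add_left, hw, c2, hPY, hr0]; rfl
        · rw [weil_add_left, weil_add_left, hf, c1, hPY', hr0]; rfl
      · exact ⟨_, hfi, by rw [weil_comm]; exact zmod_two_eq_one c2, hf⟩
    · exact ⟨_, hwi, by rw [weil_comm]; exact hw, zmod_two_eq_one c1⟩
  · have hr1 : (r : ZMod 2) = 1 := ZMod.natCast_eq_one_iff_odd.2 hodd
    refine ⟨y (r + 1) + P, fun i h1 h2 => ?_, ?_, ?_⟩
    · rw [weil_add_left, hPi i h1 h2, hr1,
        h _ _ (by omega) (by omega) (by omega) (by omega) (by omega)]; rfl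
    · rw [weil_comm, weil_add_left, weil_self, hPY, hr1, zero_add]
    · rw [weil_add_left, h0, hPY', hr1, zero_add]

lemma IsFrame.exists_step {f : ℕ → BinChar g} (h : IsFrame f) (r : ℕ) (hr : r + 1 ≤ 2 * g)
    (heq : ∀ i, 1 ≤ i → i ≤ r → f 0 + f i = stdChar g i) :
    ∃ γ ∈ transvGroup g, ∀ i, 1 ≤ i → i ≤ r + 1 → γ (f 0) + γ (f i) = stdChar g i := by
  have hy : ∀ a b, 1 ≤ a → a ≤ 2 * g + 1 → 1 ≤ b → b ≤ 2 * g + 1 → a ≠ b →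
      weil (f 0 + f a) (f 0 + f b) = 1 := fun a b h1 h2 h3 h4 h5 =>
    h.1 0 a b (by omega) h2 h4 (by omega) (by omega) h5
  have hs : ∀ a b, 1 ≤ a → a ≤ 2 * g + 1 → 1 ≤ b → b ≤ 2 * g + 1 → a ≠ b →
      weil (stdChar g a) (stdChar g b) = 1 := fun a b h1 h2 h3 h4 h5 => weil_stdChar h1 h2 h3 h4 h5
  have hs' : ∀ i, 1 ≤ i → i ≤ r → weil (stdChar g (r + 1)) (f 0 + f i) = 1 := fun i h1 h2 => by
    rw [heq i h1 h2]; exact hs _ _ (by omega) (by omega) (by omega) (by omega) (by omega)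
  by_cases hc : weil (f 0 + f (r + 1)) (stdChar g (r + 1)) = 1
  · obtain ⟨x, hx1, hx2⟩ := transv_single_step f r _
      (fun i h1 h2 => hy _ _ (by omega) (by omega) h1 (by omega) (by omega)) hs' hc
    refine ⟨_, transv_mem x, fun i h1 h2 => ?_⟩
    rcases Nat.lt_or_ge r i with h3 | h3
    · obtain rfl : i = r + 1 := by omega
      exact hx2
    · rw [hx1 i h1 h3, heq i h1 h3]
  · obtain ⟨z, hz1, hz2, hz3⟩ := exists_intermediate (fun a => f 0 + f a) (stdChar g)
      (2 * g + 1) r (by omega) hy hs heq hc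
    obtain ⟨x, hx1, hx2⟩ := transv_single_step f r z
      (fun i h1 h2 => hy _ _ (by omega) (by omega) h1 (by omega) (by omega)) hz1 hz2
    obtain ⟨x', hx1', hx2'⟩ := transv_single_step (fun j => transv x (f j)) r (stdChar g (r + 1))
      (fun i h1 h2 => by rw [hx1 i h1 h2, hx2]; exact hz1 i h1 h2)
      (fun i h1 h2 => by rw [hx1 i h1 h2]; exact hs' i h1 h2) (by rw [hx2]; exact hz3)
    refine ⟨_, mul_mem (transv_mem x') (transv_mem x), fun i h1 h2 => ?_⟩
    rcases Nat.lt_or_ge r i with h3 | h3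
    · obtain rfl : i = r + 1 := by omega
      exact hx2'
    · exact (hx1' i h1 h3).trans ((hx1 i h1 h3).trans (heq i h1 h3))

/-- Transvections act transitively on ordered fundamental systems of a given parity type. -/
theorem IsFrame.exists_map_eq_stdChar {f : ℕ → BinChar g} (h : IsFrame f) :
    ∃ γ ∈ transvGroup g, ∀ j ≤ 2 * g + 1, γ (f j) = stdChar g j := by
  have main : ∀ r ≤ 2 * g, ∃ γ ∈ transvGroup g,
      ∀ i, 1 ≤ i → i ≤ r → γ (f 0) + γ (f i) = stdChar g i := by
    intro r
    induction r with
    | zero => exact fun _ => ⟨1, one_mem _, fun i h1 h2 => by omega⟩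
    | succ r ih =>
      intro hr
      obtain ⟨γ, hγ, h1⟩ := ih (by omega)
      obtain ⟨δ, hδ, h2⟩ := (h.map hγ).exists_step r hr h1
      exact ⟨δ * γ, mul_mem hδ hγ, h2⟩
  obtain ⟨γ, hγ, hd⟩ := main _ le_rfl
  have hf := h.map hγ
  set e : ℕ → BinChar g := fun j => γ (f j) with he
  have hd' : ∀ i, 1 ≤ i → i ≤ 2 * g → e i = e 0 + stdChar g i := fun i h1 h2 => by
    rw [← hd i h1 h2, ← add_assoc, add_self, zero_add]
  have h0 : e 0 = 0 := by
    refine eq_zero_of_weil_stdChar fun j h1 h2 => ?_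
    have p0 := hf.2 0 (by omega)
    have pj := hf.2 j (by omega)
    rw [stdChar_zero, parity_zero] at p0
    change parity (e j) = _ at pj
    change parity (e 0) = _ at p0
    rw [hd' j h1 h2, parity_add, p0, zero_add] at pj
    exact left_eq_add.1 pj.symm
  have hj : ∀ j ≤ 2 * g, e j = stdChar g j := by
    intro j hj
    rcases Nat.eq_zero_or_pos j with rfl | h1
    · rw [h0, stdChar_zero]
    · rw [hd' j h1 hj, h0, zero_add]
  refine ⟨γ, hγ, fun j hj2 => ?_⟩
  rcases Nat.lt_or_ge (2 * g) j with h3 | h3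
  · obtain rfl : j = 2 * g + 1 := by omega
    refine eq_of_add_eq_zero (eq_zero_of_weil_stdChar fun i h1 h2 => ?_)
    have := hf.1 0 (2 * g + 1) i (by omega) le_rfl (by omega) (by omega) (by omega) (by omega)
    change weil (e 0 + e (2 * g + 1)) (e 0 + e i) = 1 at this
    rw [h0, zero_add, zero_add, hj i h2] at this
    change weil (e (2 * g + 1) + _) _ = _
    rw [weil_add_left, this, weil_stdChar (by omega) (by omega) (by omega) (by omega) (by omega)]
    rfl
  · exact hj j h3

lemma weil_eq_one_of_parseval {ι : Type*} [Fintype ι] (hι : Fintype.card ι = 2 * g + 1)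
    (y : ι → BinChar g) (h0 : ∀ x, ∑ i, weil (y i) x = 0)
    (h : ∀ x x', ∑ i, weil (y i) x * weil (y i) x' = weil x x') {i j : ι} (hij : i ≠ j) :
    weil (y i) (y j) = 1 := by
  let ρ := Fintype.linearCombination (ZMod 2) y
  have hρ : ∀ c, ρ c = ∑ i, c i • y i := fun c => Fintype.linearCombination_apply _ _ _
  have hrep : ∀ x, ρ (fun i => weil (y i) x) = x := by
    intro x
    refine eq_of_add_eq_zero (eq_zero_of_weil fun x' => ?_)
    rw [weil_add_left, hρ, weil_sum_left]
    simp only [weil_smul_left]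
    rw [h]
    exact CharTwo.add_self_eq_zero _
  have hsurj : LinearMap.range ρ = ⊤ := LinearMap.range_eq_top.2 fun x => ⟨_, hrep x⟩
  have hker : Module.finrank (ZMod 2) (LinearMap.ker ρ) = 1 := by
    have := LinearMap.finrank_range_add_finrank_ker ρ
    rw [hsurj, finrank_top, Module.finrank_prod, Module.finrank_fintype_fun_eq_card,
      Module.finrank_fintype_fun_eq_card, hι, Fintype.card_fin] at this
    omega
  have hone : (fun _ => 1 : ι → ZMod 2) ∈ LinearMap.ker ρ := by
    rw [LinearMap.mem_ker, hρ]
    refine eq_zero_of_weil fun x => ?_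
    rw [weil_sum_left]
    simpa only [one_smul] using h0 x
  have hc : (fun i => weil (y i) (y j) + if i = j then 1 else 0 : ι → ZMod 2) ∈
      LinearMap.ker ρ := by
    rw [LinearMap.mem_ker]
    have : (fun i => weil (y i) (y j) + if i = j then 1 else 0 : ι → ZMod 2) =
        (fun i => weil (y i) (y j)) + Pi.single j 1 := by
      ext i; simp [Pi.single_apply]
    rw [this, map_add, hrep, hρ]
    simp [Pi.single_apply, add_self]
  have hne : (⟨_, hone⟩ : LinearMap.ker ρ) ≠ 0 := by
    intro hz
    have := congrFun (congrArg Subtype.val hz) j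
    exact one_ne_zero this
  obtain ⟨a, ha⟩ := (finrank_eq_one_iff_of_nonzero' _ hne).1 hker ⟨_, hc⟩
  have ha' := congrArg Subtype.val ha
  have hj := congrFun ha' j
  have hi := congrFun ha' i
  simp only [SetLike.mk_smul_mk, Pi.smul_apply, smul_eq_mul, mul_one, weil_self, if_true,
    zero_add, if_neg hij, add_zero] at hj hi
  rw [← hi, hj]

lemma azyg_of_quad {ι : Type*} [Fintype ι] (hι : Fintype.card ι = 2 * g + 2)
    (F : ι → BinChar g) (h0 : ∀ x, ∑ i, quad (F i) x = 0)
    (h : ∀ x x', ∑ i, quad (F i) x * quad (F i) x' = weil x x') {a b c : ι}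
    (hab : a ≠ b) (hac : a ≠ c) (hbc : b ≠ c) : Azyg (F a) (F b) (F c) := by
  have hq : ∀ i x, quad (F i) x = quad (F a) x + weil (F a + F i) x := by
    intro i x
    rw [← quad_add_left, ← add_assoc, add_self, zero_add]
  have hcard : ((2 * g + 2 : ℕ) : ZMod 2) = 0 :=
    (ZMod.natCast_eq_zero_iff_even).2 ⟨g + 1, by ring⟩
  have hs : ∀ f : ι → ZMod 2, f a = 0 → ∑ i : {i // i ≠ a}, f i.1 = ∑ i, f i := by
    intro f hf
    rw [Fintype.sum_eq_add_sum_subtype_ne f a, hf, zero_add]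
  have h0' : ∀ x, ∑ i, weil (F a + F i) x = 0 := by
    intro x
    have := (Finset.sum_congr rfl fun i _ => (hq i x).symm).trans (h0 x)
    rwa [Finset.sum_add_distrib, Finset.sum_const, Finset.card_univ, hι, nsmul_eq_mul, hcard,
      zero_mul, zero_add] at this
  have h1 : ∀ x x', ∑ i, weil (F a + F i) x * weil (F a + F i) x' = weil x x' := by
    intro x x'
    have := (Finset.sum_congr rfl fun i _ =>
      congrArg₂ (· * ·) (hq i x).symm (hq i x').symm).trans (h x x')
    simp only [add_mul, mul_add, Finset.sum_add_distrib, ← Finset.mul_sum, ← Finset.sum_mul,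
      h0'] at this
    rw [Finset.sum_const, Finset.card_univ, hι, nsmul_eq_mul, hcard] at this
    simpa using this
  refine weil_eq_one_of_parseval (ι := {i // i ≠ a}) (g := g) ?_ (fun i => F a + F i.1)
    (fun x => ?_) (fun x x' => ?_) (i := ⟨b, hab.symm⟩) (j := ⟨c, hac.symm⟩)
    (fun e => hbc (congrArg Subtype.val e))
  · rw [Fintype.card_subtype_compl, hι]; simp
  · rw [hs (fun i => weil (F a + F i) x) (by simp [add_self]), h0']
  · rw [hs (fun i => weil (F a + F i) x * weil (F a + F i) x') (by simp [add_self]), h1]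

/-- The representative in `{0, 1}` of a class modulo `2`, taken modulo `4`. -/
def lift4 (z : ZMod 2) : ZMod 4 := (z.val : ZMod 4)

/-- The embedding of `ℤ/2` in `ℤ/4`. -/
def double4 : ZMod 2 →+ ZMod 4 := AddMonoidHom.mk' (fun z => 2 * lift4 z) (by decide)

lemma lift4_add (a b c : ZMod 2) :
    lift4 (a + b + c) = lift4 a + lift4 b + lift4 c + double4 (a * b + c * a + c * b) := by
  revert a b c; decide

lemma azyg_of_lift4 (N : Fin g → BinChar g) (v : Fin (g + 2) → BinChar g)
    (hA : ∀ x, ∑ j, lift4 (quad (v j) x) = ∑ k, lift4 (quad (N k) x))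
    {a b c : Fin g ⊕ Fin (g + 2)} (hab : a ≠ b) (hac : a ≠ c) (hbc : b ≠ c) :
    Azyg (Sum.elim N v a) (Sum.elim N v b) (Sum.elim N v c) := by
  have hsum : ∀ x, ∑ j, quad (v j) x = ∑ k, quad (N k) x := by
    intro x
    have hc : ∀ z : ZMod 2, (ZMod.castHom (show 2 ∣ 4 by decide) (ZMod 2)) (lift4 z) = z := by
      decide
    have := congrArg (ZMod.castHom (show 2 ∣ 4 by decide) (ZMod 2)) (hA x)
    simpa only [map_sum, hc] using this
  refine azyg_of_quad ?_ _ (fun x => ?_) (fun x x' => ?_) hab hac hbc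
  · simp; omega
  · rw [Fintype.sum_sum_type]
    simp only [Sum.elim_inl, Sum.elim_inr, hsum]
    exact CharTwo.add_self_eq_zero _
  · rw [Fintype.sum_sum_type]
    simp only [Sum.elim_inl, Sum.elim_inr]
    have h := hA (x + x')
    simp only [quad_add, lift4_add, Finset.sum_add_distrib, hA, ← map_sum, ← Finset.mul_sum,
      hsum, Finset.sum_const, Finset.card_univ, Fintype.card_fin] at h
    have hinj : Function.Injective double4 := by decide
    have hd : double4 (weil x x') = 2 * lift4 (weil x x') := rfl
    have h2 : double4 (weil x x' + ∑ j, quad (v j) x * quad (v j) x') =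
        double4 (∑ k, quad (N k) x * quad (N k) x') := by
      rw [map_add, hd]
      simp only [map_add, nsmul_eq_mul] at h
      push_cast at h
      linear_combination h
    rw [← hinj h2, add_assoc, CharTwo.add_self_eq_zero, add_zero]

lemma injective_of_azyg {ι : Type*} [Fintype ι] (hι : 3 ≤ Fintype.card ι) (F : ι → BinChar g)
    (h : ∀ a b c, a ≠ b → a ≠ c → b ≠ c → Azyg (F a) (F b) (F c)) : Function.Injective F := by
  intro a b hF
  by_contra hab
  obtain ⟨c, hc⟩ : ∃ c, c ∉ ({a, b} : Finset ι) := by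
    by_contra! hcon
    have h1 : Finset.univ ⊆ ({a, b} : Finset ι) := fun c _ => hcon c
    have h2 := Finset.card_le_card h1
    have h3 : ({a, b} : Finset ι).card ≤ 2 := Finset.card_le_two
    rw [Finset.card_univ] at h2
    omega
  simp only [Finset.mem_insert, Finset.mem_singleton, not_or] at hc
  have := h a b c hab (Ne.symm hc.1) (Ne.symm hc.2)
  rw [Azyg, hF, add_self, weil_zero_left] at this
  exact zero_ne_one this

/-- The odd members of the standard fundamental system. -/
def stdOdd (g : ℕ) (k : Fin g) : BinChar g := stdChar g (2 * k + 2)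

/-- The even members of the standard fundamental system. -/
def stdEven (g : ℕ) (j : Fin (g + 2)) : BinChar g := stdChar g (2 * j - 1)

lemma weil_stdOdd (m : BinChar g) (j : Fin g) :
    weil m (stdOdd g j) = (∑ i, if i ≤ j then m.1 i else 0) + m.2 j := by
  rw [weil, Finset.sum_add_distrib]
  congr 1
  · refine Finset.sum_congr rfl fun i _ => ?_
    simp only [stdOdd, stdChar, mul_ite, mul_one, mul_zero, Fin.le_def]
    refine if_congr ?_ rfl rfl
    omega
  · have := sum_stdChar_fst (2 * j.1 + 2) m.2 j.1 j.2 (by simp)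
    exact (Finset.sum_congr rfl fun i _ => mul_comm _ _).trans this

lemma exists_eq_stdEven {m : BinChar g} (hm : ∀ i, ¬ (m.1 i = 1 ∧ m.2 i = 1))
    (hazy : ∀ j k, j ≠ k → weil m (stdOdd g j) = weil m (stdOdd g k)) :
    ∃ j, m = stdEven g j := by
  have hz : ∀ i, m.1 i ≠ 0 → m.2 i = 0 := by
    intro i h1
    by_contra h2
    exact hm i ⟨zmod_two_eq_one h1, zmod_two_eq_one h2⟩
  have hazy' : ∀ j k, weil m (stdOdd g j) = weil m (stdOdd g k) := by
    intro j k
    by_cases h : j = k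
    · rw [h]
    · exact hazy j k h
  simp only [weil_stdOdd] at hazy'
  by_cases hA : ∀ i, m.1 i = 0
  · simp only [hA, ite_self, Finset.sum_const_zero, zero_add] at hazy'
    by_cases hB : ∀ i, m.2 i = 0
    · exact ⟨0, by ext i <;> simp [hA, hB, stdEven, stdChar]⟩
    · push Not at hB
      obtain ⟨i0, hi0⟩ := hB
      refine ⟨Fin.last _, ?_⟩
      ext i
      · have := i.2
        rw [hA]
        simp only [stdEven, stdChar, Fin.val_last]
        rw [if_neg (by omega)]
      · have := i.2
        rw [hazy' i i0, zmod_two_eq_one hi0]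
        simp only [stdEven, stdChar, Fin.val_last]
        rw [if_pos (by omega)]
  · push Not at hA
    obtain ⟨k, hk, hmin⟩ : ∃ k, m.1 k ≠ 0 ∧ ∀ i < k, m.1 i = 0 := by
      obtain ⟨k, hk, hmin⟩ := WellFounded.has_min (wellFounded_lt (α := Fin g))
        {i | m.1 i ≠ 0} hA
      exact ⟨k, hk, fun i hi => by by_contra h; exact hmin i h hi⟩
    have hsum : ∀ j, (∀ i, i ≤ j → m.1 i ≠ 0 → i = k) → k ≤ j →
        (∑ i, if i ≤ j then m.1 i else 0) = 1 := by
      intro j hj hkj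
      rw [Finset.sum_eq_single k]
      · rw [if_pos hkj, zmod_two_eq_one hk]
      · intro i _ hik
        split_ifs with h
        · by_contra h'
          exact hik (hj i h h')
        · rfl
      · simp
    have hck : (∑ i, if i ≤ k then m.1 i else 0) + m.2 k = 1 := by
      rw [hsum k (fun i hi hi' => ?_) le_rfl, hz k hk, add_zero]
      by_contra h
      exact hi' (hmin i (lt_of_le_of_ne hi h))
    have hgt : ∀ j, k < j → m.1 j = 0 := by
      intro j
      induction j using WellFoundedLT.induction with
      | ind j ih =>
        intro hkj
        by_contra hj
        have e := (hazy' j k).trans hck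
        rw [hz j hj, add_zero, ← Finset.add_sum_erase _ _ (Finset.mem_univ j),
          if_pos le_rfl, zmod_two_eq_one hj] at e
        have e2 : (∑ i ∈ Finset.univ.erase j, if i ≤ j then m.1 i else 0) = 1 := by
          rw [Finset.sum_eq_single k]
          · rw [if_pos hkj.le, zmod_two_eq_one hk]
          · intro i hi hik
            split_ifs with h
            · rcases lt_or_gt_of_ne hik with h' | h'
              · exact hmin i h'
              · exact ih i (lt_of_le_of_ne h (Finset.ne_of_mem_erase hi)) h'
            · rfl
          · intro h
            exact absurd (Finset.mem_erase.2 ⟨hkj.ne, Finset.mem_univ _⟩) h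
        rw [e2] at e
        exact absurd e (by decide)
    have hsup : ∀ i, m.1 i ≠ 0 → i = k := by
      intro i hi
      rcases lt_trichotomy i k with h | h | h
      · exact absurd (hmin i h) hi
      · exact h
      · exact absurd (hgt i h) hi
    refine ⟨⟨k.1 + 1, by omega⟩, ?_⟩
    ext i
    · simp only [stdEven, stdChar]
      by_cases h : i = k
      · rw [h, zmod_two_eq_one hk, if_pos (by omega)]
      · have h' : i.1 ≠ k.1 := fun e => h (Fin.ext e)
        rw [if_neg (by omega)]
        by_contra h2
        exact h (hsup i h2)
    · simp only [stdEven, stdChar]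
      have e := (hazy' i k).trans hck
      rcases lt_trichotomy i k with h | h | h
      · rw [if_pos (by rw [Fin.lt_def] at h; omega)]
        rw [Finset.sum_eq_zero, zero_add] at e
        · exact e
        · intro l _
          split_ifs with h'
          · exact hmin l (lt_of_le_of_lt h' h)
          · rfl
      · rw [h, hz k hk, if_neg (by omega)]
      · rw [if_neg (by rw [Fin.lt_def] at h; omega)]
        rw [hsum i (fun l _ => hsup l) h.le] at e
        exact add_eq_left.1 e

/-- The theta characteristic with entries `0, 1/2` given by a binary characteristic. -/
def ch (k : BinChar g) : ThetaChar g :=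
  (fun i => ((k.1 i).val : ℝ) / 2, fun i => ((k.2 i).val : ℝ) / 2)

/-- The point `n + η'` of the shifted lattice. -/
def pt (k : BinChar g) (n : Fin g → ℤ) (i : Fin g) : ℝ := n i + ((k.1 i).val : ℝ) / 2

/-- The quadratic form `ᵗx τ x`. -/
def qf {R : Type*} [CommRing R] (τ : Matrix (Fin g) (Fin g) R) (x : Fin g → R) : R :=
  ∑ i, ∑ j, x i * τ i j * x j

/-- The general term of the theta series. -/
def term (k : BinChar g) (z : Fin g → ℂ) (τ : Matrix (Fin g) (Fin g) ℂ) (n : Fin g → ℤ) : ℂ :=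
  Complex.exp (Real.pi * Complex.I * qf τ (fun i => (pt k n i : ℂ)) +
    2 * Real.pi * Complex.I * ∑ i, (pt k n i : ℂ) * (z i + ((k.2 i).val : ℂ) / 2))

lemma theta_ch (k : BinChar g) (z : Fin g → ℂ) (τ : Matrix (Fin g) (Fin g) ℂ) :
    theta (ch k) z τ = ∑' n, term k z τ n := by
  simp only [theta, term, ch, qf, pt]
  push_cast
  rfl

lemma summable_exp_neg_abs : Summable fun n : ℤ => Real.exp (-|(n : ℝ)|) := by
  refine Summable.of_nat_of_neg ?_ ?_ <;> simpa using Real.summable_exp_neg_nat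

lemma gaussian_le (δ C a : ℝ) (hδ : 0 < δ) (n : ℤ) :
    Real.exp (-δ * (n + a) ^ 2 + C * |n + a|) ≤
      Real.exp ((C + 1) ^ 2 / (4 * δ) + |a|) * Real.exp (-|(n : ℝ)|) := by
  rw [← Real.exp_add, Real.exp_le_exp]
  have h1 : |(n : ℝ)| ≤ |n + a| + |a| := by
    have := abs_sub (n + a) a
    rwa [add_sub_cancel_right] at this
  have h2 : (C + 1) ^ 2 / (4 * δ) - (C + 1) * |n + a| + δ * |n + a| ^ 2 =
      δ * (|n + a| - (C + 1) / (2 * δ)) ^ 2 := by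
    field_simp; ring
  have h3 : 0 ≤ δ * (|n + a| - (C + 1) / (2 * δ)) ^ 2 := by positivity
  rw [← sq_abs (n + a)]
  nlinarith

lemma summable_prod {g : ℕ} (f : Fin g → ℤ → ℝ) (hf : ∀ i n, 0 ≤ f i n)
    (hs : ∀ i, Summable (f i)) : Summable fun n : Fin g → ℤ => ∏ i, f i (n i) := by
  induction g with
  | zero => exact Summable.of_finite
  | succ g ih =>
    have h := (hs 0).mul_of_nonneg (ih (fun i => f i.succ) (fun i n => hf _ _) fun i => hs _)
      (fun n => hf 0 n) (fun n => Finset.prod_nonneg fun i _ => hf _ _)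
    rw [← (Fin.consEquiv fun _ => ℤ).summable_iff]
    refine h.congr fun x => ?_
    simp [Fin.prod_univ_succ, Fin.consEquiv]

lemma summable_gaussian (k : BinChar g) (δ C : ℝ) (hδ : 0 < δ) :
    Summable fun n : Fin g → ℤ => ∏ i, Real.exp (-δ * pt k n i ^ 2 + C * |pt k n i|) := by
  refine summable_prod (fun i (n : ℤ) => Real.exp (-δ * (n + ((k.1 i).val : ℝ) / 2) ^ 2 +
    C * |n + ((k.1 i).val : ℝ) / 2|)) (fun i n => (Real.exp_pos _).le) fun i => ?_
  exact Summable.of_nonneg_of_le (fun n => (Real.exp_pos _).le)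
    (fun n => gaussian_le δ C _ hδ n) (summable_exp_neg_abs.mul_left _)

lemma qf_posDef {τ : Matrix (Fin g) (Fin g) ℝ} (h : τ.PosDef) {x : Fin g → ℝ} (hx : x ≠ 0) :
    0 < qf τ x := by
  have := h.dotProduct_mulVec_pos hx
  simpa [qf, dotProduct, Matrix.mulVec, Finset.mul_sum, mul_assoc] using this

lemma qf_im (τ : Matrix (Fin g) (Fin g) ℂ) (x : Fin g → ℝ) :
    (qf τ (fun i => (x i : ℂ))).im = qf (τ.map Complex.im) x := by
  simp [qf, Complex.im_sum]

lemma exists_lower_bound {τ : Matrix (Fin g) (Fin g) ℝ} (h : τ.PosDef) :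
    ∃ δ > 0, ∀ x, δ * ∑ i, x i ^ 2 ≤ qf τ x := by
  have hc : IsCompact {x : Fin g → ℝ | ∑ i, x i ^ 2 = 1} := by
    refine Metric.isCompact_of_isClosed_isBounded
      (isClosed_eq (by fun_prop) continuous_const) ?_
    refine (Metric.isBounded_closedBall (x := 0) (r := 1)).subset fun x hx => ?_
    rw [mem_closedBall_zero_iff, pi_norm_le_iff_of_nonneg zero_le_one]
    intro i
    have h1 : x i ^ 2 ≤ 1 := by
      rw [← show ∑ i, x i ^ 2 = 1 from hx]
      exact Finset.single_le_sum (f := fun i => x i ^ 2) (fun i _ => sq_nonneg _)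
        (Finset.mem_univ i)
    exact abs_le_one_iff_mul_self_le_one.2 (by nlinarith)
  have hcont : Continuous (qf τ) := by unfold qf; fun_prop
  obtain ⟨δ, hδ, hb⟩ : ∃ δ > 0, ∀ x ∈ {x : Fin g → ℝ | ∑ i, x i ^ 2 = 1}, δ ≤ qf τ x := by
    rcases Set.eq_empty_or_nonempty {x : Fin g → ℝ | ∑ i, x i ^ 2 = 1} with he | hne
    · exact ⟨1, one_pos, fun x hx => by rw [he] at hx; exact hx.elim⟩
    · obtain ⟨x0, hx0, hmin⟩ := hc.exists_isMinOn hne hcont.continuousOn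
      refine ⟨qf τ x0, qf_posDef h ?_, fun x hx => hmin hx⟩
      rintro rfl
      simp at hx0
  refine ⟨δ, hδ, fun x => ?_⟩
  rcases (Finset.sum_nonneg fun i _ => sq_nonneg (x i) : 0 ≤ ∑ i, x i ^ 2).eq_or_lt with h0 | h0
  · rw [← h0, mul_zero]
    by_cases hx : x = 0
    · simp [hx, qf]
    · exact (qf_posDef h hx).le
  · set S := ∑ i, x i ^ 2 with hS
    have hS2 := Real.mul_self_sqrt h0.le
    have hSp := Real.sqrt_pos.2 h0
    have := hb (fun i => x i / √S) (by
      simp only [Set.mem_ofPred_eq, div_pow, Real.sq_sqrt h0.le, ← Finset.sum_div, ← hS]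
      exact div_self h0.ne')
    have h2 : qf τ (fun i => x i / √S) = qf τ x / S := by
      simp only [qf, Finset.sum_div]
      refine Finset.sum_congr rfl fun i _ => Finset.sum_congr rfl fun j _ => ?_
      rw [div_mul_eq_mul_div, div_mul_div_comm, hS2]
    rw [h2, le_div_iff₀ h0] at this
    exact this

lemma norm_term (k : BinChar g) (z : Fin g → ℂ) (τ : Matrix (Fin g) (Fin g) ℂ)
    (n : Fin g → ℤ) :
    ‖term k z τ n‖ = Real.exp (-Real.pi * qf (τ.map Complex.im) (pt k n) -
      2 * Real.pi * ∑ i, pt k n i * (z i).im) := by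
  rw [term, Complex.norm_exp]
  congr 1
  rw [Complex.add_re, ← qf_im]
  have h1 : ∀ w : ℂ, (Real.pi * Complex.I * w).re = -Real.pi * w.im := by
    intro w; simp
  have h2 : ∀ w : ℂ, (2 * Real.pi * Complex.I * w).re = -(2 * Real.pi * w.im) := by
    intro w; simp
  rw [h1, h2, Complex.im_sum, sub_eq_add_neg]
  congr 4
  ext i
  have : (((k.2 i).val : ℂ) / 2).im = 0 := by
    rw [show (((k.2 i).val : ℂ) / 2) = (((k.2 i).val / 2 : ℝ) : ℂ) by push_cast; rfl]
    exact Complex.ofReal_im _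
  rw [Complex.im_ofReal_mul, Complex.add_im, this, add_zero]

lemma norm_term_le {τ : Matrix (Fin g) (Fin g) ℂ} {δ : ℝ}
    (hδ : ∀ x, δ * ∑ i, x i ^ 2 ≤ qf (τ.map Complex.im) x) (k : BinChar g) {z : Fin g → ℂ}
    {C : ℝ} (hz : ∀ i, ‖z i‖ ≤ C) (n : Fin g → ℤ) :
    ‖term k z τ n‖ ≤
      ∏ i, Real.exp (-(Real.pi * δ) * pt k n i ^ 2 + 2 * Real.pi * C * |pt k n i|) := by
  rw [norm_term, ← Real.exp_sum, Real.exp_le_exp, Finset.sum_add_distrib, ← Finset.mul_sum,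
    ← Finset.mul_sum]
  have h1 := mul_le_mul_of_nonneg_left (hδ (pt k n)) Real.pi_pos.le
  have h2 : -∑ i, pt k n i * (z i).im ≤ C * ∑ i, |pt k n i| := by
    rw [← Finset.sum_neg_distrib, Finset.mul_sum]
    refine Finset.sum_le_sum fun i _ => ?_
    have h3 := neg_abs_le (pt k n i * (z i).im)
    rw [abs_mul] at h3
    have h4 := mul_le_mul_of_nonneg_left ((Complex.abs_im_le_norm (z i)).trans (hz i))
      (abs_nonneg (pt k n i))
    linarith
  have h3 := mul_le_mul_of_nonneg_left h2 (by positivity : 0 ≤ 2 * Real.pi)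
  linarith

lemma abs_le_prod_exp (x : Fin g → ℝ) (l : Fin g) : |x l| ≤ ∏ i, Real.exp |x i| := by
  rw [← Real.exp_sum]
  calc |x l| ≤ ∑ i, |x i| :=
        Finset.single_le_sum (f := fun i => |x i|) (fun i _ => abs_nonneg _) (Finset.mem_univ l)
    _ ≤ Real.exp (∑ i, |x i|) := by linarith [Real.add_one_le_exp (∑ i, |x i|)]

lemma summable_term {τ : Matrix (Fin g) (Fin g) ℂ} (hτ : IsSiegel τ) (k : BinChar g)
    (z : Fin g → ℂ) : Summable (term k z τ) := by
  obtain ⟨δ, hδ, h⟩ := exists_lower_bound hτ.2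
  refine Summable.of_norm_bounded
    (summable_gaussian k (Real.pi * δ) (2 * Real.pi * ‖z‖) (by positivity)) fun n => ?_
  exact norm_term_le h k (fun i => norm_le_pi_norm z i) n

/-- The gradient of the theta function at the origin. -/
def grad (k : BinChar g) (τ : Matrix (Fin g) (Fin g) ℂ) (l : Fin g) : ℂ :=
  fderiv ℂ (fun z : Fin g → ℂ => theta (ch k) z τ) 0 (Pi.single l 1)

/-- The derivative of the exponent of the theta series. -/
def dterm (k : BinChar g) (n : Fin g → ℤ) : (Fin g → ℂ) →L[ℂ] ℂ :=
  (2 * Real.pi * Complex.I) • ∑ i, (pt k n i : ℂ) • ContinuousLinearMap.proj (R := ℂ) i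

lemma dterm_apply (k : BinChar g) (n : Fin g → ℤ) (z : Fin g → ℂ) :
    dterm k n z = 2 * Real.pi * Complex.I * ∑ i, (pt k n i : ℂ) * z i := by
  simp [dterm]

lemma norm_dterm_le (k : BinChar g) (n : Fin g → ℤ) :
    ‖dterm k n‖ ≤ 2 * Real.pi * ∏ i, Real.exp |pt k n i| := by
  refine ContinuousLinearMap.opNorm_le_bound _ (by positivity) fun z => ?_
  rw [dterm_apply, norm_mul, mul_assoc (2 * Real.pi : ℝ)]
  have h0 : ‖(2 * Real.pi * Complex.I : ℂ)‖ = 2 * Real.pi := by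
    simp [abs_of_pos Real.pi_pos]
  rw [h0]
  refine mul_le_mul_of_nonneg_left ?_ (by positivity)
  calc ‖∑ i, (pt k n i : ℂ) * z i‖ ≤ ∑ i, |pt k n i| * ‖z‖ := by
        refine (norm_sum_le _ _).trans (Finset.sum_le_sum fun i _ => ?_)
        rw [norm_mul, Complex.norm_real, Real.norm_eq_abs]
        exact mul_le_mul_of_nonneg_left (norm_le_pi_norm z i) (abs_nonneg _)
    _ ≤ _ := by
        rw [← Finset.sum_mul, ← Real.exp_sum]
        refine mul_le_mul_of_nonneg_right ?_ (norm_nonneg _)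
        linarith [Real.add_one_le_exp (∑ i, |pt k n i|)]

lemma hasFDerivAt_term (k : BinChar g) (τ : Matrix (Fin g) (Fin g) ℂ) (n : Fin g → ℤ)
    (z : Fin g → ℂ) :
    HasFDerivAt (fun z => term k z τ n) (term k z τ n • dterm k n) z := by
  unfold term
  refine HasFDerivAt.cexp ?_
  have h1 := (dterm k n).hasFDerivAt (x := z)
  have h2 := h1.const_add (Real.pi * Complex.I * qf τ (fun i => (pt k n i : ℂ)) +
    2 * Real.pi * Complex.I * ∑ i, (pt k n i : ℂ) * (((k.2 i).val : ℂ) / 2))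
  refine h2.congr_of_eventuallyEq (Filter.Eventually.of_forall fun y => ?_)
  simp only [dterm_apply, mul_add, Finset.sum_add_distrib]
  ring

lemma summable_grad_bound (k : BinChar g) {δ C : ℝ} (hδ : 0 < δ) :
    Summable fun n : Fin g → ℤ => (∏ i, Real.exp (-δ * pt k n i ^ 2 + C * |pt k n i|)) *
      (2 * Real.pi * ∏ i, Real.exp |pt k n i|) := by
  refine ((summable_gaussian k δ (C + 1) hδ).mul_left (2 * Real.pi)).congr fun n => ?_
  rw [mul_left_comm, ← Finset.prod_mul_distrib]
  congr 1
  refine Finset.prod_congr rfl fun i _ => ?_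
  rw [← Real.exp_add]
  ring_nf

lemma hasFDerivAt_theta {τ : Matrix (Fin g) (Fin g) ℂ} (hτ : IsSiegel τ) (k : BinChar g) :
    HasFDerivAt (fun z : Fin g → ℂ => theta (ch k) z τ)
      (∑' n, term k 0 τ n • dterm k n) 0 := by
  obtain ⟨δ, hδ, h⟩ := exists_lower_bound hτ.2
  simp only [theta_ch]
  refine hasFDerivAt_tsum_of_isPreconnected (s := Metric.ball 0 1)
    (summable_grad_bound k (C := 2 * Real.pi * 1) (by positivity : 0 < Real.pi * δ))
    Metric.isOpen_ball (convex_ball _ _).isPreconnected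
    (fun n z _ => hasFDerivAt_term k τ n z) (fun n z hz => ?_) (Metric.mem_ball_self one_pos)
    (summable_term hτ k 0) (Metric.mem_ball_self one_pos)
  rw [norm_smul]
  refine mul_le_mul (norm_term_le h k (fun i => ?_) n) (norm_dterm_le k n) (norm_nonneg _)
    (by positivity)
  exact (norm_le_pi_norm z i).trans (mem_ball_zero_iff.1 hz).le

lemma grad_eq {τ : Matrix (Fin g) (Fin g) ℂ} (hτ : IsSiegel τ) (k : BinChar g) (l : Fin g) :
    grad k τ l = ∑' n, 2 * Real.pi * Complex.I * pt k n l * term k 0 τ n := by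
  obtain ⟨δ, hδ, h⟩ := exists_lower_bound hτ.2
  rw [grad, (hasFDerivAt_theta hτ k).fderiv]
  have hs : Summable fun n => term k 0 τ n • dterm k n := by
    refine Summable.of_norm_bounded
      (summable_grad_bound k (C := 2 * Real.pi * 0) (by positivity : 0 < Real.pi * δ))
      fun n => ?_
    rw [norm_smul]
    exact mul_le_mul (norm_term_le h k (fun i => by simp) n) (norm_dterm_le k n)
      (norm_nonneg _) (by positivity)
  have := (ContinuousLinearMap.apply ℂ ℂ (Pi.single l 1 : Fin g → ℂ)).map_tsum hs
  rw [ContinuousLinearMap.apply_apply] at this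
  rw [this]
  refine tsum_congr fun n => ?_
  simp [dterm_apply, Pi.single_apply]
  ring

/-- The reflection of `ℤ^g` covering `x ↦ -x` on the shifted lattice. -/
def reflect (k : BinChar g) : Equiv.Perm (Fin g → ℤ) :=
  Function.Involutive.toPerm (fun n i => -n i - (k.1 i).val) (fun n => by ext i; simp)

lemma pt_reflect (k : BinChar g) (n : Fin g → ℤ) (i : Fin g) :
    pt k (reflect k n) i = -pt k n i := by
  change ((-n i - ((k.1 i).val : ℤ) : ℤ) : ℝ) + ((k.1 i).val : ℝ) / 2 =
    -((n i : ℝ) + ((k.1 i).val : ℝ) / 2)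
  push_cast
  ring

lemma qf_neg {R : Type*} [CommRing R] (τ : Matrix (Fin g) (Fin g) R) (x : Fin g → R) :
    qf τ (fun i => -x i) = qf τ x := by
  simp [qf]

lemma exp_eq_of_even {X Y : ℂ} (M : ℤ) (hM : (M : ZMod 2) = 0)
    (h : X = Y + Real.pi * Complex.I * M) : Complex.exp X = Complex.exp Y := by
  obtain ⟨q, rfl⟩ := (ZMod.intCast_zmod_eq_zero_iff_dvd M 2).1 hM
  rw [Complex.exp_eq_exp_iff_exists_int]
  exact ⟨q, by rw [h]; push_cast; ring⟩

lemma term_reflect {k : BinChar g} (hk : parity k = 1) (τ : Matrix (Fin g) (Fin g) ℂ)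
    (n : Fin g → ℤ) : term k 0 τ (reflect k n) = -term k 0 τ n := by
  have h : ∀ X : ℂ, -Complex.exp X = Complex.exp (X + Real.pi * Complex.I) := by
    intro X; rw [Complex.exp_add, Complex.exp_pi_mul_I]; ring
  simp only [term, pt_reflect, h, Complex.ofReal_neg, qf_neg]
  refine exp_eq_of_even (-1 - 2 * ∑ i, n i * (k.2 i).val - ∑ i, (k.1 i).val * (k.2 i).val) ?_ ?_
  · push_cast
    simp only [ZMod.natCast_zmod_val]
    rw [← parity, hk]
    generalize ∑ i, (n i : ZMod 2) * k.2 i = c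
    revert c; decide
  · have : ∑ i, (pt k n i : ℂ) * ((0 : Fin g → ℂ) i + ((k.2 i).val : ℂ) / 2) =
        (∑ i, (n i : ℂ) * (k.2 i).val) / 2 + (∑ i, ((k.1 i).val : ℂ) * (k.2 i).val) / 4 := by
      rw [Finset.sum_div, Finset.sum_div, ← Finset.sum_add_distrib]
      refine Finset.sum_congr rfl fun i _ => ?_
      simp only [pt, Pi.zero_apply]
      push_cast; ring
    simp only [neg_mul, Finset.sum_neg_distrib, this]
    push_cast
    ring

lemma theta_eq_zero {k : BinChar g} (hk : parity k = 1) (τ : Matrix (Fin g) (Fin g) ℂ) :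
    theta (ch k) 0 τ = 0 := by
  have h : ∑' n, term k 0 τ n = -∑' n, term k 0 τ n := by
    conv_lhs => rw [← (reflect k).tsum_eq]
    simp only [term_reflect hk, tsum_neg]
  rw [theta_ch]
  linear_combination h / 2

/-- The matrix `-τ̄`. -/
def negConj (τ : Matrix (Fin g) (Fin g) ℂ) : Matrix (Fin g) (Fin g) ℂ :=
  Matrix.of fun i j => -(starRingEnd ℂ) (τ i j)

lemma isSiegel_negConj {τ : Matrix (Fin g) (Fin g) ℂ} (hτ : IsSiegel τ) :
    IsSiegel (negConj τ) := by
  refine ⟨?_, ?_⟩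
  · ext i j
    simp only [negConj, Matrix.transpose_apply, Matrix.of_apply]
    rw [hτ.1.apply]
  · convert hτ.2 using 1
    ext i j
    simp [negConj]

lemma term_negConj (k : BinChar g) (τ : Matrix (Fin g) (Fin g) ℂ) (n : Fin g → ℤ) :
    term k 0 (negConj τ) (reflect k n) = (starRingEnd ℂ) (term k 0 τ n) := by
  rw [term, term, ← Complex.exp_conj]
  simp only [pt_reflect, Complex.ofReal_neg, qf_neg]
  congr 1
  simp only [qf, negConj, map_add, map_mul, map_sum, Complex.conj_ofReal, Complex.conj_I,
    Matrix.of_apply, Pi.zero_apply, zero_add, map_div₀, Complex.conj_ofNat, map_natCast,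
    neg_mul, mul_neg, Finset.sum_neg_distrib]

lemma conj_theta (k : BinChar g) (τ : Matrix (Fin g) (Fin g) ℂ) :
    theta (ch k) 0 (negConj τ) = (starRingEnd ℂ) (theta (ch k) 0 τ) := by
  rw [theta_ch, theta_ch, Complex.conj_tsum, ← (reflect k).tsum_eq]
  simp only [term_negConj]

lemma conj_grad {τ : Matrix (Fin g) (Fin g) ℂ} (hτ : IsSiegel τ) (k : BinChar g) (l : Fin g) :
    grad k (negConj τ) l = (starRingEnd ℂ) (grad k τ l) := by
  rw [grad_eq hτ, grad_eq (isSiegel_negConj hτ), Complex.conj_tsum, ← (reflect k).tsum_eq]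
  refine tsum_congr fun n => ?_
  rw [term_negConj, pt_reflect]
  simp only [map_mul, Complex.conj_ofReal, Complex.conj_I, Complex.conj_ofNat]
  push_cast
  ring

/-- The Jacobian Nullwert of a tuple of binary characteristics. -/
def jac (N : Fin g → BinChar g) (τ : Matrix (Fin g) (Fin g) ℂ) : ℂ :=
  Matrix.det (Matrix.of fun k l => grad (N k) τ l)

lemma conj_jac {τ : Matrix (Fin g) (Fin g) ℂ} (hτ : IsSiegel τ) (N : Fin g → BinChar g) :
    jac N (negConj τ) = (starRingEnd ℂ) (jac N τ) := by
  simp only [jac, conj_grad hτ]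
  rw [RingHom.map_det]
  rfl

/-- The translate `τ + c · w ᵗw`. -/
def shift (c : ℝ) (w : Fin g → ZMod 2) (τ : Matrix (Fin g) (Fin g) ℂ) :
    Matrix (Fin g) (Fin g) ℂ :=
  Matrix.of fun i j => τ i j + c * ((w i).val * (w j).val)

lemma isSiegel_shift {τ : Matrix (Fin g) (Fin g) ℂ} (hτ : IsSiegel τ) (c : ℝ)
    (w : Fin g → ZMod 2) : IsSiegel (shift c w τ) := by
  refine ⟨?_, ?_⟩
  · ext i j
    simp only [shift, Matrix.transpose_apply, Matrix.of_apply]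
    rw [hτ.1.apply]
    ring
  · convert hτ.2 using 1
    ext i j
    have : ((c : ℂ) * (((w i).val : ℂ) * ((w j).val : ℂ))).im = 0 := by
      rw [show (c : ℂ) * (((w i).val : ℂ) * ((w j).val : ℂ)) =
        ((c * ((w i).val * (w j).val) : ℝ) : ℂ) by push_cast; rfl]
      exact Complex.ofReal_im _
    simp only [shift, Matrix.map_apply, Matrix.of_apply, Complex.add_im, this, add_zero]

lemma shift_shift (c d : ℝ) (w : Fin g → ZMod 2) (τ : Matrix (Fin g) (Fin g) ℂ) :
    shift c w (shift d w τ) = shift (c + d) w τ := by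
  ext i j
  simp only [shift, Matrix.of_apply]
  push_cast; ring

lemma shift_zero (w : Fin g → ZMod 2) (τ : Matrix (Fin g) (Fin g) ℂ) : shift 0 w τ = τ := by
  ext i j
  simp [shift]

lemma qf_shift (c : ℝ) (w : Fin g → ZMod 2) (τ : Matrix (Fin g) (Fin g) ℂ) (x : Fin g → ℂ) :
    qf (shift c w τ) x = qf τ x + c * (∑ i, x i * (w i).val) ^ 2 := by
  rw [sq, Finset.sum_mul_sum, Finset.mul_sum]
  simp only [qf, shift, Matrix.of_apply, Finset.mul_sum, ← Finset.sum_add_distrib]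
  exact Finset.sum_congr rfl fun i _ => Finset.sum_congr rfl fun j _ => by ring

lemma sum_pt_mul (k : BinChar g) (n : Fin g → ℤ) (w : Fin g → ZMod 2) :
    ∑ i, (pt k n i : ℂ) * (w i).val =
      ((∑ i, n i * (w i).val : ℤ) : ℂ) + ((∑ i, (k.1 i).val * (w i).val : ℕ) : ℂ) / 2 := by
  push_cast
  rw [Finset.sum_div, ← Finset.sum_add_distrib]
  refine Finset.sum_congr rfl fun i _ => ?_
  simp only [pt]
  push_cast; ring

lemma quad_zero_prod (k : BinChar g) (w : Fin g → ZMod 2) :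
    quad k (0, w) = ∑ i, k.1 i * w i := by
  simp [quad, parity, weil]

lemma transv_zero_prod_fst (k : BinChar g) (w : Fin g → ZMod 2) :
    (transv (0, w) k).1 = k.1 := by
  rw [transv_apply]; simp

lemma transv_zero_prod_snd (k : BinChar g) (w : Fin g → ZMod 2) (i : Fin g) :
    (transv (0, w) k).2 i = k.2 i + (1 + ∑ i, k.1 i * w i) * w i := by
  rw [transv_apply, quad_zero_prod]; simp

/-- The factor of automorphy of a translation. -/
def shiftFactor (w : Fin g → ZMod 2) (k : BinChar g) : ℂ :=
  Complex.exp (((Real.pi * (((∑ i, (k.1 i).val * (w i).val : ℕ) : ℝ) ^ 2 / 4 -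
    ∑ i, ((k.1 i).val : ℝ) / 2 * (((transv (0, w) k).2 i).val - (k.2 i).val)) : ℝ) : ℂ) *
      Complex.I)

lemma norm_shiftFactor (w : Fin g → ZMod 2) (k : BinChar g) : ‖shiftFactor w k‖ = 1 :=
  Complex.norm_exp_ofReal_mul_I _

lemma term_shift_one (w : Fin g → ZMod 2) (k : BinChar g) (τ : Matrix (Fin g) (Fin g) ℂ)
    (n : Fin g → ℤ) :
    term k 0 (shift 1 w τ) n = shiftFactor w k * term (transv (0, w) k) 0 τ n := by
  have hpt : pt (transv (0, w) k) n = pt k n := by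
    ext i; rw [pt, pt, transv_zero_prod_fst]
  rw [shiftFactor, term, term, ← Complex.exp_add, hpt, qf_shift, sum_pt_mul]
  set A : ℕ := ∑ i, (k.1 i).val * (w i).val with hA
  set P : ℤ := ∑ i, n i * (w i).val with hP
  set b' := (transv (0, w) k).2 with hb'
  have hAc : (A : ZMod 2) = ∑ i, k.1 i * w i := by
    simp only [hA, Nat.cast_sum, Nat.cast_mul, ZMod.natCast_zmod_val]
  have hPc : (P : ZMod 2) = ∑ i, n i * w i := by
    simp only [hP, Int.cast_sum, Int.cast_mul, Int.cast_natCast, ZMod.natCast_zmod_val]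
  refine exp_eq_of_even (P ^ 2 + P * A - ∑ i, n i * ((b' i).val - (k.2 i).val)) ?_ ?_
  · have hd : ∑ i, (n i : ZMod 2) * (b' i - k.2 i) = (1 + A) * P := by
      rw [hPc, Finset.mul_sum]
      refine Finset.sum_congr rfl fun i _ => ?_
      rw [hb', transv_zero_prod_snd, ← hAc]
      ring
    push_cast
    simp only [ZMod.natCast_zmod_val]
    rw [hd]
    generalize (P : ZMod 2) = p, (A : ZMod 2) = a
    revert p a; decide
  · have h1 : ∀ b : Fin g → ZMod 2, ∑ i, (pt k n i : ℂ) * ((0 : Fin g → ℂ) i + ((b i).val : ℂ) / 2) =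
        (∑ i, (n i : ℂ) * (b i).val) / 2 + (∑ i, ((k.1 i).val : ℂ) / 2 * (b i).val) / 2 := by
      intro b
      rw [Finset.sum_div, Finset.sum_div, ← Finset.sum_add_distrib]
      refine Finset.sum_congr rfl fun i _ => ?_
      simp only [pt, Pi.zero_apply]
      push_cast; ring
    rw [h1, h1]
    push_cast
    simp only [mul_sub, Finset.sum_sub_distrib]
    ring

lemma term_shift_two (w : Fin g → ZMod 2) (k : BinChar g) (τ : Matrix (Fin g) (Fin g) ℂ)
    (n : Fin g → ℤ) :
    term k 0 (shift 2 w τ) n = Complex.I ^ (quad k (0, w)).val * term k 0 τ n := by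
  rw [term, term, qf_shift, sum_pt_mul]
  set A : ℕ := ∑ i, (k.1 i).val * (w i).val with hA
  set P : ℤ := ∑ i, n i * (w i).val with hP
  have hAc : quad k (0, w) = (A : ZMod 2) := by
    rw [quad_zero_prod]
    simp only [hA, Nat.cast_sum, Nat.cast_mul, ZMod.natCast_zmod_val]
  have hI : Complex.I ^ (quad k (0, w)).val =
      Complex.exp ((quad k (0, w)).val * (Real.pi / 2 * Complex.I)) := by
    rw [Complex.exp_nat_mul, Complex.exp_pi_div_two_mul_I]
  rw [hI, ← Complex.exp_add, hAc, ZMod.val_natCast]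
  have hdm := Nat.mod_add_div A 2
  have hr : A % 2 = 0 ∨ A % 2 = 1 := Nat.mod_two_eq_zero_or_one A
  set q := A / 2
  set r := A % 2
  have hr2 : (r : ℂ) ^ 2 = r := by rcases hr with h | h <;> rw [h] <;> norm_num
  refine exp_eq_of_even (2 * (P ^ 2 + P * A + r * q + q ^ 2)) (by
    rw [Int.cast_mul]; exact zero_mul _) ?_
  have hAe : (A : ℂ) = r + 2 * q := by rw [← hdm]; push_cast; rfl
  push_cast
  rw [hAe]
  linear_combination Real.pi * Complex.I / 2 * hr2

lemma theta_shift_one (w : Fin g → ZMod 2) (k : BinChar g) (τ : Matrix (Fin g) (Fin g) ℂ) :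
    theta (ch k) 0 (shift 1 w τ) = shiftFactor w k * theta (ch (transv (0, w) k)) 0 τ := by
  simp only [theta_ch, term_shift_one, tsum_mul_left]

lemma theta_shift_two (w : Fin g → ZMod 2) (k : BinChar g) (τ : Matrix (Fin g) (Fin g) ℂ) :
    theta (ch k) 0 (shift 2 w τ) = Complex.I ^ (quad k (0, w)).val * theta (ch k) 0 τ := by
  simp only [theta_ch, term_shift_two, tsum_mul_left]

lemma grad_shift_one (w : Fin g → ZMod 2) (k : BinChar g) {τ : Matrix (Fin g) (Fin g) ℂ}
    (hτ : IsSiegel τ) (l : Fin g) :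
    grad k (shift 1 w τ) l = shiftFactor w k * grad (transv (0, w) k) τ l := by
  rw [grad_eq hτ, grad_eq (isSiegel_shift hτ 1 w), ← tsum_mul_left]
  refine tsum_congr fun n => ?_
  rw [term_shift_one, pt, pt, transv_zero_prod_fst]
  ring

lemma grad_shift_two (w : Fin g → ZMod 2) (k : BinChar g) {τ : Matrix (Fin g) (Fin g) ℂ}
    (hτ : IsSiegel τ) (l : Fin g) :
    grad k (shift 2 w τ) l = Complex.I ^ (quad k (0, w)).val * grad k τ l := by
  rw [grad_eq hτ, grad_eq (isSiegel_shift hτ 2 w), ← tsum_mul_left]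
  refine tsum_congr fun n => ?_
  rw [term_shift_two]
  ring

lemma jac_shift_one (w : Fin g → ZMod 2) (N : Fin g → BinChar g)
    {τ : Matrix (Fin g) (Fin g) ℂ} (hτ : IsSiegel τ) :
    jac N (shift 1 w τ) =
      (∏ k, shiftFactor w (N k)) * jac (fun k => transv (0, w) (N k)) τ := by
  simp only [jac, grad_shift_one w _ hτ]
  exact Matrix.det_mul_column _ _

lemma jac_shift_two (w : Fin g → ZMod 2) (N : Fin g → BinChar g)
    {τ : Matrix (Fin g) (Fin g) ℂ} (hτ : IsSiegel τ) :
    jac N (shift 2 w τ) = (∏ k, Complex.I ^ (quad (N k) (0, w)).val) * jac N τ := by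
  simp only [jac, grad_shift_two w _ hτ]
  exact Matrix.det_mul_column _ _

/-- The image of `τ` under inversion in the `i`-th coordinate. -/
def invMat (i : Fin g) (τ : Matrix (Fin g) (Fin g) ℂ) : Matrix (Fin g) (Fin g) ℂ :=
  Matrix.of fun j k => τ j k -
    (τ i j + (Pi.single i 1 : Fin g → ℂ) j) * (τ i k + (Pi.single i 1 : Fin g → ℂ) k) / τ i i +
    2 * (Pi.single i 1 : Fin g → ℂ) j * (Pi.single i 1 : Fin g → ℂ) k

lemma invMat_self (i : Fin g) {τ : Matrix (Fin g) (Fin g) ℂ} (hp : τ i i ≠ 0) :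
    invMat i τ i i = -1 / τ i i := by
  simp [invMat]; field_simp; ring

lemma invMat_left (i : Fin g) {τ : Matrix (Fin g) (Fin g) ℂ} (hp : τ i i ≠ 0) {k : Fin g}
    (hk : k ≠ i) : invMat i τ i k = -τ i k / τ i i := by
  simp [invMat, hk]; field_simp; ring

lemma invMat_isSymm (i : Fin g) {τ : Matrix (Fin g) (Fin g) ℂ} (h : τ.IsSymm) :
    (invMat i τ).IsSymm := by
  ext j k
  simp only [invMat, Matrix.transpose_apply, Matrix.of_apply, h.apply]
  ring

lemma invMat_invMat (i : Fin g) {τ : Matrix (Fin g) (Fin g) ℂ} (h : τ.IsSymm)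
    (hp : τ i i ≠ 0) (j k : Fin g) :
    invMat i (invMat i τ) j k =
      (if j = i then -1 else 1) * (if k = i then -1 else 1) * τ j k := by
  have hp' : -1 / τ i i ≠ 0 := div_ne_zero (by norm_num) hp
  have key : ∀ k, invMat i (invMat i τ) i k = (if k = i then 1 else -1) * τ i k := by
    intro k
    by_cases hk : k = i
    · subst hk
      rw [invMat_self k (by rwa [invMat_self k hp]), invMat_self k hp]
      simp
    · rw [invMat_left i (by rwa [invMat_self i hp]) hk, invMat_self i hp, invMat_left i hp hk]
      simp [hk]; field_simp
  by_cases hj : j = i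
  · subst hj
    rw [key]
    by_cases hk : k = j <;> simp [hk]
  · by_cases hk : k = i
    · subst hk
      rw [(invMat_isSymm k (invMat_isSymm k h)).apply, key, h.apply]
      simp [hj]
    · have h1 : invMat i (invMat i τ) j k = invMat i τ j k -
          invMat i τ i j * invMat i τ i k / invMat i τ i i := by
        conv_lhs => rw [invMat]
        simp [hj, hk]
      rw [h1, invMat_self i hp, invMat_left i hp hj, invMat_left i hp hk]
      simp only [invMat, Matrix.of_apply, Pi.single_apply, hj, hk, if_false]
      field_simp
      ring

lemma qf_add_single {τ : Matrix (Fin g) (Fin g) ℂ} (h : τ.IsSymm) (i : Fin g) (s : ℂ)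
    (x : Fin g → ℂ) :
    qf τ (fun j => x j + s * (Pi.single i 1 : Fin g → ℂ) j) =
      qf τ x + 2 * s * (∑ j, τ i j * x j) + s ^ 2 * τ i i := by
  have h1 : ∑ j, x j * τ j i = ∑ j, τ i j * x j :=
    Finset.sum_congr rfl fun j _ => by rw [h.apply, mul_comm]
  have h2 : qf τ (fun j => x j + s * (Pi.single i 1 : Fin g → ℂ) j) =
      qf τ x + s * (∑ j, x j * τ j i) + s * (∑ j, τ i j * x j) + s ^ 2 * τ i i := by
    simp only [qf, add_mul, mul_add, Finset.sum_add_distrib, Pi.single_apply, mul_ite, mul_one,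
      mul_zero, ite_mul, zero_mul, Finset.sum_ite_eq', Finset.mem_univ, if_true, Finset.mul_sum,
      Finset.sum_ite_irrel, Finset.sum_const_zero]
    have e1 : ∑ a, x a * τ a i * s = ∑ a, s * (x a * τ a i) :=
      Finset.sum_congr rfl fun _ _ => by ring
    have e2 : ∑ a, s * τ i a * x a = ∑ a, s * (τ i a * x a) :=
      Finset.sum_congr rfl fun _ _ => by ring
    rw [e1, e2]
    ring
  rw [h2, h1]
  ring

lemma qf_invMat (i : Fin g) (τ : Matrix (Fin g) (Fin g) ℂ) (y : Fin g → ℂ) :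
    qf (invMat i τ) y = qf τ y - (∑ j, τ i j * y j + y i) ^ 2 / τ i i + 2 * y i ^ 2 := by
  have h1 : ∑ j, (τ i j + (Pi.single i 1 : Fin g → ℂ) j) * y j = ∑ j, τ i j * y j + y i := by
    simp [add_mul, Finset.sum_add_distrib, Pi.single_apply]
  have h2 : ∑ j, (Pi.single i 1 : Fin g → ℂ) j * y j = y i := by simp [Pi.single_apply]
  rw [← h1]
  conv_rhs => rw [← h2]
  rw [sq, sq, Finset.sum_mul_sum, Finset.sum_mul_sum, Finset.sum_div, Finset.mul_sum]
  simp only [qf, invMat, Matrix.of_apply, Finset.sum_div, Finset.mul_sum,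
    ← Finset.sum_sub_distrib, ← Finset.sum_add_distrib]
  exact Finset.sum_congr rfl fun a _ => Finset.sum_congr rfl fun b _ => by ring

lemma isSiegel_of_qf {τ : Matrix (Fin g) (Fin g) ℂ} (h : τ.IsSymm)
    (hq : ∀ x : Fin g → ℝ, x ≠ 0 → 0 < (qf τ (fun i => (x i : ℂ))).im) : IsSiegel τ := by
  refine ⟨h, Matrix.PosDef.of_dotProduct_mulVec_pos ?_ fun x hx => ?_⟩
  · ext i j
    simp [h.apply i j]
  · have := hq x hx
    rw [qf_im] at this
    simpa [qf, dotProduct, Matrix.mulVec, Finset.mul_sum, mul_assoc] using this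

lemma _root_.IsSiegel.im_qf_pos {τ : Matrix (Fin g) (Fin g) ℂ} (h : IsSiegel τ) {x : Fin g → ℝ}
    (hx : x ≠ 0) : 0 < (qf τ (fun i => (x i : ℂ))).im := by
  rw [qf_im]; exact qf_posDef h.2 hx

lemma _root_.IsSiegel.im_diag_pos {τ : Matrix (Fin g) (Fin g) ℂ} (h : IsSiegel τ) (i : Fin g) :
    0 < (τ i i).im := h.2.diag_pos

lemma _root_.IsSiegel.diag_ne_zero {τ : Matrix (Fin g) (Fin g) ℂ} (h : IsSiegel τ) (i : Fin g) :
    τ i i ≠ 0 := by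
  intro h0
  have := h.im_diag_pos i
  simp [h0] at this

lemma isSiegel_invMat (i : Fin g) {τ : Matrix (Fin g) (Fin g) ℂ} (h : IsSiegel τ) :
    IsSiegel (invMat i τ) := by
  refine isSiegel_of_qf (invMat_isSymm i h.1) fun y hy => ?_
  set p := τ i i with hp
  have hp0 : p ≠ 0 := h.diag_ne_zero i
  set ρ : ℂ := (∑ j, τ i j * y j) - p * y i with hρ
  set t : ℝ := -((ρ + y i) / p).re with ht
  set σ : ℝ := ((ρ + y i) / p).im with hσ
  have hs : (t : ℂ) + (ρ + y i) / p = σ * Complex.I := by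
    apply Complex.ext <;> simp [ht, hσ]
  have hR : ρ + y i = (σ * Complex.I - t) * p := by
    rw [← hs]; field_simp; ring
  set x : Fin g → ℝ := fun j => y j + (t - y i) * (Pi.single i 1 : Fin g → ℝ) j with hx
  have hxc : (fun j => (x j : ℂ)) =
      fun j => (y j : ℂ) + ((t - y i : ℝ) : ℂ) * (Pi.single i 1 : Fin g → ℂ) j := by
    ext j
    by_cases hj : j = i
    · subst hj; simp [hx]
    · simp [hx, hj]
  have h1 := qf_add_single h.1 i ((t - y i : ℝ) : ℂ) (fun j => (y j : ℂ))
  rw [← hxc] at h1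
  have h2 := qf_invMat i τ (fun j => (y j : ℂ))
  have hL : ∑ j, τ i j * (y j : ℂ) = (σ * Complex.I - t) * p + (p - 1) * y i := by
    rw [← hR, hρ]; ring
  have hq : qf (invMat i τ) (fun j => (y j : ℂ)) =
      qf τ (fun j => (x j : ℂ)) + σ ^ 2 * p + 2 * t * y i := by
    rw [h2, h1, hL, ← hp]
    have : ((σ * Complex.I - t) * p + (p - 1) * y i + y i) ^ 2 / p =
        (σ * Complex.I - t + y i) ^ 2 * p := by
      field_simp; ring
    rw [this]
    push_cast
    linear_combination (-(σ : ℂ) ^ 2 * p) * Complex.I_sq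
  have him : (qf (invMat i τ) (fun j => (y j : ℂ))).im =
      (qf τ (fun j => (x j : ℂ))).im + σ ^ 2 * p.im := by
    rw [hq, ← Complex.ofReal_pow, Complex.add_im, Complex.add_im, Complex.im_ofReal_mul]
    simp
  rw [him]
  have hpp := h.im_diag_pos i
  by_cases hx0 : x = 0
  · have hyj : ∀ j ≠ i, y j = 0 := by
      intro j hj
      simpa [hx, hj] using congrFun hx0 j
    have ht0 : t = 0 := by simpa [hx] using congrFun hx0 i
    have hyi : y i ≠ 0 := by
      intro h0
      apply hy
      ext j
      by_cases hj : j = i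
      · subst hj; exact h0
      · exact hyj j hj
    have hρ0 : ρ = 0 := by
      rw [hρ, Finset.sum_eq_single i (fun j _ hj => by simp [hyj j hj]) (by simp), sub_self]
    have hσ0 : σ ≠ 0 := by
      intro h0
      rw [h0, ht0, hρ0] at hR
      simp at hR
      exact hyi hR
    have := mul_pos (pow_pos (abs_pos.2 hσ0) 2) hpp
    rw [sq_abs] at this
    simpa [hx0, qf] using this
  · exact add_pos_of_pos_of_nonneg (h.im_qf_pos hx0) (by positivity)

lemma invMat_surj (i : Fin g) {τ : Matrix (Fin g) (Fin g) ℂ} (h : IsSiegel τ) :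
    ∃ τ', IsSiegel τ' ∧ invMat i τ' = τ := by
  have h1 := isSiegel_invMat i h
  have h2 := isSiegel_invMat i h1
  have h3 := isSiegel_invMat i h2
  refine ⟨_, h3, ?_⟩
  ext j k
  rw [invMat_invMat i h2.1 (h2.diag_ne_zero i), invMat_invMat i h.1 (h.diag_ne_zero i)]
  split_ifs <;> ring

/-- The exchange of the `i`-th entries of the two rows of a characteristic. -/
def swapAt (i : Fin g) : Equiv.Perm (BinChar g) :=
  Function.Involutive.toPerm
    (fun k => (Function.update k.1 i (k.2 i), Function.update k.2 i (k.1 i)))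
    (fun k => by simp)

lemma swapAt_apply (i : Fin g) (k : BinChar g) :
    swapAt i k = (Function.update k.1 i (k.2 i), Function.update k.2 i (k.1 i)) := rfl

lemma isAffine_swapAt (i : Fin g) : IsAffine (swapAt i) (swapAt i) where
  parity_eq m := by
    refine Finset.sum_congr rfl fun j _ => ?_
    rw [swapAt_apply]
    by_cases hj : j = i
    · subst hj; simp [mul_comm]
    · simp [hj]
  map_add m x := by
    ext j <;> by_cases hj : j = i
    · subst hj; simp [swapAt_apply]
    · simp [swapAt_apply, hj]
    · subst hj; simp [swapAt_apply]
    · simp [swapAt_apply, hj]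

/-- The square-root factor of automorphy of an inversion. -/
def rootFactor (p : ℂ) : ℂ := 1 / (-Complex.I * p) ^ (1 / 2 : ℂ)

lemma tsum_gauss_inversion {p : ℂ} (hp : p ≠ 0) (w α : ℂ) :
    ∑' n : ℤ, Complex.exp (Real.pi * Complex.I * p * (n + α) ^ 2 +
      2 * Real.pi * Complex.I * (n + α) * w) =
    rootFactor p * ∑' m : ℤ, Complex.exp (-(Real.pi * Complex.I * (w + m) ^ 2 / p) -
      2 * Real.pi * Complex.I * m * α) := by
  have h1 : ∀ n : ℤ, Complex.exp (Real.pi * Complex.I * p * (n + α) ^ 2 +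
      2 * Real.pi * Complex.I * (n + α) * w) =
      Complex.exp (Real.pi * Complex.I * p * α ^ 2 + 2 * Real.pi * Complex.I * α * w) *
        jacobiTheta₂_term n (w + p * α) p := by
    intro n
    rw [jacobiTheta₂_term, ← Complex.exp_add]
    congr 1; ring
  simp only [h1, tsum_mul_left]
  change _ * jacobiTheta₂ (w + p * α) p = _
  rw [jacobiTheta₂_functional_equation, jacobiTheta₂, ← rootFactor, mul_left_comm, mul_assoc,
    ← tsum_mul_left, ← tsum_mul_left, ← (Equiv.neg ℤ).tsum_eq]
  congr 1
  refine tsum_congr fun m => ?_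
  rw [jacobiTheta₂_term, ← Complex.exp_add, ← Complex.exp_add]
  congr 1
  simp only [Equiv.neg_apply]
  push_cast
  field_simp
  ring

/-- The constant of modulus one in the inversion formula. -/
def invFactor (i : Fin g) (k : BinChar g) : ℂ :=
  Complex.exp (((-(Real.pi * ((k.1 i).val * (k.2 i).val / 2)) : ℝ) : ℂ) * Complex.I)

lemma norm_invFactor (i : Fin g) (k : BinChar g) : ‖invFactor i k‖ = 1 :=
  Complex.norm_exp_ofReal_mul_I _

/-- The linear map on the argument of the theta function belonging to an inversion. -/
def invLin (i : Fin g) (τ : Matrix (Fin g) (Fin g) ℂ) (z : Fin g → ℂ) (j : Fin g) : ℂ :=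
  z j - z i / τ i i * (τ i j + (Pi.single i 1 : Fin g → ℂ) j)

/-- The lattice point with `i`-th coordinate removed from the shift. -/
def restPt (i : Fin g) (k : BinChar g) (r : {j // j ≠ i} → ℤ) (j : Fin g) : ℂ :=
  if h : j = i then 0 else (r ⟨j, h⟩ : ℂ) + ((k.1 j).val : ℂ) / 2

lemma pt_split (i : Fin g) (k : BinChar g) (m : ℤ) (r : {j // j ≠ i} → ℤ) :
    (fun j => (pt k ((Equiv.funSplitAt i ℤ).symm (m, r)) j : ℂ)) =
      fun j => restPt i k r j + (m + ((k.1 i).val : ℂ) / 2) * (Pi.single i 1 : Fin g → ℂ) j := by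
  ext j
  by_cases hj : j = i
  · subst hj; simp [pt, restPt, Equiv.funSplitAt, Equiv.piSplitAt, -ZMod.natCast_val]
  · simp [pt, restPt, Equiv.funSplitAt, Equiv.piSplitAt, hj, -ZMod.natCast_val]

lemma restPt_swapAt (i : Fin g) (k : BinChar g) (r : {j // j ≠ i} → ℤ) :
    restPt i (swapAt i k) r = restPt i k r := by
  ext j
  by_cases hj : j = i <;> simp [restPt, swapAt_apply, hj]

lemma restPt_self (i : Fin g) (k : BinChar g) (r : {j // j ≠ i} → ℤ) : restPt i k r i = 0 := by
  simp [restPt]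

lemma sum_add_single (i : Fin g) (x : Fin g → ℂ) (s : ℂ) (f : Fin g → ℂ) :
    ∑ j, (x j + s * (Pi.single i 1 : Fin g → ℂ) j) * f j = ∑ j, x j * f j + s * f i := by
  simp [add_mul, Finset.sum_add_distrib, Pi.single_apply]

lemma term_split (i : Fin g) (k : BinChar g) (z : Fin g → ℂ) {τ : Matrix (Fin g) (Fin g) ℂ}
    (h : τ.IsSymm) (m : ℤ) (r : {j // j ≠ i} → ℤ) :
    term k z τ ((Equiv.funSplitAt i ℤ).symm (m, r)) =
      Complex.exp (Real.pi * Complex.I * qf τ (restPt i k r) +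
        2 * Real.pi * Complex.I * ∑ j, restPt i k r j * (z j + ((k.2 j).val : ℂ) / 2)) *
      Complex.exp (Real.pi * Complex.I * τ i i * (m + ((k.1 i).val : ℂ) / 2) ^ 2 +
        2 * Real.pi * Complex.I * (m + ((k.1 i).val : ℂ) / 2) *
          (∑ j, τ i j * restPt i k r j + z i + ((k.2 i).val : ℂ) / 2)) := by
  rw [term, ← Complex.exp_add, pt_split, qf_add_single h]
  have := pt_split i k m r
  simp only [funext_iff] at this
  simp only [this, sum_add_single]
  congr 1
  ring

lemma term_inversion (i : Fin g) (k : BinChar g) (z : Fin g → ℂ)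
    {τ : Matrix (Fin g) (Fin g) ℂ} (h : τ.IsSymm) (hp : τ i i ≠ 0) (m : ℤ)
    (r : {j // j ≠ i} → ℤ) :
    Complex.exp (Real.pi * Complex.I * qf τ (restPt i k r) +
        2 * Real.pi * Complex.I * ∑ j, restPt i k r j * (z j + ((k.2 j).val : ℂ) / 2)) *
      Complex.exp (-(Real.pi * Complex.I *
        (∑ j, τ i j * restPt i k r j + z i + ((k.2 i).val : ℂ) / 2 + m) ^ 2 / τ i i) -
        2 * Real.pi * Complex.I * m * (((k.1 i).val : ℂ) / 2)) =
    Complex.exp (-(Real.pi * Complex.I / τ i i) * z i ^ 2) * invFactor i k *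
      term (swapAt i k) (invLin i τ z) (invMat i τ) ((Equiv.funSplitAt i ℤ).symm (m, r)) := by
  rw [term_split i _ _ (invMat_isSymm i h), restPt_swapAt, invMat_self i hp, qf_invMat,
    restPt_self, invFactor]
  simp only [← Complex.exp_add]
  have hX := restPt_self i k r
  set X := restPt i k r
  set R := ∑ j, τ i j * X j with hR
  have e1 : ∑ j, invMat i τ i j * X j = -R / τ i i := by
    rw [hR, ← Finset.sum_neg_distrib, Finset.sum_div]
    refine Finset.sum_congr rfl fun j _ => ?_
    by_cases hj : j = i
    · subst hj; simp [hX]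
    · rw [invMat_left i hp hj]; ring
  have e2 : ∑ j, X j * (invLin i τ z j + (((swapAt i k).2 j).val : ℂ) / 2) =
      ∑ j, X j * (z j + ((k.2 j).val : ℂ) / 2) - z i / τ i i * R := by
    rw [hR, Finset.mul_sum, ← Finset.sum_sub_distrib]
    refine Finset.sum_congr rfl fun j _ => ?_
    by_cases hj : j = i
    · subst hj; simp [hX]
    · simp only [invLin, swapAt_apply, Pi.single_apply, hj, if_false, ne_eq, not_false_eq_true,
        Function.update_of_ne]
      ring
  have e3 : invLin i τ z i = -z i / τ i i := by
    simp only [invLin, Pi.single_eq_same]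
    field_simp; ring
  have e4 : (swapAt i k).1 i = k.2 i := by simp [swapAt_apply]
  have e5 : (swapAt i k).2 i = k.1 i := by simp [swapAt_apply]
  rw [e1, e2, e3, e4, e5]
  refine exp_eq_of_even (-2 * (m * (k.1 i).val)) (by rw [Int.cast_mul]; exact zero_mul _) ?_
  push_cast
  field_simp
  ring

lemma theta_inversion (i : Fin g) (k : BinChar g) (z : Fin g → ℂ)
    {τ : Matrix (Fin g) (Fin g) ℂ} (h : IsSiegel τ) :
    theta (ch k) z τ = rootFactor (τ i i) * invFactor i k *
      (Complex.exp (-(Real.pi * Complex.I / τ i i) * z i ^ 2) *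
        theta (ch (swapAt i k)) (invLin i τ z) (invMat i τ)) := by
  have hp := h.diag_ne_zero i
  let e := ((Equiv.prodComm _ _).trans (Equiv.funSplitAt i ℤ).symm)
  have hsum : ∀ (k : BinChar g) (z : Fin g → ℂ) {τ : Matrix (Fin g) (Fin g) ℂ}, IsSiegel τ →
      ∑' n, term k z τ n =
        ∑' r, ∑' m, term k z τ ((Equiv.funSplitAt i ℤ).symm (m, r)) := by
    intro k z τ h
    have hs := e.summable_iff.2 (summable_term h k z)
    rw [← e.tsum_eq]
    exact hs.tsum_prod' fun r => hs.prod_factor r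
  rw [theta_ch, theta_ch, hsum k z h, hsum _ _ (isSiegel_invMat i h), ← tsum_mul_left,
    ← tsum_mul_left]
  refine tsum_congr fun r => ?_
  simp only [term_split i k z h.1, tsum_mul_left]
  rw [tsum_gauss_inversion hp, mul_left_comm, ← tsum_mul_left]
  simp only [term_inversion i k z h.1 hp, tsum_mul_left]
  ring

lemma theta_inversion_zero (i : Fin g) (k : BinChar g) {τ : Matrix (Fin g) (Fin g) ℂ}
    (h : IsSiegel τ) :
    theta (ch k) 0 τ = rootFactor (τ i i) * invFactor i k *
      theta (ch (swapAt i k)) 0 (invMat i τ) := by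
  rw [theta_inversion i k 0 h]
  have : invLin i τ 0 = 0 := by ext j; simp [invLin]
  simp [this]

lemma grad_inversion (i : Fin g) (k : BinChar g) {τ : Matrix (Fin g) (Fin g) ℂ}
    (h : IsSiegel τ) (l : Fin g) :
    grad k τ l = rootFactor (τ i i) * invFactor i k *
      ∑ j, grad (swapAt i k) (invMat i τ) j * invLin i τ (Pi.single l 1) j := by
  let W : (Fin g → ℂ) →L[ℂ] (Fin g → ℂ) := ContinuousLinearMap.pi fun j =>
    ContinuousLinearMap.proj j -
      ((τ i j + (Pi.single i 1 : Fin g → ℂ) j) / τ i i) • ContinuousLinearMap.proj i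
  have hW : ∀ z, W z = invLin i τ z := by
    intro z; ext j
    simp only [W, ContinuousLinearMap.pi_apply, sub_apply,
      smul_apply, ContinuousLinearMap.proj_apply, smul_eq_mul, invLin]
    ring
  have hG := hasFDerivAt_theta (isSiegel_invMat i h) (swapAt i k)
  set G' := ∑' n, term (swapAt i k) 0 (invMat i τ) n • dterm (swapAt i k) n
  have hG1 : HasFDerivAt (fun z => theta (ch (swapAt i k)) (invLin i τ z) (invMat i τ))
      (G'.comp W) 0 := by
    simp only [← hW]
    refine HasFDerivAt.comp (g := fun z => theta (ch (swapAt i k)) z (invMat i τ)) 0 ?_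
      W.hasFDerivAt
    rwa [show W 0 = 0 from map_zero W]
  have hE : HasFDerivAt (fun z : Fin g → ℂ =>
      Complex.exp (-(Real.pi * Complex.I / τ i i) * z i ^ 2))
      (0 : (Fin g → ℂ) →L[ℂ] ℂ) 0 := by
    have h1 : HasFDerivAt (fun z : Fin g → ℂ => z i)
        (ContinuousLinearMap.proj (R := ℂ) (φ := fun _ : Fin g => ℂ) i) 0 :=
      (ContinuousLinearMap.proj (R := ℂ) (φ := fun _ : Fin g => ℂ) i).hasFDerivAt
    refine ((h1.pow 2).const_mul (-(Real.pi * Complex.I / τ i i))).cexp.congr_fderiv ?_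
    ext
    simp
  have hF := (hE.mul hG1).const_mul (rootFactor (τ i i) * invFactor i k)
  have heq : (fun z : Fin g → ℂ => theta (ch k) z τ) = fun z =>
      rootFactor (τ i i) * invFactor i k *
      (Complex.exp (-(Real.pi * Complex.I / τ i i) * z i ^ 2) *
        theta (ch (swapAt i k)) (invLin i τ z) (invMat i τ)) :=
    funext fun z => theta_inversion i k z h
  have hgr : ∀ j, grad (swapAt i k) (invMat i τ) j = G' (Pi.single j 1) := by
    intro j; rw [grad, hG.fderiv]
  have hlin := LinearMap.pi_apply_eq_sum_univ (G' : (Fin g → ℂ) →ₗ[ℂ] ℂ)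
    (invLin i τ (Pi.single l 1))
  rw [grad, heq]
  refine (congrArg (fun f => f (Pi.single l 1)) hF.fderiv).trans ?_
  simp only [smul_apply, add_apply,
    ContinuousLinearMap.comp_apply, smul_eq_mul, hW, hgr,
    show (0 : (Fin g → ℂ) →L[ℂ] ℂ) (Pi.single l 1) = 0 from rfl, mul_zero, add_zero]
  simp only [ContinuousLinearMap.coe_coe] at hlin
  rw [hlin]
  congr 1
  simp only [Pi.zero_apply, ne_eq, OfNat.ofNat_ne_zero, not_false_eq_true, zero_pow, mul_zero,
    Complex.exp_zero, one_mul, smul_eq_mul]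
  refine Finset.sum_congr rfl fun j _ => ?_
  rw [mul_comm]
  congr 2
  ext a
  simp [Pi.single_apply, eq_comm]

lemma rootFactor_sq {p : ℂ} (hp : p ≠ 0) : Complex.I * rootFactor p ^ 2 = -1 / p := by
  have hne : -Complex.I * p ≠ 0 := mul_ne_zero (neg_ne_zero.2 Complex.I_ne_zero) hp
  have : ((-Complex.I * p) ^ (1 / 2 : ℂ)) ^ 2 = -Complex.I * p := by
    rw [← Complex.cpow_nat_mul]
    norm_num
  rw [rootFactor, div_pow, this]
  field_simp

lemma det_invLin (i : Fin g) {τ : Matrix (Fin g) (Fin g) ℂ} (hp : τ i i ≠ 0) :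
    (Matrix.of fun j l => invLin i τ (Pi.single l 1) j).det = -1 / τ i i := by
  have : (Matrix.of fun j l => invLin i τ (Pi.single l 1) j) =
      1 + Matrix.replicateCol Unit (fun j => -(τ i j + (Pi.single i 1 : Fin g → ℂ) j) / τ i i) *
        Matrix.replicateRow Unit (Pi.single i 1 : Fin g → ℂ) := by
    ext j l
    simp only [invLin, Matrix.of_apply, Matrix.add_apply, Matrix.mul_apply,
      Matrix.replicateCol_apply, Matrix.replicateRow_apply, Finset.univ_unique,
      Finset.sum_singleton, Matrix.one_apply, Pi.single_apply, eq_comm (a := l)]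
    ring
  rw [this, Matrix.det_one_add_replicateCol_mul_replicateRow]
  simp
  field_simp
  ring

lemma jac_inversion (i : Fin g) (N : Fin g → BinChar g) {τ : Matrix (Fin g) (Fin g) ℂ}
    (h : IsSiegel τ) :
    jac N τ = (Complex.I * ∏ k, invFactor i (N k)) * rootFactor (τ i i) ^ (g + 2) *
      jac (fun k => swapAt i (N k)) (invMat i τ) := by
  have h1 : (Matrix.of fun k l => grad (N k) τ l) = Matrix.of fun k l =>
      (rootFactor (τ i i) * invFactor i (N k)) *
        ((Matrix.of fun k l => grad (swapAt i (N k)) (invMat i τ) l) *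
          (Matrix.of fun j l => invLin i τ (Pi.single l 1) j)) k l := by
    ext k l
    simp only [Matrix.of_apply, Matrix.mul_apply]
    exact grad_inversion i (N k) h l
  rw [jac, h1, Matrix.det_mul_column, Matrix.det_mul, det_invLin i (h.diag_ne_zero i),
    ← rootFactor_sq (h.diag_ne_zero i), Finset.prod_mul_distrib, Finset.prod_const,
    Finset.card_univ, Fintype.card_fin, jac]
  ring

/-- The scalar matrix `i t`. -/
def diag (g : ℕ) (t : ℝ) : Matrix (Fin g) (Fin g) ℂ := Matrix.diagonal fun _ => t * Complex.I

lemma isSiegel_diag {t : ℝ} (ht : 0 < t) : IsSiegel (diag g t) := by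
  refine ⟨Matrix.diagonal_transpose _, ?_⟩
  have : (diag g t).map Complex.im = Matrix.diagonal fun _ => t := by
    ext i j
    by_cases h : i = j
    · subst h; simp [diag]
    · simp [diag, h]
  rw [this]
  exact Matrix.PosDef.diagonal fun _ => ht

/-- The `t`-independent factor of a term of the theta series at `i t`. -/
def phase (k : BinChar g) (n : Fin g → ℤ) : ℂ :=
  Complex.exp (2 * Real.pi * Complex.I * ∑ i, (pt k n i : ℂ) * (((k.2 i).val : ℂ) / 2))

lemma term_diag (k : BinChar g) (t : ℝ) (n : Fin g → ℤ) :
    term k 0 (diag g t) n =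
      (Real.exp (-Real.pi * t * ∑ i, pt k n i ^ 2) : ℝ) * phase k n := by
  rw [term, phase, Complex.ofReal_exp, ← Complex.exp_add]
  simp only [Pi.zero_apply, zero_add]
  congr 2
  have : qf (diag g t) (fun i => (pt k n i : ℂ)) = t * Complex.I * ∑ i, (pt k n i : ℂ) ^ 2 := by
    rw [qf, Finset.mul_sum]
    refine Finset.sum_congr rfl fun i _ => ?_
    rw [Finset.sum_eq_single i]
    · simp [diag]; ring
    · intro j _ hj; simp [diag, hj.symm]
    · simp
  rw [this]
  push_cast
  linear_combination (Real.pi * t * ∑ i, (pt k n i : ℂ) ^ 2) * Complex.I_mul_I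

/-- The reflection of the shifted lattice in the `l`-th coordinate. -/
def reflectAt (k : BinChar g) (l : Fin g) : Equiv.Perm (Fin g → ℤ) :=
  Function.Involutive.toPerm (fun n => Function.update n l (-n l - (k.1 l).val))
    (fun n => by simp)

lemma reflectAt_apply (k : BinChar g) (l : Fin g) (n : Fin g → ℤ) :
    reflectAt k l n = Function.update n l (-n l - (k.1 l).val) := rfl

lemma pt_reflectAt (k : BinChar g) (l : Fin g) (n : Fin g → ℤ) (j : Fin g) :
    pt k (reflectAt k l n) j = pt k n j - if j = l then 2 * pt k n l else 0 := by
  by_cases h : j = l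
  · subst h
    rw [if_pos rfl]
    simp only [pt, reflectAt_apply, Function.update_self]
    push_cast
    ring
  · simp [pt, reflectAt_apply, h]

lemma term_reflectAt (k : BinChar g) (l : Fin g) (t : ℝ) (n : Fin g → ℤ) :
    term k 0 (diag g t) (reflectAt k l n) =
      (if k.1 l = 1 ∧ k.2 l = 1 then -1 else 1) * term k 0 (diag g t) n := by
  have h1 : ∑ i, pt k (reflectAt k l n) i ^ 2 = ∑ i, pt k n i ^ 2 := by
    refine Finset.sum_congr rfl fun i _ => ?_
    rw [pt_reflectAt]
    split_ifs with h
    · subst h; ring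
    · ring
  have h2 : ∑ i, (pt k (reflectAt k l n) i : ℂ) * (((k.2 i).val : ℂ) / 2) =
      ∑ i, (pt k n i : ℂ) * (((k.2 i).val : ℂ) / 2) - pt k n l * (k.2 l).val := by
    rw [eq_sub_iff_add_eq, ← eq_sub_iff_add_eq', ← Finset.sum_sub_distrib,
      Finset.sum_eq_single l]
    · rw [pt_reflectAt, if_pos rfl]; push_cast; ring
    · intro j _ hj; rw [pt_reflectAt, if_neg hj]; push_cast; ring
    · simp
  rw [term_diag, term_diag, h1, mul_left_comm]
  congr 1
  rw [phase, phase, h2]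
  split_ifs with h
  · rw [show (-1 : ℂ) = Complex.exp (Real.pi * Complex.I) from Complex.exp_pi_mul_I.symm,
      ← Complex.exp_add]
    refine exp_eq_of_even (-2 - 2 * n l) ?_ ?_
    · push_cast; rw [show (2 : ZMod 2) = 0 from rfl]; ring
    · rw [pt, h.1, h.2, show ((1 : ZMod 2)).val = 1 from rfl]
      push_cast
      ring
  · rw [one_mul]
    refine exp_eq_of_even (-(2 * n l * (k.2 l).val) - (k.1 l).val * (k.2 l).val) ?_ ?_
    · push_cast
      rw [show (2 : ZMod 2) = 0 from rfl, ZMod.natCast_zmod_val, ZMod.natCast_zmod_val]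
      generalize k.1 l = a at h ⊢
      generalize k.2 l = b at h ⊢
      rw [zero_mul, zero_mul, neg_zero, zero_sub]
      revert a b; decide
    · rw [pt]
      push_cast
      ring

lemma theta_diag_eq_zero {k : BinChar g} {l : Fin g} (h : k.1 l = 1 ∧ k.2 l = 1) (t : ℝ) :
    theta (ch k) 0 (diag g t) = 0 := by
  have h : ∑' n, term k 0 (diag g t) n = -∑' n, term k 0 (diag g t) n := by
    conv_lhs => rw [← (reflectAt k l).tsum_eq]
    simp only [term_reflectAt, if_pos h, neg_one_mul, tsum_neg]
  rw [theta_ch]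
  linear_combination h / 2

lemma grad_diag_eq_zero {k : BinChar g} {l : Fin g} (h : ¬ (k.1 l = 1 ∧ k.2 l = 1)) {t : ℝ}
    (ht : 0 < t) : grad k (diag g t) l = 0 := by
  rw [grad_eq (isSiegel_diag ht)]
  set f : (Fin g → ℤ) → ℂ := fun n => 2 * Real.pi * Complex.I * pt k n l * term k 0 (diag g t) n
  have h : ∑' n, f n = -∑' n, f n := by
    conv_lhs => rw [← (reflectAt k l).tsum_eq]
    rw [← tsum_neg]
    refine tsum_congr fun n => ?_
    simp only [f, term_reflectAt, if_neg h, pt_reflectAt, if_true]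
    push_cast
    ring
  linear_combination h / 2

/-- The minimal value of the sum of squares on the shifted lattice. -/
def minSq (k : BinChar g) : ℝ := ∑ i, ((k.1 i).val : ℝ) / 4

lemma sum_pt_sq (k : BinChar g) (n : Fin g → ℤ) :
    ∑ i, pt k n i ^ 2 = minSq k + ∑ i, (n i : ℝ) * (n i + (k.1 i).val) := by
  rw [minSq, ← Finset.sum_add_distrib]
  refine Finset.sum_congr rfl fun i _ => ?_
  have : ∀ a : ZMod 2, ((a.val : ℕ) : ℝ) ^ 2 = a.val := by
    intro a
    by_cases h : a = 0
    · subst h; simp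
    · rw [zmod_two_eq_one h, show ((1 : ZMod 2)).val = 1 from rfl]; norm_num
  rw [pt]
  linear_combination this (k.1 i) / 4

lemma mul_add_val_nonneg (a : ZMod 2) (m : ℤ) : 0 ≤ m * (m + a.val) := by
  have := ZMod.val_lt a
  rcases lt_or_ge m 0 with h | h
  · have : m + a.val ≤ 0 := by omega
    nlinarith
  · positivity

lemma minSq_le (k : BinChar g) (n : Fin g → ℤ) : minSq k ≤ ∑ i, pt k n i ^ 2 := by
  rw [sum_pt_sq, le_add_iff_nonneg_right]
  exact Finset.sum_nonneg fun i _ => mod_cast mul_add_val_nonneg (k.1 i) (n i)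

lemma sum_pt_sq_eq_iff (k : BinChar g) (n : Fin g → ℤ) :
    ∑ i, pt k n i ^ 2 = minSq k ↔ ∀ i, n i = 0 ∨ n i + ((k.1 i).val : ℤ) = 0 := by
  rw [sum_pt_sq, add_eq_left, Finset.sum_eq_zero_iff_of_nonneg
    fun i _ => mod_cast mul_add_val_nonneg (k.1 i) (n i)]
  simp only [Finset.mem_univ, true_imp_iff, mul_eq_zero]
  norm_cast

lemma tendsto_tsum_diag (k : BinChar g) (w : (Fin g → ℤ) → ℂ)
    (hw : ∀ n, ‖w n‖ ≤ 2 * Real.pi * ∏ i, Real.exp |pt k n i|) :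
    Filter.Tendsto (fun t : ℝ => (Real.exp (Real.pi * t * minSq k) : ℂ) *
        ∑' n, w n * term k 0 (diag g t) n) Filter.atTop
      (nhds (∑' n : Fin g → ℤ, if ∀ i, n i = 0 ∨ n i + ((k.1 i).val : ℤ) = 0 then w n * phase k n else 0)) := by
  have hterm : ∀ t n, (Real.exp (Real.pi * t * minSq k) : ℂ) * (w n * term k 0 (diag g t) n) =
      (Real.exp (-(Real.pi * (∑ i, pt k n i ^ 2 - minSq k)) * t) : ℝ) * (w n * phase k n) := by
    intro t n
    rw [term_diag, mul_left_comm (w n), ← mul_assoc, ← Complex.ofReal_mul, ← Real.exp_add]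
    ring_nf
  have hphase : ∀ n, ‖phase k n‖ = 1 := by
    intro n
    rw [phase]
    have : (2 * Real.pi * Complex.I * ∑ i, (pt k n i : ℂ) * (((k.2 i).val : ℂ) / 2)) =
      ((2 * Real.pi * ∑ i, pt k n i * (((k.2 i).val : ℝ) / 2) : ℝ) : ℂ) * Complex.I := by
      push_cast; ring
    rw [this, Complex.norm_exp_ofReal_mul_I]
  simp only [← tsum_mul_left, hterm]
  refine tendsto_tsum_of_dominated_convergence
    ((summable_grad_bound k (C := 0) Real.pi_pos).mul_left (Real.exp (Real.pi * minSq k)))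
    (fun n => ?_) ?_
  · split_ifs with h
    · rw [← sum_pt_sq_eq_iff] at h
      simp only [h, sub_self, mul_zero, neg_zero, zero_mul, Real.exp_zero, Complex.ofReal_one,
        one_mul]
      exact tendsto_const_nhds
    · rw [← sum_pt_sq_eq_iff] at h
      have hpos : 0 < Real.pi * (∑ i, pt k n i ^ 2 - minSq k) :=
        mul_pos Real.pi_pos (sub_pos.2 (lt_of_le_of_ne (minSq_le k n) (Ne.symm h)))
      have h1 : Filter.Tendsto
          (fun t : ℝ => Real.exp (-(Real.pi * (∑ i, pt k n i ^ 2 - minSq k)) * t))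
          Filter.atTop (nhds 0) :=
        Real.tendsto_exp_atBot.comp
          (Filter.tendsto_id.const_mul_atTop_of_neg (neg_lt_zero.2 hpos))
      have h2 := (Complex.continuous_ofReal.tendsto 0).comp h1
      simpa using h2.mul_const (w n * phase k n)
  · filter_upwards [Filter.eventually_ge_atTop 1] with t ht n
    rw [norm_mul, norm_mul, hphase, mul_one, Complex.norm_real, Real.norm_eq_abs,
      abs_of_pos (Real.exp_pos _), ← mul_assoc]
    refine mul_le_mul ?_ (hw n) (norm_nonneg _) (by positivity)
    rw [← Real.exp_sum, ← Real.exp_add, Real.exp_le_exp]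
    simp only [zero_mul, add_zero, ← Finset.mul_sum]
    have h0 := mul_nonneg (mul_nonneg Real.pi_pos.le (sub_nonneg.2 (minSq_le k n)))
      (sub_nonneg.2 ht)
    nlinarith

lemma tendsto_theta_diag (k : BinChar g) :
    Filter.Tendsto (fun t : ℝ => (Real.exp (Real.pi * t * minSq k) : ℂ) *
        theta (ch k) 0 (diag g t)) Filter.atTop
      (nhds (∑' n : Fin g → ℤ, if ∀ i, n i = 0 ∨ n i + ((k.1 i).val : ℤ) = 0 then phase k n else 0)) := by
  have := tendsto_tsum_diag k (fun _ => 1) (fun n => ?_)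
  · simpa only [one_mul, ← theta_ch] using this
  · rw [norm_one, ← Real.exp_sum]
    have h1 := Real.one_le_exp (Finset.sum_nonneg fun i _ => abs_nonneg (pt k n i) :
      0 ≤ ∑ i, |pt k n i|)
    have h2 := Real.pi_gt_three
    nlinarith

lemma tendsto_grad_diag (k : BinChar g) (l : Fin g) :
    Filter.Tendsto (fun t : ℝ => (Real.exp (Real.pi * t * minSq k) : ℂ) *
        grad k (diag g t) l) Filter.atTop
      (nhds (∑' n : Fin g → ℤ, if ∀ i, n i = 0 ∨ n i + ((k.1 i).val : ℤ) = 0 then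
        2 * Real.pi * Complex.I * pt k n l * phase k n else 0)) := by
  have := tendsto_tsum_diag k (fun n => 2 * Real.pi * Complex.I * pt k n l) (fun n => ?_)
  · refine this.congr' ?_
    filter_upwards [Filter.eventually_gt_atTop 0] with t ht
    rw [grad_eq (isSiegel_diag ht)]
  · rw [norm_mul, Complex.norm_real]
    refine mul_le_mul (le_of_eq ?_) (abs_le_prod_exp _ l) (norm_nonneg _) (by positivity)
    simp [abs_of_pos Real.pi_pos]

lemma tsum_zero_fst {k : BinChar g} (h : k.1 = 0) (f : (Fin g → ℤ) → ℂ) :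
    ∑' n : Fin g → ℤ, (if ∀ i, n i = 0 ∨ n i + ((k.1 i).val : ℤ) = 0 then f n else 0) = f 0 := by
  rw [tsum_eq_single 0]
  · simp
  · intro n hn
    refine if_neg fun h' => hn ?_
    ext i
    simpa [h] using h' i

lemma tsum_single_fst {k : BinChar g} {l : Fin g} (h : k.1 = Pi.single l 1)
    (f : (Fin g → ℤ) → ℂ) :
    ∑' n : Fin g → ℤ, (if ∀ i, n i = 0 ∨ n i + ((k.1 i).val : ℤ) = 0 then f n else 0) =
      f 0 + f (Pi.single l (-1)) := by
  have h1 : ((1 : ZMod 2)).val = 1 := rfl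
  have hne : (0 : Fin g → ℤ) ≠ Pi.single l (-1) := by
    intro e; have := congrFun e l; simp at this
  rw [tsum_eq_sum (s := {0, Pi.single l (-1)}), Finset.sum_pair hne, if_pos (by simp), if_pos]
  · intro i
    by_cases hi : i = l
    · subst hi; simp [h, h1]
    · simp [hi]
  · intro n hn
    refine if_neg fun h' => hn ?_
    rw [Finset.mem_insert, Finset.mem_singleton]
    have hi : ∀ i, i ≠ l → n i = 0 := by
      intro i hi; simpa [h, hi] using h' i
    rcases h' l with h0 | h0
    · left; ext i
      by_cases e : i = l
      · subst e; exact h0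
      · exact hi i e
    · right; ext i
      by_cases e : i = l
      · subst e
        simp only [h, Pi.single_eq_same, h1] at h0 ⊢
        omega
      · simp [e, hi i e]

lemma pt_zero_single {k : BinChar g} {l : Fin g} (h : k.1 = Pi.single l 1) (i : Fin g) :
    pt k 0 i = if i = l then 1 / 2 else 0 := by
  have h1 : ((1 : ZMod 2)).val = 1 := rfl
  by_cases e : i = l
  · subst e; simp [pt, h, h1]
  · simp [pt, h, e]

lemma pt_neg_single {k : BinChar g} {l : Fin g} (h : k.1 = Pi.single l 1) (i : Fin g) :
    pt k (Pi.single l (-1)) i = if i = l then -1 / 2 else 0 := by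
  have h1 : ((1 : ZMod 2)).val = 1 := rfl
  by_cases e : i = l
  · subst e; simp [pt, h, h1]; norm_num
  · simp [pt, h, e]

lemma phase_zero_single {k : BinChar g} {l : Fin g} (h : k.1 = Pi.single l 1) :
    phase k 0 = Complex.exp ((k.2 l).val * (Real.pi / 2 * Complex.I)) := by
  simp only [phase, pt_zero_single h, apply_ite (Complex.ofReal), Complex.ofReal_zero, ite_mul,
    zero_mul, Finset.sum_ite_eq', Finset.mem_univ, if_true]
  congr 1
  push_cast
  ring

lemma phase_neg_single {k : BinChar g} {l : Fin g} (h : k.1 = Pi.single l 1) :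
    phase k (Pi.single l (-1)) = Complex.exp (-((k.2 l).val * (Real.pi / 2 * Complex.I))) := by
  simp only [phase, pt_neg_single h, apply_ite (Complex.ofReal), Complex.ofReal_zero, ite_mul,
    zero_mul, Finset.sum_ite_eq', Finset.mem_univ, if_true]
  congr 1
  push_cast
  ring

lemma minSq_single {k : BinChar g} {l : Fin g} (h : k.1 = Pi.single l 1) : minSq k = 1 / 4 := by
  have h1 : ((1 : ZMod 2)).val = 1 := rfl
  rw [minSq, Finset.sum_eq_single l]
  · rw [h, Pi.single_eq_same, h1, Nat.cast_one]
  · intro i _ hi; rw [h, Pi.single_eq_of_ne hi]; simp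
  · simp

lemma tendsto_theta_diag_zero {k : BinChar g} (h : k.1 = 0) :
    Filter.Tendsto (fun t : ℝ => theta (ch k) 0 (diag g t)) Filter.atTop (nhds 1) := by
  have := tendsto_theta_diag k
  rw [tsum_zero_fst h] at this
  simpa [minSq, h, phase, pt] using this

lemma tendsto_theta_diag_single {k : BinChar g} {l : Fin g} (h : k.1 = Pi.single l 1)
    (h2 : k.2 l = 0) :
    Filter.Tendsto (fun t : ℝ => (Real.exp (Real.pi * t / 4) : ℂ) * theta (ch k) 0 (diag g t))
      Filter.atTop (nhds 2) := by
  have := tendsto_theta_diag k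
  rw [tsum_single_fst h, phase_zero_single h, phase_neg_single h, h2, minSq_single h] at this
  simp only [ZMod.val_zero, Nat.cast_zero, zero_mul, neg_zero, Complex.exp_zero] at this
  norm_num at this
  simpa [div_eq_mul_inv] using this

lemma tendsto_grad_diag_single {k : BinChar g} {l : Fin g} (h : k.1 = Pi.single l 1)
    (h2 : k.2 l = 1) :
    Filter.Tendsto (fun t : ℝ => (Real.exp (Real.pi * t / 4) : ℂ) * grad k (diag g t) l)
      Filter.atTop (nhds (-2 * Real.pi)) := by
  have := tendsto_grad_diag k l
  rw [tsum_single_fst h, phase_zero_single h, phase_neg_single h, h2, minSq_single h,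
    pt_zero_single h, pt_neg_single h, if_pos rfl, if_pos rfl,
    show ((1 : ZMod 2)).val = 1 from rfl, Nat.cast_one, one_mul, Complex.exp_neg,
    Complex.exp_pi_div_two_mul_I, Complex.inv_I] at this
  convert this using 2
  · ring_nf
  · push_cast
    linear_combination (-2 * Real.pi) * Complex.I_mul_I

lemma stdOdd_fst (k : Fin g) : (stdOdd g k).1 = Pi.single k 1 := by
  ext i
  simp only [stdOdd, stdChar, Pi.single_apply, Fin.ext_iff]
  exact if_congr (by omega) rfl rfl

lemma stdOdd_snd (k : Fin g) : (stdOdd g k).2 k = 1 := by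
  simp [stdOdd, stdChar]

lemma stdEven_castSucc_succ_fst (k : Fin g) :
    (stdEven g k.succ.castSucc).1 = Pi.single k 1 := by
  ext i
  simp only [stdEven, stdChar, Pi.single_apply, Fin.ext_iff, Fin.val_castSucc, Fin.val_succ]
  exact if_congr (by omega) rfl rfl

lemma stdEven_castSucc_succ_snd (k : Fin g) : (stdEven g k.succ.castSucc).2 k = 0 := by
  simp only [stdEven, stdChar, Fin.val_castSucc, Fin.val_succ]
  exact if_neg (by omega)

lemma jac_stdOdd_diag {t : ℝ} (ht : 0 < t) :
    jac (stdOdd g) (diag g t) = ∏ k, grad (stdOdd g k) (diag g t) k := by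
  rw [jac, ← Matrix.det_diagonal]
  congr 1
  ext k l
  by_cases h : k = l
  · subst h; simp
  · rw [Matrix.diagonal_apply_ne _ h, Matrix.of_apply]
    refine grad_diag_eq_zero (fun h' => ?_) ht
    rw [stdOdd_fst, Pi.single_eq_of_ne (Ne.symm h)] at h'
    exact absurd h'.1 (by decide)

lemma eq_of_jac_stdOdd_diag {c : ℂ}
    (h : ∀ t : ℝ, 0 < t → jac (stdOdd g) (diag g t) =
      c * ∏ j, theta (ch (stdEven g j)) 0 (diag g t)) : c = (-Real.pi : ℂ) ^ g := by
  have h1 := tendsto_finsetProd Finset.univ fun (k : Fin g) _ =>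
    tendsto_grad_diag_single (stdOdd_fst k) (stdOdd_snd k)
  have h2 := tendsto_finsetProd Finset.univ fun (k : Fin g) _ =>
    tendsto_theta_diag_single (stdEven_castSucc_succ_fst k) (stdEven_castSucc_succ_snd k)
  have h3 : Filter.Tendsto (fun t : ℝ => theta (ch (stdEven g 0)) 0 (diag g t))
      Filter.atTop (nhds 1) :=
    tendsto_theta_diag_zero (by ext i; simp [stdEven, stdChar])
  have h4 : Filter.Tendsto (fun t : ℝ => theta (ch (stdEven g (Fin.last _))) 0 (diag g t))
      Filter.atTop (nhds 1) :=
    tendsto_theta_diag_zero (by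
      ext i
      have := i.2
      simp only [stdEven, stdChar, Fin.val_last, Pi.zero_apply]
      exact if_neg (by omega))
  have h5 := (((h3.mul h2).mul h4).const_mul c)
  have h6 := tendsto_nhds_unique (h1.congr' ?_) h5
  · simp only [Finset.prod_const, Finset.card_univ, Fintype.card_fin, one_mul, mul_one] at h6
    refine mul_right_cancel₀ (pow_ne_zero g (two_ne_zero : (2 : ℂ) ≠ 0)) ?_
    rw [← h6, ← mul_pow]
    ring
  · filter_upwards [Filter.eventually_gt_atTop 0] with t ht
    rw [Finset.prod_mul_distrib, Finset.prod_mul_distrib, ← jac_stdOdd_diag ht, h t ht,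
      Fin.prod_univ_castSucc, Fin.prod_univ_succ]
    simp only [Fin.castSucc_zero]
    ring

/-- The product of the Thetanullwerte over a multiset of characteristics. -/
def thetaProd (M : Multiset (BinChar g)) (τ : Matrix (Fin g) (Fin g) ℂ) : ℂ :=
  (M.map fun k => theta (ch k) 0 τ).prod

/-- The Jacobian Nullwert of `N` is the combination with coefficients `c` of the products of
`g + 2` Thetanullwerte. -/
def Rel (N : Fin g → BinChar g) (c : Sym (BinChar g) (g + 2) → ℂ) : Prop :=
  ∀ τ, IsSiegel τ → jac N τ = ∑ M, c M * thetaProd M τ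

/-- The action of a permutation of the characteristics on multisets. -/
def symPerm (γ : Equiv.Perm (BinChar g)) : Equiv.Perm (Sym (BinChar g) (g + 2)) :=
  Sym.equivCongr γ

lemma coe_symPerm (γ : Equiv.Perm (BinChar g)) (M : Sym (BinChar g) (g + 2)) :
    (symPerm γ M : Multiset (BinChar g)) = (M : Multiset (BinChar g)).map γ := rfl

lemma symPerm_mul (γ δ : Equiv.Perm (BinChar g)) : symPerm (γ * δ) = symPerm γ * symPerm δ := by
  ext1 M
  refine Subtype.ext ?_
  change Multiset.map _ _ = Multiset.map _ (Multiset.map _ _)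
  rw [Multiset.map_map]
  rfl

lemma symPerm_inv_apply (γ : Equiv.Perm (BinChar g)) (M : Sym (BinChar g) (g + 2)) :
    (symPerm γ)⁻¹ (symPerm γ M) = M := (symPerm γ).symm_apply_apply M

lemma symPerm_one : symPerm (1 : Equiv.Perm (BinChar g)) = 1 := by
  ext1 M
  refine Subtype.ext ?_
  exact Multiset.map_id _

/-- The permutation `γ` carries relations to relations, up to factors of modulus one. -/
def Transports (γ : Equiv.Perm (BinChar g)) : Prop :=
  ∀ N, ∃ κ : Sym (BinChar g) (g + 2) → ℂ, (∀ M, ‖κ M‖ = 1) ∧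
    ∀ c, Rel N c ↔ Rel (fun k => γ (N k)) fun M => κ M * c ((symPerm γ)⁻¹ M)

lemma transports_one : Transports (1 : Equiv.Perm (BinChar g)) := fun N =>
  ⟨fun _ => 1, fun _ => norm_one, fun c => by simp [symPerm_one]⟩

lemma Transports.mul {γ δ : Equiv.Perm (BinChar g)} (hγ : Transports γ) (hδ : Transports δ) :
    Transports (γ * δ) := by
  intro N
  obtain ⟨κ, hκ, h⟩ := hδ N
  obtain ⟨κ', hκ', h'⟩ := hγ fun k => δ (N k)
  refine ⟨fun M => κ' M * κ ((symPerm γ)⁻¹ M), fun M => by rw [norm_mul, hκ, hκ', one_mul],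
    fun c => ?_⟩
  rw [h, h']
  simp only [symPerm_mul, mul_inv_rev, Equiv.Perm.mul_apply, mul_assoc]

lemma transports_of_modular {γ : Equiv.Perm (BinChar g)}
    {f h : Matrix (Fin g) (Fin g) ℂ → Matrix (Fin g) (Fin g) ℂ}
    (hfm : ∀ τ, IsSiegel τ → IsSiegel (f τ)) (hhm : ∀ τ, IsSiegel τ → IsSiegel (h τ))
    (hfs : ∀ τ, IsSiegel τ → ∃ τ', IsSiegel τ' ∧ f τ' = τ)
    (hhs : ∀ τ, IsSiegel τ → ∃ τ', IsSiegel τ' ∧ h τ' = τ)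
    {u : Matrix (Fin g) (Fin g) ℂ → ℂ} (hu : ∀ τ, IsSiegel τ → u τ ≠ 0)
    {a : BinChar g → ℂ} (ha : ∀ k, ‖a k‖ = 1)
    (hθ : ∀ k τ, IsSiegel τ → theta (ch k) 0 (f τ) = u τ * a k * theta (ch (γ k)) 0 (h τ))
    {b : (Fin g → BinChar g) → ℂ} (hb : ∀ N, ‖b N‖ = 1)
    (hj : ∀ N τ, IsSiegel τ →
      jac N (f τ) = b N * u τ ^ (g + 2) * jac (fun k => γ (N k)) (h τ)) :
    Transports γ := by
  intro N
  have hprod : ∀ (M : Sym (BinChar g) (g + 2)) τ, IsSiegel τ → thetaProd M (f τ) =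
      u τ ^ (g + 2) * ((M : Multiset (BinChar g)).map a).prod * thetaProd (symPerm γ M) (h τ) := by
    intro M τ hτ
    have h1 : ((M : Multiset (BinChar g)).map fun k => theta (ch k) 0 (f τ)) =
        (M : Multiset (BinChar g)).map
          fun k => u τ * a k * theta (ch (γ k)) 0 (h τ) :=
      Multiset.map_congr rfl fun k _ => hθ k τ hτ
    rw [thetaProd, thetaProd, h1, Multiset.prod_map_mul, Multiset.prod_map_mul,
      Multiset.map_const', Multiset.prod_replicate, coe_symPerm, Multiset.map_map,
      show Multiset.card (M : Multiset (BinChar g)) = g + 2 from M.2]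
    rfl
  have hnorm : ∀ M : Sym (BinChar g) (g + 2),
      ‖((M : Multiset (BinChar g)).map a).prod‖ = 1 := by
    intro M
    rw [← normHom_apply, map_multiset_prod, Multiset.map_map]
    refine Multiset.prod_eq_one fun x hx => ?_
    obtain ⟨k, -, rfl⟩ := Multiset.mem_map.1 hx
    exact ha k
  have hb0 : b N ≠ 0 := norm_ne_zero_iff.1 (by rw [hb]; exact one_ne_zero)
  refine ⟨fun M => (b N)⁻¹ * (((symPerm γ)⁻¹ M : Multiset (BinChar g)).map a).prod,
    fun M => by rw [norm_mul, norm_inv, hb, hnorm]; norm_num, fun c => ?_⟩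
  have key : ∀ τ, IsSiegel τ → (jac N (f τ) = ∑ M, c M * thetaProd M (f τ) ↔
      jac (fun k => γ (N k)) (h τ) = ∑ M : Sym (BinChar g) (g + 2),
        (b N)⁻¹ * (((symPerm γ)⁻¹ M : Multiset (BinChar g)).map a).prod *
          c ((symPerm γ)⁻¹ M) * thetaProd M (h τ)) := by
    intro τ hτ
    have hu' := pow_ne_zero (g + 2) (hu τ hτ)
    have h1 : ∑ M, c M * thetaProd M (f τ) = b N * u τ ^ (g + 2) *
        ∑ M : Sym (BinChar g) (g + 2),
        (b N)⁻¹ * (((symPerm γ)⁻¹ M : Multiset (BinChar g)).map a).prod *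
          c ((symPerm γ)⁻¹ M) * thetaProd M (h τ) := by
      rw [Finset.mul_sum]
      refine Fintype.sum_equiv (symPerm γ) _ _ fun M => ?_
      rw [hprod M τ hτ, symPerm_inv_apply]
      field_simp
    rw [hj N τ hτ, h1, mul_right_inj' (mul_ne_zero hb0 hu')]
  constructor
  · intro H τ hτ
    obtain ⟨σ, hσ, rfl⟩ := hhs τ hτ
    exact (key σ hσ).1 (H _ (hfm σ hσ))
  · intro H τ hτ
    obtain ⟨σ, hσ, rfl⟩ := hfs τ hτ
    exact (key σ hσ).2 (H _ (hhm σ hσ))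

lemma transports_transv_zero_prod (w : Fin g → ZMod 2) : Transports (transv (0, w)) := by
  refine transports_of_modular (f := shift 1 w) (h := id) (u := fun _ => 1)
    (fun τ h => isSiegel_shift h 1 w) (fun τ h => h)
    (fun τ h => ⟨_, isSiegel_shift h (-1) w, ?_⟩) (fun τ h => ⟨τ, h, rfl⟩)
    (fun _ _ => one_ne_zero) (norm_shiftFactor w)
    (fun k τ _ => by rw [theta_shift_one, one_mul]; rfl)
    (b := fun N => ∏ k, shiftFactor w (N k)) (fun N => ?_)
    (fun N τ h => by rw [jac_shift_one w N h, one_pow, mul_one]; rfl)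
  · rw [shift_shift, add_neg_cancel, shift_zero]
  · simp [norm_prod, norm_shiftFactor]

lemma rootFactor_ne_zero {p : ℂ} (hp : p ≠ 0) : rootFactor p ≠ 0 := by
  intro h
  have := rootFactor_sq hp
  rw [h, zero_pow two_ne_zero, mul_zero] at this
  exact div_ne_zero (neg_ne_zero.2 one_ne_zero) hp this.symm

lemma transports_swapAt (i : Fin g) : Transports (swapAt i) := by
  refine transports_of_modular (f := id) (h := invMat i) (u := fun τ => rootFactor (τ i i))
    (fun τ h => h) (fun τ h => isSiegel_invMat i h) (fun τ h => ⟨τ, h, rfl⟩)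
    (fun τ h => invMat_surj i h) (fun τ h => rootFactor_ne_zero (h.diag_ne_zero i))
    (norm_invFactor i) (fun k τ h => theta_inversion_zero i k h)
    (b := fun N => Complex.I * ∏ k, invFactor i (N k)) (fun N => ?_)
    (fun N τ h => jac_inversion i N h)
  simp [norm_prod, norm_invFactor]

/-- The congruence between a multiset of characteristics and `N` in the direction `x`. -/
def Admissible (N : Fin g → BinChar g) (x : BinChar g) (M : Multiset (BinChar g)) : Prop :=
  (M.map fun m => lift4 (quad m x)).sum = ∑ k, lift4 (quad (N k) x)

/-- Relations may be projected to the multisets admissible in the direction `x`. -/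
def Projects (x : BinChar g) : Prop :=
  ∀ N c, Rel N c → Rel N fun M => if Admissible N x M then c M else 0

lemma I_pow_eq_iff (a b : ℕ) : Complex.I ^ a = Complex.I ^ b ↔ (a : ZMod 4) = b := by
  rw [ZMod.natCast_eq_natCast_iff, Complex.I_pow_eq_pow_mod a, Complex.I_pow_eq_pow_mod b]
  exact ⟨fun h => Complex.isPrimitiveRoot_I.pow_inj (Nat.mod_lt _ four_pos)
    (Nat.mod_lt _ four_pos) h, fun h => congrArg _ h⟩

lemma projects_zero_prod (w : Fin g → ZMod 2) : Projects ((0, w) : BinChar g) := by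
  intro N c hc
  set x : BinChar g := (0, w)
  set r : ℂ := ∏ k, Complex.I ^ (quad (N k) x).val with hr
  let s : Sym (BinChar g) (g + 2) → ℂ := fun M =>
    ((M : Multiset (BinChar g)).map fun m => Complex.I ^ (quad m x).val).prod
  have hr' : r = Complex.I ^ (∑ k, (quad (N k) x).val) := Finset.prod_pow_eq_pow_sum _ _ _
  have hs' : ∀ M : Sym (BinChar g) (g + 2), s M =
      Complex.I ^ ((M : Multiset (BinChar g)).map fun m => (quad m x).val).sum := by
    intro M
    simp only [s]
    induction (M : Multiset (BinChar g)) using Multiset.induction_on with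
    | empty => simp
    | cons m M ih => simp [pow_add, ih]
  have hr0 : r ≠ 0 := by rw [hr']; exact pow_ne_zero _ Complex.I_ne_zero
  have hadm : ∀ M : Sym (BinChar g) (g + 2), Admissible N x M ↔ s M / r = 1 := by
    intro M
    rw [div_eq_one_iff_eq hr0, hr', hs', I_pow_eq_iff, Admissible]
    simp only [lift4, Nat.cast_sum, Nat.cast_multiset_sum, Multiset.map_map, Function.comp_def]
  have hpow : ∀ M : Sym (BinChar g) (g + 2), (s M / r) ^ 4 = 1 := by
    intro M
    rw [hr', hs', div_pow, ← pow_mul', ← pow_mul', pow_mul, pow_mul, Complex.I_pow_four]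
    simp
  have step : ∀ c, Rel N c → Rel N fun M => s M / r * c M := by
    intro c hc τ hτ
    have h1 := hc _ (isSiegel_shift hτ 2 w)
    rw [jac_shift_two w N hτ] at h1
    have h2 : ∀ M : Sym (BinChar g) (g + 2),
        thetaProd M (shift 2 w τ) = s M * thetaProd M τ := by
      intro M
      simp only [thetaProd, theta_shift_two, Multiset.prod_map_mul]
      rfl
    simp only [h2] at h1
    refine mul_left_cancel₀ hr0 (h1.trans ?_)
    rw [Finset.mul_sum]
    refine Finset.sum_congr rfl fun M _ => ?_
    field_simp
  have step2 := step _ (step _ hc)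
  have step3 := step _ step2
  intro τ hτ
  have e0 := hc τ hτ
  have e1 := step _ hc τ hτ
  have e2 := step2 τ hτ
  have e3 := step3 τ hτ
  have : jac N τ = (jac N τ + jac N τ + jac N τ + jac N τ) / 4 := by ring
  rw [this]
  nth_rewrite 1 [e0]
  nth_rewrite 1 [e1]
  nth_rewrite 1 [e2]
  rw [e3, ← Finset.sum_add_distrib, ← Finset.sum_add_distrib, ← Finset.sum_add_distrib,
    Finset.sum_div]
  refine Finset.sum_congr rfl fun M _ => ?_
  simp only [hadm]
  have h4 := hpow M
  generalize s M / r = ρ at h4 ⊢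
  split_ifs with h
  · rw [h]; ring
  · have : 1 + ρ + ρ ^ 2 + ρ ^ 3 = 0 := by
      refine (mul_eq_zero.1 (?_ : (ρ - 1) * _ = 0)).resolve_left (sub_ne_zero.2 h)
      linear_combination h4
    linear_combination (c M * thetaProd M τ / 4) * this

lemma Projects.of_isAffine {γ : Equiv.Perm (BinChar g)} {L} (hL : IsAffine γ L)
    (hγ : Transports γ) {x : BinChar g} (h : Projects (L x)) : Projects x := by
  intro N c hc
  obtain ⟨κ, -, hκ⟩ := hγ N
  have := h _ _ ((hκ c).1 hc)
  rw [hκ]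
  convert this using 2 with M
  obtain ⟨M', rfl⟩ := (symPerm γ).surjective M
  have : Admissible (fun k => γ (N k)) (L x) (symPerm γ M') ↔ Admissible N x M' := by
    simp only [Admissible, coe_symPerm, Multiset.map_map, Function.comp_def, hL.quad_eq]
  simp only [symPerm_inv_apply, this, mul_ite, mul_zero]

lemma Transports.of_isAffine {γ : Equiv.Perm (BinChar g)} {L} (hL : IsAffine γ L)
    (hγ : Transports γ) (hinv : γ⁻¹ = γ) {x : BinChar g} (h : Transports (transv (L x))) :
    Transports (transv x) := by
  have : transv x = γ * (transv (L x) * γ) := by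
    nth_rewrite 1 [← hinv]
    rw [eq_inv_mul_iff_mul_eq]
    ext1 m
    exact hL.map_transv x m
  rw [this]
  exact hγ.mul (h.mul hγ)

lemma swapAt_inv (i : Fin g) : (swapAt i)⁻¹ = swapAt i := Function.Involutive.toPerm_symm _

theorem transports_and_projects (x : BinChar g) : Transports (transv x) ∧ Projects x := by
  induction hn : (Finset.univ.filter fun i => x.1 i ≠ 0).card using Nat.strong_induction_on
    generalizing x with
  | _ n ih =>
  by_cases hx : x.1 = 0
  · obtain ⟨y, w⟩ := x
    obtain rfl : y = 0 := hx
    exact ⟨transports_transv_zero_prod w, projects_zero_prod w⟩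
  obtain ⟨i, hi⟩ := Function.ne_iff.1 hx
  have swap : ∀ y : BinChar g, y.1 = x.1 → y.2 i = 0 → Transports (transv y) ∧ Projects y := by
    intro y hy1 hy2
    have hlt : (Finset.univ.filter fun j => (swapAt i y).1 j ≠ 0).card < n := by
      rw [← hn]
      refine Finset.card_lt_card (Finset.ssubset_iff_of_subset ?_ |>.2 ⟨i, ?_⟩)
      · intro j
        simp only [Finset.mem_filter, Finset.mem_univ, true_and, swapAt_apply]
        by_cases hj : j = i
        · subst hj; simp [hy2]
        · simp [hj, hy1]
      · simp [swapAt_apply, hy2]; exact hi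
    obtain ⟨h1, h2⟩ := ih _ hlt _ rfl
    exact ⟨Transports.of_isAffine (isAffine_swapAt i) (transports_swapAt i) (swapAt_inv i) h1,
      Projects.of_isAffine (isAffine_swapAt i) (transports_swapAt i) h2⟩
  by_cases hi2 : x.2 i = 0
  · exact swap x rfl hi2
  · set w : BinChar g := (0, Pi.single i 1)
    have hw : weil w x = 1 := by
      rw [weil, Finset.sum_eq_single i]
      · simp [w, zmod_two_eq_one hi]
      · intro j _ hj; simp [w, hj]
      · simp
    have hT := transports_transv_zero_prod (Pi.single i 1 : Fin g → ZMod 2)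
    obtain ⟨h1, h2⟩ := swap (x + weil w x • w) (by simp [w])
      (by
        change x.2 i + weil w x * (Pi.single i 1 : Fin g → ZMod 2) i = 0
        rw [hw, Pi.single_eq_same, zmod_two_eq_one hi2]
        rfl)
    exact ⟨Transports.of_isAffine (isAffine_transv w) hT (transv_inv w) h1,
      Projects.of_isAffine (isAffine_transv w) hT h2⟩

lemma transports_of_mem {γ : Equiv.Perm (BinChar g)} (hγ : γ ∈ transvGroup g) : Transports γ :=
  transvGroup_induction transports_one
    (fun x _ h => (transports_and_projects x).1.mul h) hγ

lemma Rel.re {N : Fin g → BinChar g} {c : Sym (BinChar g) (g + 2) → ℂ} (h : Rel N c) :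
    Rel N fun M => ((c M).re : ℂ) := by
  intro τ hτ
  have h1 := h _ (isSiegel_negConj hτ)
  have h2 : ∀ M : Sym (BinChar g) (g + 2),
      thetaProd M (negConj τ) = (starRingEnd ℂ) (thetaProd M τ) := by
    intro M
    simp only [thetaProd, conj_theta, map_multiset_prod, Multiset.map_map, Function.comp_def]
  rw [conj_jac hτ] at h1
  have h3 := congrArg (starRingEnd ℂ) h1
  simp only [map_sum, map_mul, h2, Complex.conj_conj] at h3
  have : jac N τ = (jac N τ + jac N τ) / 2 := by ring
  rw [this]
  nth_rewrite 1 [h τ hτ]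
  rw [h3, ← Finset.sum_add_distrib, Finset.sum_div]
  refine Finset.sum_congr rfl fun M _ => ?_
  change _ = ((c M).re : ℂ) * _
  rw [Complex.re_eq_add_conj]
  ring

lemma Rel.project {N : Fin g → BinChar g} {c : Sym (BinChar g) (g + 2) → ℂ} (h : Rel N c) :
    Rel N fun M => if ∀ x, Admissible N x M then c M else 0 := by
  have : ∀ S : Finset (BinChar g),
      Rel N fun M => if ∀ x ∈ S, Admissible N x M then c M else 0 := by
    intro S
    induction S using Finset.induction_on with
    | empty => simpa using h
    | insert x S _ ih =>
      convert (transports_and_projects x).2 N _ ih using 2 with M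
      simp only [Finset.forall_mem_insert, ite_and]
  simpa using this Finset.univ

lemma exists_ch_eq {η : ThetaChar g} (h : IsChar η) : ∃ k, ch k = η := by
  refine ⟨(fun i => if η.1 i = 0 then 0 else 1, fun i => if η.2 i = 0 then 0 else 1),
    Prod.ext ?_ ?_⟩
  · funext i
    rcases h.1 i with h | h <;> simp [-ZMod.natCast_val, ch, h, ZMod.val_one]
  · funext i
    rcases h.2 i with h | h <;> simp [-ZMod.natCast_val, ch, h, ZMod.val_one]

lemma thetaProd_zero (τ : Matrix (Fin g) (Fin g) ℂ) : thetaProd 0 τ = 1 := by simp [thetaProd]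

lemma thetaProd_add (M M' : Multiset (BinChar g)) (τ : Matrix (Fin g) (Fin g) ℂ) :
    thetaProd (M + M') τ = thetaProd M τ * thetaProd M' τ := by simp [thetaProd]

lemma thetaProd_singleton (k : BinChar g) (τ : Matrix (Fin g) (Fin g) ℂ) :
    thetaProd {k} τ = theta (ch k) 0 τ := by simp [thetaProd]

lemma exists_eq_sum_thetaProd {f : Siegel g → ℂ} (hf : f ∈ thetanullwerteRing g) :
    ∃ (n : ℕ) (C : Fin n → ℂ) (M : Fin n → Multiset (BinChar g)),
      ∀ τ, f τ = ∑ d, C d * thetaProd (M d) τ.1 := by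
  rw [thetanullwerteRing, ← Subalgebra.mem_toSubmodule, Algebra.adjoin_eq_span,
    Submodule.mem_span_set'] at hf
  obtain ⟨n, C, F, rfl⟩ := hf
  have hM : ∀ d, ∃ M : Multiset (BinChar g), ∀ τ, (F d : Siegel g → ℂ) τ = thetaProd M τ.1 := by
    intro d
    refine Submonoid.closure_induction (fun f hf => ?_) ⟨0, fun τ => by simp [thetaProd_zero]⟩
      (fun f f' _ _ => ?_) (F d).2
    · obtain ⟨η, hη, -, rfl⟩ := hf
      obtain ⟨k, rfl⟩ := exists_ch_eq hη
      exact ⟨{k}, fun τ => (thetaProd_singleton k τ.1).symm⟩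
    · rintro ⟨M, hM⟩ ⟨M', hM'⟩
      exact ⟨M + M', fun τ => by rw [Pi.mul_apply, hM, hM', thetaProd_add]⟩
  choose M hM using hM
  exact ⟨n, C, M, fun τ => by simp [hM]⟩

lemma theta_shift_eight (w : Fin g → ZMod 2) (n : ℕ) (k : BinChar g)
    (τ : Matrix (Fin g) (Fin g) ℂ) : theta (ch k) 0 (shift (8 * n : ℝ) w τ) = theta (ch k) 0 τ := by
  induction n with
  | zero => simp [shift_zero]
  | succ n ih =>
    rw [← ih, show (8 * ((n + 1 : ℕ) : ℝ)) = 2 + (2 + (2 + (2 + 8 * n))) by push_cast; ring]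
    simp only [← shift_shift, theta_shift_two, ← mul_assoc, ← pow_add]
    rw [show ∀ m : ℕ, m + (m + (m + m)) = 4 * m by intro m; ring, pow_mul, Complex.I_pow_four, one_pow,
      one_mul]

lemma jac_shift_eight (w : Fin g → ZMod 2) (n : ℕ) (N : Fin g → BinChar g)
    {τ : Matrix (Fin g) (Fin g) ℂ} (hτ : IsSiegel τ) :
    jac N (shift (8 * n : ℝ) w τ) = jac N τ := by
  induction n with
  | zero => simp [shift_zero]
  | succ n ih =>
    rw [← ih, show (8 * ((n + 1 : ℕ) : ℝ)) = 2 + (2 + (2 + (2 + 8 * n))) by push_cast; ring]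
    simp only [← shift_shift]
    have h0 := isSiegel_shift hτ (8 * n) w
    have h1 := isSiegel_shift h0 2 w
    have h2 := isSiegel_shift h1 2 w
    rw [jac_shift_two w N (isSiegel_shift h2 2 w), jac_shift_two w N h2, jac_shift_two w N h1,
      jac_shift_two w N h0, Finset.prod_pow_eq_pow_sum]
    simp only [← mul_assoc, ← pow_add]
    rw [show ∀ m : ℕ, m + (m + (m + m)) = 4 * m by intro m; ring, pow_mul, Complex.I_pow_four, one_pow,
      one_mul]

lemma jac_eq_sum_card_eq (i : Fin g) {N : Fin g → BinChar g} {ι : Type*} [Fintype ι] {C : ι → ℂ}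
    {M : ι → Multiset (BinChar g)}
    (h : ∀ τ, IsSiegel τ → jac N τ = ∑ d, C d * thetaProd (M d) τ) {τ : Matrix (Fin g) (Fin g) ℂ}
    (hτ : IsSiegel τ) :
    jac N τ = ∑ d with Multiset.card (M d) = g + 2, C d * thetaProd (M d) τ := by
  set σ := invMat i τ with hσ
  have hσs : IsSiegel σ := isSiegel_invMat i hτ
  let w : Fin g → ZMod 2 := Pi.single i 1
  let a : Multiset (BinChar g) → ℂ := fun M => (M.map (invFactor i)).prod
  set b : ℂ := Complex.I * ∏ k, invFactor i (N k)
  let B : Multiset (BinChar g) → ℂ := fun M => a M * thetaProd (M.map (swapAt i)) σ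
  have hprod : ∀ (M : Multiset (BinChar g)) (n : ℕ) τ', IsSiegel τ' →
      invMat i τ' = shift (8 * n : ℝ) w σ →
      thetaProd M τ' = rootFactor (τ' i i) ^ Multiset.card M * B M := by
    intro M n τ' hτ' he
    have h1 : (M.map fun k => theta (ch k) 0 τ') = M.map fun k =>
        rootFactor (τ' i i) * invFactor i k * theta (ch (swapAt i k)) 0 σ :=
      Multiset.map_congr rfl fun k _ => by
        rw [theta_inversion_zero i k hτ', he, theta_shift_eight]
    rw [thetaProd, h1, Multiset.prod_map_mul, Multiset.prod_map_mul, Multiset.map_const',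
      Multiset.prod_replicate]
    simp only [B, a, thetaProd, Multiset.map_map, Function.comp_def, mul_assoc]
  have hjac : ∀ (n : ℕ) τ', IsSiegel τ' → invMat i τ' = shift (8 * n : ℝ) w σ →
      jac N τ' = b * rootFactor (τ' i i) ^ (g + 2) * jac (fun k => swapAt i (N k)) σ := by
    intro n τ' hτ' he
    rw [jac_inversion i N hτ', he, jac_shift_eight w n _ hσs]
  choose T hT hTσ using fun n : ℕ => invMat_surj i (isSiegel_shift hσs (8 * n) w)
  let u : ℕ → ℂ := fun n => rootFactor (T n i i)
  have hu2 : ∀ n : ℕ, Complex.I * u n ^ 2 = σ i i + 8 * n := by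
    intro n
    have hp := (hT n).diag_ne_zero i
    rw [rootFactor_sq hp, ← invMat_self i hp, hTσ]
    simp [-ZMod.natCast_val, shift, w, ZMod.val_one]
  have huinj : Function.Injective u := by
    intro m n hmn
    have := hu2 m
    rw [hmn, hu2 n] at this
    have h8 : (8 : ℂ) * n = 8 * m := add_left_cancel this
    exact_mod_cast (mul_left_cancel₀ (by norm_num) h8).symm
  let P : Polynomial ℂ := ∑ d, Polynomial.monomial (Multiset.card (M d)) (C d * B (M d)) -
    Polynomial.monomial (g + 2) (b * jac (fun k => swapAt i (N k)) σ)
  have hP : P = 0 := by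
    refine Polynomial.eq_zero_of_infinite_isRoot P
      ((Set.infinite_range_of_injective huinj).mono ?_)
    rintro _ ⟨n, rfl⟩
    have h1 := h _ (hT n)
    rw [hjac n _ (hT n) (hTσ n)] at h1
    simp only [hprod _ n _ (hT n) (hTσ n)] at h1
    simp only [Set.mem_ofPred_eq, Polynomial.IsRoot, P, Polynomial.eval_sub,
      Polynomial.eval_finsetSum, Polynomial.eval_monomial]
    rw [sub_eq_zero, mul_right_comm, h1]
    exact Finset.sum_congr rfl fun d _ => by ring
  have hcoeff := congrArg (fun p => Polynomial.coeff p (g + 2)) hP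
  simp only [P, Polynomial.coeff_sub, Polynomial.finsetSum_coeff, Polynomial.coeff_monomial,
    if_true, Polynomial.coeff_zero, sub_eq_zero, ← Finset.sum_filter] at hcoeff
  have he : invMat i τ = shift (8 * ((0 : ℕ) : ℝ)) w σ := by simp [shift_zero, σ]
  rw [hjac 0 τ hτ he, mul_right_comm, ← hcoeff, Finset.sum_mul]
  refine Finset.sum_congr rfl fun d hd => ?_
  rw [hprod _ 0 τ hτ he, (Finset.mem_filter.1 hd).2]
  ring

theorem exists_rel (hg : 1 ≤ g) {N : Fin g → BinChar g}
    (h : (fun τ : Siegel g => jac N τ.1) ∈ thetanullwerteRing g) : ∃ c, Rel N c := by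
  obtain ⟨n, C, M, hf⟩ := exists_eq_sum_thetaProd h
  refine ⟨fun M' => ∑ d with M d = M', C d, fun τ hτ => ?_⟩
  rw [jac_eq_sum_card_eq ⟨0, hg⟩ (fun τ hτ => hf ⟨τ, hτ⟩) hτ]
  have h1 : ∀ M' : Sym (BinChar g) (g + 2), (∑ d with M d = M', C d) * thetaProd M' τ =
      ∑ d with Multiset.card (M d) = g + 2, if M d = M' then C d * thetaProd (M d) τ else 0 := by
    intro M'
    rw [Finset.sum_mul, ← Finset.sum_filter, Finset.filter_filter]
    refine Finset.sum_congr (Finset.filter_congr fun d _ => ?_) fun d hd => by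
      rw [(Finset.mem_filter.1 hd).2.2]
    exact ⟨fun h => ⟨h ▸ M'.2, h⟩, And.right⟩
  simp only [h1]
  rw [Finset.sum_comm]
  refine Finset.sum_congr rfl fun d hd => ?_
  let M₀ : Sym (BinChar g) (g + 2) := ⟨M d, (Finset.mem_filter.1 hd).2⟩
  rw [Fintype.sum_eq_single M₀ fun M' hM' => if_neg fun h => hM' (Subtype.ext h.symm)]
  exact (if_pos rfl).symm

lemma exists_map_univ_eq {α : Type*} (n : ℕ) (M : Multiset α) (h : Multiset.card M = n) :
    ∃ v : Fin n → α, Finset.univ.val.map v = M := by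
  obtain ⟨l, rfl⟩ : ∃ l : List α, (l : Multiset α) = M := ⟨M.toList, M.coe_toList⟩
  rw [Multiset.coe_card] at h
  subst h
  exact ⟨l.get, by rw [Fin.univ_val_map, List.ofFn_get]⟩

/-- The multiset of the values of a family of `g + 2` characteristics. -/
def famSym (v : Fin (g + 2) → BinChar g) : Sym (BinChar g) (g + 2) :=
  ⟨Finset.univ.val.map v, by simp⟩

lemma coe_famSym (v : Fin (g + 2) → BinChar g) :
    (famSym v : Multiset (BinChar g)) = Finset.univ.val.map v := rfl

lemma exists_famSym_eq (M : Sym (BinChar g) (g + 2)) : ∃ v, famSym v = M := by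
  obtain ⟨v, hv⟩ := exists_map_univ_eq (g + 2) M.1 M.2
  exact ⟨v, Subtype.ext hv⟩

lemma symPerm_famSym (γ : Equiv.Perm (BinChar g)) (v : Fin (g + 2) → BinChar g) :
    symPerm γ (famSym v) = famSym fun j => γ (v j) :=
  Sym.coe_injective (by rw [coe_symPerm, coe_famSym, coe_famSym, Multiset.map_map]; rfl)

lemma thetaProd_famSym (v : Fin (g + 2) → BinChar g) (τ : Matrix (Fin g) (Fin g) ℂ) :
    thetaProd (famSym v) τ = ∏ j, theta (ch (v j)) 0 τ := by
  rw [thetaProd, coe_famSym, Multiset.map_map]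
  rfl

/-- The characteristics in `N` and `v` form an azygetic family. -/
def AzygFam (N : Fin g → BinChar g) (v : Fin (g + 2) → BinChar g) : Prop :=
  ∀ a b c : Fin g ⊕ Fin (g + 2), a ≠ b → a ≠ c → b ≠ c →
    Azyg (Sum.elim N v a) (Sum.elim N v b) (Sum.elim N v c)

lemma azygFam_of_admissible {N : Fin g → BinChar g} {v : Fin (g + 2) → BinChar g}
    (h : ∀ x, Admissible N x (famSym v)) : AzygFam N v := fun _ _ _ =>
  azyg_of_lift4 N v fun x => by
    have hx := h x
    rw [Admissible, coe_famSym, Multiset.map_map] at hx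
    exact hx

lemma AzygFam.injective (hg : 1 ≤ g) {N : Fin g → BinChar g} {v : Fin (g + 2) → BinChar g}
    (h : AzygFam N v) : Function.Injective (Sum.elim N v) :=
  injective_of_azyg (by simp; omega) _ h

lemma AzygFam.eq_famSym_stdEven (hg : 1 ≤ g) {v : Fin (g + 2) → BinChar g}
    (h : AzygFam (stdOdd g) v) (hv : ∀ j i, ¬((v j).1 i = 1 ∧ (v j).2 i = 1)) :
    famSym v = famSym (stdEven g) := by
  have : ∀ j, ∃ j', v j = stdEven g j' := fun j => by
    refine exists_eq_stdEven (hv j) fun a b hab => ?_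
    have h1 : weil (v j + stdOdd g a) (v j + stdOdd g b) = 1 :=
      h (Sum.inr j) (Sum.inl a) (Sum.inl b) (by simp) (by simp) (by simpa using hab)
    have h2 : weil (stdOdd g a) (stdOdd g b) = 1 :=
      weil_stdChar (by omega) (by omega) (by omega) (by omega)
        (by have := fun h => hab (Fin.ext h); omega)
    rw [weil_add_left, weil_add_right, weil_add_right, weil_self, h2, zero_add, ← add_assoc,
      add_eq_right, weil_comm (stdOdd g a)] at h1
    exact (CharTwo.add_eq_zero.1 h1).symm
  choose σ hσ using this
  have hinj : Function.Injective σ := fun a b hab => by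
    have h1 : v a = v b := by rw [hσ, hσ, hab]
    exact Sum.inr_injective (h.injective hg (a₁ := Sum.inr a) (a₂ := Sum.inr b) h1)
  have hbij : Function.Bijective σ := Finite.injective_iff_bijective.1 hinj
  refine Subtype.ext ?_
  change Finset.univ.val.map v = Finset.univ.val.map (stdEven g)
  rw [funext hσ]
  change Finset.univ.val.map (stdEven g ∘ Equiv.ofBijective σ hbij) = _
  rw [← Multiset.map_map]
  congr 1
  exact congrArg Finset.val (Finset.map_univ_equiv (Equiv.ofBijective σ hbij))

lemma Rel.norm_stdOdd (hg : 1 ≤ g) {c : Sym (BinChar g) (g + 2) → ℂ} (h : Rel (stdOdd g) c) :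
    ‖c (famSym (stdEven g))‖ = Real.pi ^ g := by
  set c' : Sym (BinChar g) (g + 2) → ℂ :=
    fun M => if ∀ x, Admissible (stdOdd g) x M then c M else 0 with hc'
  have h1 : c' (famSym (stdEven g)) = (-Real.pi : ℂ) ^ g := by
    refine eq_of_jac_stdOdd_diag fun t ht => ?_
    rw [h.project _ (isSiegel_diag ht), ← thetaProd_famSym]
    refine Fintype.sum_eq_single _ fun M hM => ?_
    by_contra hne
    have hadm : ∀ x, Admissible (stdOdd g) x M := by
      by_contra hcon
      exact hne (by simp only [if_neg hcon, zero_mul])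
    obtain ⟨v, rfl⟩ := exists_famSym_eq M
    refine hM ((azygFam_of_admissible hadm).eq_famSym_stdEven hg fun j i hi => hne ?_)
    rw [thetaProd_famSym, Finset.prod_eq_zero (Finset.mem_univ j) (theta_diag_eq_zero hi t),
      mul_zero]
  have h2 : c' (famSym (stdEven g)) = c (famSym (stdEven g)) := by
    refine if_pos ?_
    by_contra hcon
    have : (-Real.pi : ℂ) ^ g = 0 := by rw [← h1, hc']; exact if_neg hcon
    exact pow_ne_zero _ (neg_ne_zero.2 (Complex.ofReal_ne_zero.2 Real.pi_ne_zero)) this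
  rw [← h2, h1, norm_pow, norm_neg, Complex.norm_real, Real.norm_of_nonneg Real.pi_pos.le]

/-- The position of the `j`-th member of a frame in a family of odd and even characteristics. -/
def framePos (g j : ℕ) : Fin g ⊕ Fin (g + 2) :=
  if h : j % 2 = 0 ∧ 2 ≤ j ∧ j ≤ 2 * g then Sum.inl ⟨j / 2 - 1, by omega⟩
  else Sum.inr (Fin.ofNat (g + 2) ((j + 1) / 2))

lemma framePos_odd (k : Fin g) : framePos g (2 * k + 2) = Sum.inl k := by
  rw [framePos, dif_pos (by omega)]
  congr 1
  ext
  simp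

lemma framePos_even (j : Fin (g + 2)) : framePos g (2 * j - 1) = Sum.inr j := by
  rw [framePos, dif_neg (by omega)]
  congr 1
  ext
  simp only [Fin.ofNat]
  rw [Nat.mod_eq_of_lt] <;> omega

lemma exists_framePos {j : ℕ} (hj : j ≤ 2 * g + 1) :
    (∃ k : Fin g, j = 2 * k + 2) ∨ ∃ k : Fin (g + 2), j = 2 * k - 1 := by
  by_cases h : j % 2 = 0 ∧ 2 ≤ j
  · exact Or.inl ⟨⟨j / 2 - 1, by omega⟩, by simp only; omega⟩
  · exact Or.inr ⟨⟨(j + 1) / 2, by omega⟩, by simp only; omega⟩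

lemma AzygFam.exists_map_std {N : Fin g → BinChar g} {v : Fin (g + 2) → BinChar g}
    (h : AzygFam N v) (hN : ∀ k, parity (N k) = 1) (hv : ∀ j, parity (v j) = 0) :
    ∃ γ ∈ transvGroup g, (∀ k, γ (N k) = stdOdd g k) ∧ ∀ j, γ (v j) = stdEven g j := by
  have hinj : ∀ i j, i ≤ 2 * g + 1 → j ≤ 2 * g + 1 → i ≠ j → framePos g i ≠ framePos g j := by
    intro i j hi hj hij he
    obtain ⟨k, rfl⟩ | ⟨k, rfl⟩ := exists_framePos hi <;>
      obtain ⟨l, rfl⟩ | ⟨l, rfl⟩ := exists_framePos hj <;>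
      simp only [framePos_odd, framePos_even, Sum.inl.injEq, Sum.inr.injEq, reduceCtorEq] at he <;>
      exact hij (by rw [he])
  have hf : IsFrame fun j => Sum.elim N v (framePos g j) := by
    refine ⟨fun i j k hi hj hk hij hik hjk => h _ _ _ (hinj i j hi hj hij) (hinj i k hi hk hik)
      (hinj j k hj hk hjk), fun j hj => ?_⟩
    obtain ⟨k, rfl⟩ | ⟨k, rfl⟩ := exists_framePos hj
    · simp only [framePos_odd, Sum.elim_inl]
      rw [hN, parity_stdChar_even k k.2]
    · simp only [framePos_even, Sum.elim_inr]
      rw [hv]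
      rcases Nat.eq_zero_or_pos k.1 with h0 | h0
      · rw [h0, Nat.mul_zero, Nat.zero_sub, stdChar_zero]
        simp [parity]
      · rw [show 2 * k.1 - 1 = 2 * (k.1 - 1) + 1 by omega, parity_stdChar_odd]
  obtain ⟨γ, hγ, hmap⟩ := hf.exists_map_eq_stdChar
  refine ⟨γ, hγ, fun k => ?_, fun j => ?_⟩
  · have := hmap (2 * k + 2) (by omega)
    rwa [framePos_odd] at this
  · have := hmap (2 * j - 1) (by omega)
    rwa [framePos_even] at this

theorem Rel.norm_eq (hg : 1 ≤ g) {N : Fin g → BinChar g} {c : Sym (BinChar g) (g + 2) → ℂ}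
    (hc : Rel N c) {v : Fin (g + 2) → BinChar g} (h : AzygFam N v)
    (hN : ∀ k, parity (N k) = 1) (hv : ∀ j, parity (v j) = 0) :
    ‖c (famSym v)‖ = Real.pi ^ g := by
  obtain ⟨γ, hγ, h1, h2⟩ := h.exists_map_std hN hv
  obtain ⟨κ, hκ, hrel⟩ := transports_of_mem hγ N
  have h3 := (hrel c).1 hc
  rw [funext h1] at h3
  have h4 := h3.norm_stdOdd hg
  rwa [← funext h2, ← symPerm_famSym, symPerm_inv_apply, norm_mul, hκ, one_mul] at h4

lemma isChar_ch (k : BinChar g) : IsChar (ch k) := by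
  have h : ∀ a : ZMod 2, (a.val : ℝ) / 2 = 0 ∨ (a.val : ℝ) / 2 = 1 / 2 := by
    intro a
    obtain rfl | rfl : a = 0 ∨ a = 1 := by revert a; decide
    · left; simp
    · right; rw [ZMod.val_one, Nat.cast_one]
  exact ⟨fun i => h _, fun i => h _⟩

lemma ch_injective : Function.Injective (ch : BinChar g → ThetaChar g) := by
  intro k l h
  have key : ∀ a b : ZMod 2, (a.val : ℝ) / 2 = (b.val : ℝ) / 2 → a = b := by
    intro a b hab
    have : (a.val : ℝ) = b.val := by linarith
    exact ZMod.val_injective 2 (Nat.cast_injective this)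
  exact Prod.ext (funext fun i => key _ _ (congrFun (congrArg Prod.fst h) i))
    (funext fun i => key _ _ (congrFun (congrArg Prod.snd h) i))

lemma isEvenChar_ch (k : BinChar g) : IsEvenChar (ch k) ↔ parity k = 0 := by
  have h1 : parity k = ((∑ i, (k.1 i).val * (k.2 i).val : ℕ) : ZMod 2) := by
    simp [parity]
  have h2 : (4 * ∑ i, (ch k).1 i * (ch k).2 i : ℝ) =
      ((∑ i, (k.1 i).val * (k.2 i).val : ℕ) : ℤ) := by
    rw [Finset.mul_sum]
    push_cast
    exact Finset.sum_congr rfl fun i _ => by simp only [ch]; ring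
  rw [IsEvenChar, h1, h2, ZMod.natCast_eq_zero_iff_even, ← Int.even_coe_nat, even_iff_exists_two_mul]
  exact exists_congr fun m => by norm_cast

lemma isOddChar_ch (k : BinChar g) : IsOddChar (ch k) ↔ parity k = 1 := by
  rw [IsOddChar, isEvenChar_ch]
  exact ⟨zmod_two_eq_one, fun h => h ▸ one_ne_zero⟩

lemma charAdd_ch (k l : BinChar g) : charAdd (ch k) (ch l) = ch (k + l) := by
  have key : ∀ a b : ZMod 2, Int.fract ((a.val : ℝ) / 2 + (b.val : ℝ) / 2) =
      ((a + b).val : ℝ) / 2 := by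
    intro a b
    obtain rfl | rfl : a = 0 ∨ a = 1 := by revert a; decide
    all_goals obtain rfl | rfl : b = 0 ∨ b = 1 := by revert b; decide
    · simp
    · rw [zero_add, ZMod.val_one, ZMod.val_zero]
      norm_num
    · rw [add_zero, ZMod.val_one, ZMod.val_zero]
      norm_num
    · rw [show (1 + 1 : ZMod 2) = 0 from rfl, ZMod.val_one, ZMod.val_zero]
      norm_num
  exact Prod.ext (funext fun i => key _ _) (funext fun i => key _ _)

lemma azygetic_ch (a b c : BinChar g) : Azygetic (ch a) (ch b) (ch c) ↔ Azyg a b c := by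
  have h1 : weil (a + b) (a + c) = parity a + parity b + parity c + parity (a + b + c) := by
    simp only [parity_add, weil_add_left, weil_add_right, weil_self, weil_comm b a]
    linear_combination -(parity a + parity b + parity c) * (CharTwo.two_eq_zero : (2 : ZMod 2) = 0)
  simp only [Azygetic, eSign, charAdd_ch, isEvenChar_ch, Azyg, h1]
  generalize parity (a + b + c) = s
  generalize parity a = x
  generalize parity b = y
  generalize parity c = z
  revert s x y z
  decide

/-- Completion of the odd characteristics `η` to a fundamental system. -/
def IsCompletion (η : Fin g → ThetaChar g) (s : Finset (ThetaChar g)) : Prop :=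
  s.card = g + 2 ∧ (∀ ζ ∈ s, IsChar ζ ∧ IsEvenChar ζ) ∧
    IsFundamentalSystem g (Finset.image η Finset.univ ∪ s)

lemma image_sumElim (N : Fin g → BinChar g) (v : Fin (g + 2) → BinChar g) :
    Finset.univ.image (fun a => ch (Sum.elim N v a)) =
      Finset.univ.image (fun k => ch (N k)) ∪ Finset.univ.image fun j => ch (v j) := by
  ext ζ
  simp

lemma isCompletion_of_azygFam (hg : 1 ≤ g) {N : Fin g → BinChar g} {v : Fin (g + 2) → BinChar g}
    (h : AzygFam N v) (hN : ∀ k, parity (N k) = 1) (hv : ∀ j, parity (v j) = 0) :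
    IsCompletion (fun k => ch (N k)) (Finset.univ.image fun j => ch (v j)) := by
  have hinj := h.injective hg
  have hinj' : Function.Injective fun a => ch (Sum.elim N v a) := ch_injective.comp hinj
  have hinjN : Function.Injective fun k => ch (N k) := hinj'.comp Sum.inl_injective
  have hinjv : Function.Injective fun j => ch (v j) := hinj'.comp Sum.inr_injective
  refine ⟨?_, ?_, ?_, ?_, ?_, ?_⟩
  · rw [Finset.card_image_of_injective _ hinjv, Finset.card_fin]
  · intro ζ hζ
    obtain ⟨j, -, rfl⟩ := Finset.mem_image.1 hζ
    exact ⟨isChar_ch _, (isEvenChar_ch _).2 (hv j)⟩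
  · rw [← image_sumElim, Finset.card_image_of_injective _ hinj', Finset.card_univ,
      Fintype.card_sum, Fintype.card_fin, Fintype.card_fin]
    ring
  · intro ζ hζ
    rw [← image_sumElim] at hζ
    obtain ⟨a, -, rfl⟩ := Finset.mem_image.1 hζ
    exact isChar_ch _
  · have : (Finset.univ.image (fun k => ch (N k)) ∪ Finset.univ.image fun j => ch (v j)).filter
        (fun ζ => IsOddChar ζ) = Finset.univ.image fun k => ch (N k) := by
      rw [Finset.filter_union, Finset.filter_true_of_mem, Finset.filter_false_of_mem,
        Finset.union_empty]
      · intro ζ hζ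
        obtain ⟨j, -, rfl⟩ := Finset.mem_image.1 hζ
        rw [isOddChar_ch, hv]
        exact zero_ne_one
      · intro ζ hζ
        obtain ⟨k, -, rfl⟩ := Finset.mem_image.1 hζ
        exact (isOddChar_ch _).2 (hN k)
    rw [this, Finset.card_image_of_injective _ hinjN, Finset.card_fin]
  · rw [← image_sumElim]
    intro a ha b hb c hc hab hac hbc
    obtain ⟨a, -, rfl⟩ := Finset.mem_image.1 ha
    obtain ⟨b, -, rfl⟩ := Finset.mem_image.1 hb
    obtain ⟨c, -, rfl⟩ := Finset.mem_image.1 hc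
    exact (azygetic_ch _ _ _).2
      (h a b c (fun e => hab (e ▸ rfl)) (fun e => hac (e ▸ rfl)) fun e => hbc (e ▸ rfl))

lemma IsCompletion.exists_azygFam {N : Fin g → BinChar g} {s : Finset (ThetaChar g)}
    (h : IsCompletion (fun k => ch (N k)) s) :
    ∃ v, AzygFam N v ∧ (∀ j, parity (v j) = 0) ∧ s.val = (famSym v : Multiset _).map ch := by
  obtain ⟨hcard, heven, hF, -, -, hazy⟩ := h
  obtain ⟨w, hw⟩ := exists_map_univ_eq (g + 2) s.val hcard
  have hws : ∀ j, w j ∈ s := fun j => by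
    rw [← Finset.mem_val, ← hw]
    exact Multiset.mem_map_of_mem _ (Finset.mem_univ j)
  choose v hv using fun j => exists_ch_eq (heven _ (hws j)).1
  obtain rfl : (fun j => ch (v j)) = w := funext hv
  have hs : s = Finset.univ.image fun j => ch (v j) := by
    ext ζ
    rw [← Finset.mem_val, ← hw]
    simp only [Multiset.mem_map, Finset.mem_val, Finset.mem_image]
  have hinj : Function.Injective fun a => ch (Sum.elim N v a) := by
    rw [← Set.injOn_univ, ← Finset.coe_univ, ← Finset.card_image_iff, image_sumElim, ← hs, hF,
      Finset.card_univ, Fintype.card_sum, Fintype.card_fin, Fintype.card_fin]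
    ring
  refine ⟨v, fun a b c hab hac hbc => ?_, fun j => (isEvenChar_ch _).1 (heven _ (hws j)).2, ?_⟩
  · have hmem : ∀ a, ch (Sum.elim N v a) ∈ Finset.univ.image (fun k => ch (N k)) ∪ s := fun a => by
      rw [hs, ← image_sumElim]
      exact Finset.mem_image_of_mem _ (Finset.mem_univ a)
    exact (azygetic_ch _ _ _).1 (hazy _ (hmem a) _ (hmem b) _ (hmem c) (hinj.ne hab) (hinj.ne hac)
      (hinj.ne hbc))
  · rw [coe_famSym, Multiset.map_map, ← hw]
    rfl

/-- The multiset of binary characteristics belonging to a completion. -/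
def completionSym (g : ℕ) (s : Finset (ThetaChar g)) : Sym (BinChar g) (g + 2) :=
  if h : ∃ M : Sym (BinChar g) (g + 2), s.val = (M : Multiset _).map ch then h.choose
  else famSym 0

lemma completionSym_eq {s : Finset (ThetaChar g)} {M : Sym (BinChar g) (g + 2)}
    (h : s.val = (M : Multiset _).map ch) : completionSym g s = M := by
  have hex : ∃ M : Sym (BinChar g) (g + 2), s.val = (M : Multiset _).map ch := ⟨M, h⟩
  rw [completionSym, dif_pos hex]
  exact Sym.coe_injective (Multiset.map_injective ch_injective (hex.choose_spec.symm.trans h))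

lemma prod_theta_eq_thetaProd {s : Finset (ThetaChar g)} {M : Sym (BinChar g) (g + 2)}
    (h : s.val = (M : Multiset _).map ch) (τ : Matrix (Fin g) (Fin g) ℂ) :
    ∏ ζ ∈ s, theta ζ 0 τ = thetaProd M τ := by
  rw [Finset.prod, h, Multiset.map_map]
  rfl

lemma IsCompletion.mem_powerset {η : Fin g → ThetaChar g} {s : Finset (ThetaChar g)}
    (h : IsCompletion η s) : s ∈ (Finset.univ.image (ch : BinChar g → ThetaChar g)).powerset :=
  Finset.mem_powerset.2 fun ζ hζ => by
    obtain ⟨k, rfl⟩ := exists_ch_eq (h.2.1 ζ hζ).1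
    exact Finset.mem_image_of_mem _ (Finset.mem_univ k)

lemma Rel.exists_completion_of_ne_zero (hg : 1 ≤ g) {N : Fin g → BinChar g}
    (hN : ∀ k, parity (N k) = 1) {c : Sym (BinChar g) (g + 2) → ℂ} {M : Sym (BinChar g) (g + 2)}
    {τ : Matrix (Fin g) (Fin g) ℂ}
    (h : (if ∀ x, Admissible N x M then c M else 0) * thetaProd M τ ≠ 0) :
    ∃ s, IsCompletion (fun k => ch (N k)) s ∧ completionSym g s = M := by
  have hadm : ∀ x, Admissible N x M := by
    by_contra hcon
    exact h (by simp only [if_neg hcon, zero_mul])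
  obtain ⟨v, rfl⟩ := exists_famSym_eq M
  have hv : ∀ j, parity (v j) = 0 := by
    intro j
    by_contra hj
    refine h ?_
    rw [thetaProd_famSym, Finset.prod_eq_zero (Finset.mem_univ j)
      (theta_eq_zero (zmod_two_eq_one hj) τ), mul_zero]
  have hazy := azygFam_of_admissible hadm
  have hinj : Function.Injective fun j => ch (v j) :=
    ch_injective.comp ((hazy.injective hg).comp Sum.inr_injective)
  refine ⟨_, isCompletion_of_azygFam hg hazy hN hv, completionSym_eq ?_⟩
  rw [coe_famSym, Multiset.map_map, Finset.image_val_of_injOn hinj.injOn]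
  rfl

theorem Rel.exists_signs (hg : 1 ≤ g) {N : Fin g → BinChar g} (hN : ∀ k, parity (N k) = 1)
    {c : Sym (BinChar g) (g + 2) → ℂ} (h : Rel N c) {𝒮 : Finset (Finset (ThetaChar g))}
    (h𝒮 : ∀ s, s ∈ 𝒮 ↔ IsCompletion (fun k => ch (N k)) s) :
    ∃ ε : Finset (ThetaChar g) → ℤ, (∀ s ∈ 𝒮, ε s = 1 ∨ ε s = -1) ∧
      ∀ τ, IsSiegel τ → jac N τ =
        (Real.pi : ℂ) ^ g * ∑ s ∈ 𝒮, (ε s : ℂ) * ∏ ζ ∈ s, theta ζ 0 τ := by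
  have hrel := h.re.project
  set c' : Sym (BinChar g) (g + 2) → ℂ :=
    fun M => if ∀ x, Admissible N x M then ((c M).re : ℂ) else 0 with hc'
  have hsign : ∀ s ∈ 𝒮, ∃ e : ℤ, (e = 1 ∨ e = -1) ∧
      c' (completionSym g s) = (Real.pi : ℂ) ^ g * e := by
    intro s hs
    obtain ⟨v, hv, hpar, hsv⟩ := ((h𝒮 s).1 hs).exists_azygFam
    rw [completionSym_eq hsv]
    have hnorm := hrel.norm_eq hg hv hN hpar
    obtain ⟨r, hr⟩ : ∃ r : ℝ, c' (famSym v) = r := by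
      simp only [hc']
      split_ifs
      · exact ⟨_, rfl⟩
      · exact ⟨0, Complex.ofReal_zero.symm⟩
    rw [hr, Complex.norm_real, Real.norm_eq_abs, abs_eq (by positivity)] at hnorm
    rw [hr]
    obtain rfl | rfl := hnorm
    · exact ⟨1, Or.inl rfl, by push_cast; ring⟩
    · exact ⟨-1, Or.inr rfl, by push_cast; ring⟩
  choose! ε hε hcε using hsign
  refine ⟨ε, hε, fun τ hτ => ?_⟩
  have hval : ∀ s ∈ 𝒮, s.val = (completionSym g s : Multiset _).map ch := by
    intro s hs
    obtain ⟨v, -, -, hsv⟩ := ((h𝒮 s).1 hs).exists_azygFam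
    rw [completionSym_eq hsv, hsv]
  have hinj : Set.InjOn (completionSym g) 𝒮 := fun s hs t ht hst =>
    Finset.val_injective ((hval s hs).trans (hst ▸ (hval t ht).symm))
  rw [hrel τ hτ, ← Finset.sum_subset (Finset.subset_univ (𝒮.image (completionSym g))),
    Finset.sum_image hinj, Finset.mul_sum]
  · refine Finset.sum_congr rfl fun s hs => ?_
    rw [prod_theta_eq_thetaProd (hval s hs), ← mul_assoc, ← hcε s hs]
  · intro M _ hM
    by_contra hne
    have hne' : c' M * thetaProd M τ ≠ 0 := hne
    rw [hc'] at hne'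
    obtain ⟨s, hs, rfl⟩ := exists_completion_of_ne_zero hg hN (c := fun M => ((c M).re : ℂ)) hne'
    exact hM (Finset.mem_image_of_mem _ ((h𝒮 s).2 hs))

lemma Rel.exists_completion (hg : 1 ≤ g) {N : Fin g → BinChar g} (hN : ∀ k, parity (N k) = 1)
    {c : Sym (BinChar g) (g + 2) → ℂ} (h : Rel N c) {τ : Matrix (Fin g) (Fin g) ℂ}
    (hτ : IsSiegel τ) (hne : jac N τ ≠ 0) : ∃ s, IsCompletion (fun k => ch (N k)) s := by
  rw [h.project τ hτ] at hne
  obtain ⟨M, -, hM⟩ := Finset.exists_ne_zero_of_sum_ne_zero hne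
  exact (exists_completion_of_ne_zero hg hN hM).imp fun _ => And.left

end ThetaNull

/-- **Igusa's theorem.** If `η₁,…,η_g` are odd characteristics such that
`J(η₁,…,η_g)` is not identically zero on `H_g` and lies in the ring of
Thetanullwerte, then `η₁,…,η_g` can be completed to a fundamental system, and
`J(η₁,…,η_g)(τ) = π^g ∑_{s ∈ 𝒮} ± ∏_{η ∈ s} θ[η](0;τ)`, the sum running over
the collection `𝒮` of all `(g+2)`-element sets `s` of even characteristics such
that `{η₁,…,η_g} ∪ s` is a fundamental system. -/
theorem igusa (g : ℕ) (hg : 1 ≤ g) (η : Fin g → ThetaChar g)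
    (hchar : ∀ k, IsChar (η k)) (hodd : ∀ k, IsOddChar (η k))
    (hnz : ∃ τ : Siegel g, jacobianNullwert η τ.1 ≠ 0)
    (hring : (fun τ : Siegel g => jacobianNullwert η τ.1) ∈
      thetanullwerteRing g) :
    (∃ s : Finset (ThetaChar g), s.card = g + 2 ∧
        (∀ ζ ∈ s, IsChar ζ ∧ IsEvenChar ζ) ∧
        IsFundamentalSystem g (Finset.image η Finset.univ ∪ s)) ∧
      ∃ 𝒮 : Finset (Finset (ThetaChar g)),
        (∀ s : Finset (ThetaChar g), s ∈ 𝒮 ↔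
          s.card = g + 2 ∧ (∀ ζ ∈ s, IsChar ζ ∧ IsEvenChar ζ) ∧
            IsFundamentalSystem g (Finset.image η Finset.univ ∪ s)) ∧
        ∃ ε : Finset (ThetaChar g) → ℤ, (∀ s ∈ 𝒮, ε s = 1 ∨ ε s = -1) ∧
          ∀ τ : Siegel g, jacobianNullwert η τ.1 =
            (Real.pi : ℂ) ^ g *
              ∑ s ∈ 𝒮, (ε s : ℂ) * ∏ ζ ∈ s, theta ζ 0 τ.1 := by
  choose N hηN using fun k => ThetaNull.exists_ch_eq (hchar k)
  obtain rfl : (fun k => ThetaNull.ch (N k)) = η := funext hηN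
  have hN : ∀ k, ThetaNull.parity (N k) = 1 := fun k => (ThetaNull.isOddChar_ch _).1 (hodd k)
  obtain ⟨c, hc⟩ := ThetaNull.exists_rel hg hring
  obtain ⟨τ, hτ⟩ := hnz
  refine ⟨hc.exists_completion hg hN τ.2 hτ, ?_⟩
  let 𝒮 : Finset (Finset (ThetaChar g)) :=
    (Finset.univ.image (ThetaNull.ch : ThetaNull.BinChar g → ThetaChar g)).powerset.filter
      (ThetaNull.IsCompletion fun k => ThetaNull.ch (N k))
  have h𝒮 : ∀ s, s ∈ 𝒮 ↔ ThetaNull.IsCompletion (fun k => ThetaNull.ch (N k)) s := fun s =>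
    ⟨fun h => (Finset.mem_filter.1 h).2, fun h => Finset.mem_filter.2 ⟨h.mem_powerset, h⟩⟩
  obtain ⟨ε, hε, hsum⟩ := hc.exists_signs hg hN h𝒮
  exact ⟨𝒮, h𝒮, ε, hε, fun τ => hsum τ.1 τ.2⟩

end
end

section
/- Let g ≥ 2 and let (i₁,…,i_{2g+2}) be a permutation of (1,…,2g+2). For 1 ≤ k ≤ g let η_k := η_{T_k ∘ U} with T_k := {i₁,…,i_g} ∖ {i_k}, and for g+1 ≤ k ≤ 2g+2 let η_k := η_{T_k ∘ U} with T_k := {i₁,…,i_g} ∪ {i_k}. Then the characteristics η₁,…,η_{2g+2} are pairwise distinct, η₁,…,η_g are odd, η_{g+1},…,η_{2g+2} are even, and {η₁,…,η_g,η_{g+1},…,η_{2g+2}} is a fundamental system of analytic theta characteristics. -/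
open scoped Classical BigOperators

noncomputable section

/-- The basic characteristic `η_k` for `1 ≤ k ≤ 2g+2`: for `k = 2k'-1` odd the
top vector has `1/2` in the `k'`-th entry (zero vector if `k' = g+1`) and the
bottom vector has `1/2` in the first `k'-1` entries; for `k = 2k'` even the top
vector has `1/2` in the `k'`-th entry and the bottom vector has `1/2` in the
first `k'` entries. -/
def etaBase (g k : ℕ) : ThetaChar g :=
  (fun i => if (i : ℕ) + 1 = (k + 1) / 2 then 1 / 2 else 0,
   fun i => if (i : ℕ) < k / 2 then 1 / 2 else 0)

/-- `η_S := ∑_{k ∈ S, k ≠ 2g+2} η_k`, the sum taken entrywise modulo 1. -/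
def etaSet (g : ℕ) (S : Finset ℕ) : ThetaChar g :=
  (fun i => Int.fract (∑ k ∈ S.erase (2 * g + 2), (etaBase g k).1 i),
   fun i => Int.fract (∑ k ∈ S.erase (2 * g + 2), (etaBase g k).2 i))

/-- `U = {1, 3, …, 2g+1}`. -/
def Uset (g : ℕ) : Finset ℕ := (Finset.range (g + 1)).image fun j => 2 * j + 1

/-- `i` represents a permutation `(i₁,…,i_{2g+2})` of `(1,…,2g+2)`. -/
def IsPermIndex (g : ℕ) (i : Fin (2 * g + 2) → ℕ) : Prop :=
  Function.Injective i ∧ Finset.image i Finset.univ = Finset.Icc 1 (2 * g + 2)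

/-- Given a permutation `(i₁,…,i_{2g+2})` of `(1,…,2g+2)`, the characteristic
`η_k := η_{T_k ∘ U}` where `T_k = {i₁,…,i_g} ∖ {i_k}` for `1 ≤ k ≤ g` and
`T_k = {i₁,…,i_g} ∪ {i_k}` for `g+1 ≤ k ≤ 2g+2`. -/
def fsChars (g : ℕ) (i : Fin (2 * g + 2) → ℕ) : Fin (2 * g + 2) → ThetaChar g :=
  fun k =>
    let T0 : Finset ℕ :=
      Finset.image i (Finset.univ.filter fun l : Fin (2 * g + 2) => (l : ℕ) < g)
    if (k : ℕ) < g then etaSet g (symmDiff (T0.erase (i k)) (Uset g))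
    else etaSet g (symmDiff (insert (i k) T0) (Uset g))

/-- The system of `2g+2` characteristics obtained from a permutation
`(i₁,…,i_{2g+2})` of `(1,…,2g+2)`. -/
def fsSystem (g : ℕ) (i : Fin (2 * g + 2) → ℕ) : Finset (ThetaChar g) :=
  Finset.image (fsChars g i) Finset.univ

/-- The family `𝓕` of all fundamental systems obtained from permutations of
`(1,…,2g+2)`. -/
def FSfamily (g : ℕ) : Set (Finset (ThetaChar g)) :=
  {F | ∃ i : Fin (2 * g + 2) → ℕ, IsPermIndex g i ∧ F = fsSystem g i}

/-- The real number `0` or `1/2` attached to a residue modulo `2`. -/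
def halfVal (z : ZMod 2) : ℝ := (z.val : ℝ) / 2

/-- The residues modulo `2` of twice the top entries of `etaSet g S`. -/
def topBits (g : ℕ) (S : Finset ℕ) (i : ℕ) : ZMod 2 :=
  ∑ k ∈ S.erase (2 * g + 2), if i + 1 = (k + 1) / 2 then 1 else 0

/-- The residues modulo `2` of twice the bottom entries of `etaSet g S`. -/
def bottomBits (g : ℕ) (S : Finset ℕ) (i : ℕ) : ZMod 2 :=
  ∑ k ∈ S.erase (2 * g + 2), if i < k / 2 then 1 else 0

theorem halfVal_zero : halfVal 0 = 0 := by simp [halfVal]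

theorem halfVal_one : halfVal 1 = 1 / 2 := by simp [halfVal, ZMod.val_one]

theorem zmod_two_cases (a : ZMod 2) : a = 0 ∨ a = 1 := by
  revert a; decide

theorem fract_halfVal (a : ZMod 2) : Int.fract (halfVal a) = halfVal a := by
  rw [Int.fract_eq_self]
  rcases zmod_two_cases a with rfl | rfl <;> norm_num [halfVal_zero, halfVal_one]

theorem fract_halfVal_add (a b : ZMod 2) :
    Int.fract (halfVal a + halfVal b) = halfVal (a + b) := by
  rcases zmod_two_cases a with rfl | rfl <;> rcases zmod_two_cases b with rfl | rfl
  · simp [halfVal_zero]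
  · rw [halfVal_zero, zero_add, zero_add, fract_halfVal]
  · rw [halfVal_zero, add_zero, add_zero, fract_halfVal]
  · rw [CharTwo.add_self_eq_zero (1 : ZMod 2), halfVal_zero, halfVal_one]
    norm_num

theorem fract_sum_half (S : Finset ℕ) (p : ℕ → Prop) [DecidablePred p] :
    Int.fract (∑ k ∈ S, if p k then (1 / 2 : ℝ) else 0) =
      halfVal (∑ k ∈ S, if p k then 1 else 0) := by
  induction S using Finset.induction_on with
  | empty => simp [halfVal_zero]
  | insert a S ha ih =>
    rw [Finset.sum_insert ha, Finset.sum_insert ha, ← fract_halfVal_add, ← ih,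
      Int.fract_eq_fract]
    refine ⟨⌊∑ k ∈ S, if p k then (1 / 2 : ℝ) else 0⌋, ?_⟩
    rw [Int.fract]
    split_ifs <;> simp only [halfVal_zero, halfVal_one] <;> ring

theorem etaSet_eq (g : ℕ) (S : Finset ℕ) :
    etaSet g S = (fun i : Fin g => halfVal (topBits g S i),
      fun i : Fin g => halfVal (bottomBits g S i)) := by
  refine Prod.ext (funext fun i => ?_) (funext fun i => ?_)
  · exact fract_sum_half _ fun k => (i : ℕ) + 1 = (k + 1) / 2
  · exact fract_sum_half _ fun k => (i : ℕ) < k / 2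

theorem isChar_etaSet (g : ℕ) (S : Finset ℕ) : IsChar (etaSet g S) := by
  have h (a : ZMod 2) : halfVal a = 0 ∨ halfVal a = 1 / 2 := by
    rcases zmod_two_cases a with rfl | rfl
    · exact Or.inl halfVal_zero
    · exact Or.inr halfVal_one
  rw [etaSet_eq]
  exact ⟨fun _ => h _, fun _ => h _⟩

theorem sum_symmDiff_of_charTwo {α M : Type*} [DecidableEq α] [Ring M] [CharP M 2]
    (S T : Finset α) (f : α → M) :
    ∑ k ∈ symmDiff S T, f k = ∑ k ∈ S, f k + ∑ k ∈ T, f k := by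
  rw [symmDiff, Finset.sup_eq_union, Finset.sum_union disjoint_sdiff_sdiff]
  have h₁ := Finset.sum_inter_add_sum_sdiff S T f
  have h₂ := Finset.sum_inter_add_sum_sdiff T S f
  rw [Finset.inter_comm] at h₂
  rw [← h₁, ← h₂, add_add_add_comm, CharTwo.add_self_eq_zero, zero_add]

theorem erase_symmDiff {α : Type*} [DecidableEq α] (S T : Finset α) (a : α) :
    (symmDiff S T).erase a = symmDiff (S.erase a) (T.erase a) := by
  ext x
  simp only [Finset.mem_erase, Finset.mem_symmDiff]
  tauto

theorem topBits_symmDiff (g : ℕ) (S T : Finset ℕ) (i : ℕ) :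
    topBits g (symmDiff S T) i = topBits g S i + topBits g T i := by
  rw [topBits, erase_symmDiff, sum_symmDiff_of_charTwo]; rfl

theorem bottomBits_symmDiff (g : ℕ) (S T : Finset ℕ) (i : ℕ) :
    bottomBits g (symmDiff S T) i = bottomBits g S i + bottomBits g T i := by
  rw [bottomBits, erase_symmDiff, sum_symmDiff_of_charTwo]; rfl

theorem charAdd_etaSet (g : ℕ) (S T : Finset ℕ) :
    charAdd (etaSet g S) (etaSet g T) = etaSet g (symmDiff S T) := by
  simp only [etaSet_eq, charAdd, fract_halfVal_add, topBits_symmDiff, bottomBits_symmDiff]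

theorem isEvenChar_etaSet (g : ℕ) (S : Finset ℕ) :
    IsEvenChar (etaSet g S) ↔
      ∑ i ∈ Finset.range g, topBits g S i * bottomBits g S i = 0 := by
  have hreal : (4 * ∑ i, (etaSet g S).1 i * (etaSet g S).2 i : ℝ) =
      ((∑ i ∈ Finset.range g, (topBits g S i).val * (bottomBits g S i).val : ℕ) : ℝ) := by
    rw [etaSet_eq, Finset.sum_range, Finset.mul_sum, Nat.cast_sum]
    refine Finset.sum_congr rfl fun i _ => ?_
    simp only [halfVal]
    push_cast
    ring
  have hmod : (∑ i ∈ Finset.range g, topBits g S i * bottomBits g S i) =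
      ((∑ i ∈ Finset.range g, (topBits g S i).val * (bottomBits g S i).val : ℕ) : ZMod 2) := by
    simp
  rw [IsEvenChar, hreal, hmod, ZMod.natCast_eq_zero_iff]
  constructor
  · rintro ⟨k, hk⟩
    have hk' : ((∑ i ∈ Finset.range g, (topBits g S i).val * (bottomBits g S i).val : ℕ) : ℤ)
        = 2 * k := by exact_mod_cast hk
    omega
  · rintro ⟨k, hk⟩
    refine ⟨k, ?_⟩
    rw [hk]
    push_cast
    ring

theorem Uset_erase (g : ℕ) : (Uset g).erase (2 * g + 2) = Uset g := by
  refine Finset.erase_eq_of_notMem fun h => ?_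
  obtain ⟨j, -, hj⟩ := Finset.mem_image.1 h
  omega

theorem sum_Uset {M : Type*} [AddCommMonoid M] (g : ℕ) (f : ℕ → M) :
    ∑ k ∈ Uset g, f k = ∑ j ∈ Finset.range (g + 1), f (2 * j + 1) :=
  Finset.sum_image fun a _ b _ h => by simpa using h

theorem topBits_Uset {g i : ℕ} (hi : i < g) : topBits g (Uset g) i = 1 := by
  rw [topBits, Uset_erase, sum_Uset, Finset.sum_eq_single i]
  · rw [if_pos (by omega)]
  · intro j _ hj
    rw [if_neg (by omega)]
  · intro h
    exact absurd (Finset.mem_range.2 (by omega)) h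

theorem bottomBits_Uset {g i : ℕ} (hi : i < g) :
    bottomBits g (Uset g) i = ((g - i : ℤ) : ZMod 2) := by
  have h : (Finset.range (g + 1)).filter (fun j => i < (2 * j + 1) / 2) =
      Finset.Ico (i + 1) (g + 1) := by
    ext j
    simp only [Finset.mem_filter, Finset.mem_range, Finset.mem_Ico]
    omega
  rw [bottomBits, Uset_erase, sum_Uset, Finset.sum_boole, h, Nat.card_Ico,
    show g + 1 - (i + 1) = g - i by omega, Nat.cast_sub hi.le]
  push_cast
  rfl

/-- The number of elements of `T` that are at least `m`. -/
def tailCard (T : Finset ℕ) (m : ℕ) : ℤ := ((T.filter fun k => m ≤ k).card : ℤ)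

theorem tailCard_succ (T : Finset ℕ) (m : ℕ) :
    tailCard T m = tailCard T (m + 1) ∨ tailCard T m = tailCard T (m + 1) + 1 := by
  have h : (T.filter fun k => m ≤ k) =
      (T.filter fun k => m + 1 ≤ k) ∪ (T.filter fun k => k = m) := by
    ext k
    simp only [Finset.mem_filter, Finset.mem_union]
    grind
  have hd : Disjoint (T.filter fun k => m + 1 ≤ k) (T.filter fun k => k = m) := by
    rw [Finset.disjoint_filter]
    intro k _ h₁ h₂
    omega
  have hle : (T.filter fun k => k = m).card ≤ 1 := by
    rw [Finset.card_le_one]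
    intro a ha b hb
    rw [(Finset.mem_filter.1 ha).2, (Finset.mem_filter.1 hb).2]
  rw [tailCard, tailCard, h, Finset.card_union_of_disjoint hd]
  omega

theorem topBits_eq_tailCard (g : ℕ) (T : Finset ℕ) (i : ℕ) :
    topBits g T i = ((tailCard (T.erase (2 * g + 2)) (2 * i + 1) -
      tailCard (T.erase (2 * g + 2)) (2 * i + 3) : ℤ) : ZMod 2) := by
  set T' := T.erase (2 * g + 2)
  have h : (T'.filter fun k => 2 * i + 1 ≤ k) =
      (T'.filter fun k => i + 1 = (k + 1) / 2) ∪ (T'.filter fun k => 2 * i + 3 ≤ k) := by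
    ext k
    simp only [Finset.mem_filter, Finset.mem_union, ← and_or_left]
    exact and_congr_right fun _ => by omega
  have hd : Disjoint (T'.filter fun k => i + 1 = (k + 1) / 2)
      (T'.filter fun k => 2 * i + 3 ≤ k) := by
    rw [Finset.disjoint_filter]
    intro k _ h₁ h₂
    omega
  rw [topBits, Finset.sum_boole, tailCard, tailCard, h, Finset.card_union_of_disjoint hd]
  push_cast
  ring

theorem bottomBits_eq_tailCard (g : ℕ) (T : Finset ℕ) (i : ℕ) :
    bottomBits g T i = ((tailCard (T.erase (2 * g + 2)) (2 * i + 2) : ℤ) : ZMod 2) := by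
  rw [bottomBits, Finset.sum_boole, tailCard]
  push_cast
  congr 3
  ext k
  omega

theorem triangle_succ (D : ℤ) : (D + 1) * D / 2 = D * (D - 1) / 2 + D := by
  rw [show (D + 1) * D = D * (D - 1) + D * 2 by ring]
  exact Int.add_mul_ediv_right _ _ two_ne_zero

/-- The parity of `etaSet g (symmDiff T (Uset g))` is given by a triangular number. -/
theorem sum_bits_symmDiff_Uset {g : ℕ} {T : Finset ℕ} (hT : T ⊆ Finset.Icc 1 (2 * g + 2)) :
    ∑ i ∈ Finset.range g, topBits g (symmDiff T (Uset g)) i *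
        bottomBits g (symmDiff T (Uset g)) i =
      (((((T.erase (2 * g + 2)).card : ℤ) - g) *
        (((T.erase (2 * g + 2)).card : ℤ) - g - 1) / 2 : ℤ) : ZMod 2) := by
  set T' := T.erase (2 * g + 2) with hT'
  have hmem : ∀ k ∈ T', 1 ≤ k ∧ k ≤ 2 * g + 1 := by
    intro k hk
    have h₁ := Finset.mem_erase.1 hk
    have h₂ := Finset.mem_Icc.1 (hT h₁.2)
    omega
  let D : ℕ → ℤ := fun n => tailCard T' (2 * n + 1) - (g - n)
  let f : ℤ → ℤ := fun d => d * (d - 1) / 2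
  have hf (d : ℤ) : f (d + 1) = f d + d := by
    simpa [f] using triangle_succ d
  have hstep (n : ℕ) (hn : n < g) :
      topBits g (symmDiff T (Uset g)) n * bottomBits g (symmDiff T (Uset g)) n =
        ((f (D n) - f (D (n + 1)) : ℤ) : ZMod 2) := by
    rw [topBits_symmDiff, bottomBits_symmDiff, topBits_Uset hn, bottomBits_Uset hn,
      topBits_eq_tailCard, bottomBits_eq_tailCard, ← hT', ← Int.cast_one (R := ZMod 2),
      ← Int.cast_add, ← Int.cast_add, ← Int.cast_mul, ZMod.intCast_eq_intCast_iff_dvd_sub]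
    have h₁ := tailCard_succ T' (2 * n + 1)
    have h₂ := tailCard_succ T' (2 * n + 2)
    have hD : D n = tailCard T' (2 * n + 1) - (g - n) := rfl
    have hD' : D (n + 1) = tailCard T' (2 * n + 3) - (g - n - 1) := by
      simp only [D]; push_cast; ring_nf
    simp only [add_assoc, Nat.reduceAdd] at h₁ h₂
    set r := tailCard T' (2 * n + 3)
    set d := D (n + 1)
    have hs := hf d
    have hp := hf (d - 1)
    rw [sub_add_cancel] at hp
    rcases h₂ with h₂ | h₂ <;> rcases h₁ with h₁ | h₁ <;> rw [hD, h₁, h₂]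
    · rw [show r - (g - n : ℤ) = d - 1 by omega, hp]
      exact ⟨-r, by rw [hD']; ring⟩
    · rw [show r + 1 - (g - n : ℤ) = d by omega]
      exact ⟨-(r + (g - n)), by ring⟩
    · rw [show r + 1 - (g - n : ℤ) = d by omega]
      exact ⟨-(r + 1 + (g - n)), by ring⟩
    · rw [show r + 1 + 1 - (g - n : ℤ) = d + 1 by omega, hs]
      exact ⟨-r - 1 - 2 * (g - n), by rw [hD']; ring⟩
  have hend : f (D g) = 0 := by
    have h₀ : tailCard T' (2 * g + 2) = 0 := by
      rw [tailCard, Nat.cast_eq_zero, Finset.card_eq_zero, Finset.filter_eq_empty_iff]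
      intro k hk
      have := hmem k hk
      omega
    have h₁ := tailCard_succ T' (2 * g + 1)
    simp only [add_assoc, Nat.reduceAdd] at h₁
    rw [h₀] at h₁
    rcases h₁ with h₁ | h₁ <;> simp [f, D, h₁]
  have hstart : D 0 = (T'.card : ℤ) - g := by
    have : (T'.filter fun k => 2 * 0 + 1 ≤ k) = T' :=
      Finset.filter_true_of_mem fun k hk => (hmem k hk).1
    simp only [D, tailCard, this]
    simp
  rw [Finset.sum_congr rfl fun n hn => hstep n (Finset.mem_range.1 hn), ← Int.cast_sum,
    Finset.sum_range_sub', hend, sub_zero, hstart]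

theorem isEvenChar_etaSet_symmDiff_Uset {g : ℕ} {T : Finset ℕ}
    (hT : T ⊆ Finset.Icc 1 (2 * g + 2)) {m : ℤ} (hm : (T.card : ℤ) = g + 1 + 2 * m) :
    IsEvenChar (etaSet g (symmDiff T (Uset g))) ↔ Even m := by
  rw [isEvenChar_etaSet, sum_bits_symmDiff_Uset hT, ZMod.intCast_zmod_eq_zero_iff_dvd,
    even_iff_two_dvd]
  by_cases h : 2 * g + 2 ∈ T
  · have hc := Finset.card_erase_add_one h
    rw [show ((T.erase (2 * g + 2)).card : ℤ) - g = 2 * m by omega,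
      show 2 * m * (2 * m - 1) = (m * (2 * m - 1)) * 2 by ring,
      Int.mul_ediv_cancel _ two_ne_zero]
    simp [← even_iff_two_dvd, parity_simps]
  · rw [Finset.erase_eq_of_notMem h, hm,
      show (g + 1 + 2 * m - g) * (g + 1 + 2 * m - g - 1) = ((2 * m + 1) * m) * 2 by ring,
      Int.mul_ediv_cancel _ two_ne_zero]
    simp [← even_iff_two_dvd, parity_simps]

theorem eSign_etaSet_symmDiff_Uset {g : ℕ} {T : Finset ℕ}
    (hT : T ⊆ Finset.Icc 1 (2 * g + 2)) {m : ℤ} (hm : (T.card : ℤ) = g + 1 + 2 * m) :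
    eSign (etaSet g (symmDiff T (Uset g))) = if Even m then 1 else -1 := by
  simp only [eSign, isEvenChar_etaSet_symmDiff_Uset hT hm]

theorem card_symmDiff_singleton {α : Type*} [DecidableEq α] (S : Finset α) (a : α) :
    ((symmDiff S {a}).card : ℤ) = S.card + if a ∈ S then -1 else 1 := by
  split_ifs with h
  · have : symmDiff S {a} = S.erase a := by
      ext x
      simp only [Finset.mem_symmDiff, Finset.mem_erase, Finset.mem_singleton]
      grind
    have hc := Finset.card_erase_add_one h
    rw [this]
    omega
  · have : symmDiff S {a} = insert a S := by
      ext x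
      simp only [Finset.mem_symmDiff, Finset.mem_insert, Finset.mem_singleton]
      grind
    rw [this, Finset.card_insert_of_notMem h]
    push_cast
    ring

theorem symmDiff_singleton_subset {α : Type*} [DecidableEq α] {S A : Finset α} {a : α}
    (hS : S ⊆ A) (ha : a ∈ A) : symmDiff S {a} ⊆ A := by
  intro x hx
  rw [Finset.mem_symmDiff, Finset.mem_singleton] at hx
  grind

/-- Toggling single elements of a `g`-element set produces azygetic triples. -/
theorem azygetic_symmDiff_singleton {g : ℕ} {T : Finset ℕ} (hT : T ⊆ Finset.Icc 1 (2 * g + 2))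
    (hcard : T.card = g) {a b c : ℕ} (ha : a ∈ Finset.Icc 1 (2 * g + 2))
    (hb : b ∈ Finset.Icc 1 (2 * g + 2)) (hc : c ∈ Finset.Icc 1 (2 * g + 2))
    (hab : a ≠ b) (hac : a ≠ c) (hbc : b ≠ c) :
    Azygetic (etaSet g (symmDiff (symmDiff T {a}) (Uset g)))
      (etaSet g (symmDiff (symmDiff T {b}) (Uset g)))
      (etaSet g (symmDiff (symmDiff T {c}) (Uset g))) := by
  have hsum : symmDiff (symmDiff (symmDiff (symmDiff T {a}) (Uset g))
      (symmDiff (symmDiff T {b}) (Uset g))) (symmDiff (symmDiff T {c}) (Uset g)) =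
      symmDiff (symmDiff (symmDiff (symmDiff T {a}) {b}) {c}) (Uset g) := by
    ext x
    simp only [Finset.mem_symmDiff]
    grind
  have hTa := symmDiff_singleton_subset hT ha
  have hTb := symmDiff_singleton_subset hT hb
  have hTc := symmDiff_singleton_subset hT hc
  have hTab := symmDiff_singleton_subset hTa hb
  have hTabc := symmDiff_singleton_subset hTab hc
  have hb' : b ∈ symmDiff T {a} ↔ b ∈ T := by
    simp [Finset.mem_symmDiff, hab.symm]
  have hc' : c ∈ symmDiff (symmDiff T {a}) {b} ↔ c ∈ T := by
    simp [Finset.mem_symmDiff, hac.symm, hbc.symm]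
  have ka := card_symmDiff_singleton T a
  have kb := card_symmDiff_singleton T b
  have kc := card_symmDiff_singleton T c
  have kab := card_symmDiff_singleton (symmDiff T {a}) b
  have kabc := card_symmDiff_singleton (symmDiff (symmDiff T {a}) {b}) c
  simp only [hb'] at kab
  simp only [hc'] at kabc
  have key (x : ℕ) (hx : symmDiff T {x} ⊆ Finset.Icc 1 (2 * g + 2)) :
      eSign (etaSet g (symmDiff (symmDiff T {x}) (Uset g))) = if x ∈ T then -1 else 1 := by
    have kx := card_symmDiff_singleton T x
    by_cases h : x ∈ T
    · rw [eSign_etaSet_symmDiff_Uset hx (m := -1) (by simp only [h, if_true] at kx; omega)]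
      simp [h]
    · rw [eSign_etaSet_symmDiff_Uset hx (m := 0) (by simp only [h, if_false] at kx; omega)]
      simp [h]
  rw [Azygetic, charAdd_etaSet, charAdd_etaSet, hsum, key a hTa, key b hTb, key c hTc]
  by_cases h₁ : a ∈ T <;> by_cases h₂ : b ∈ T <;> by_cases h₃ : c ∈ T <;>
    simp only [h₁, h₂, h₃, if_true, if_false] at ka kab kabc ⊢
  · rw [eSign_etaSet_symmDiff_Uset hTabc (m := -2) (by omega)]; decide
  · rw [eSign_etaSet_symmDiff_Uset hTabc (m := -1) (by omega)]; decide
  · rw [eSign_etaSet_symmDiff_Uset hTabc (m := -1) (by omega)]; decide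
  · rw [eSign_etaSet_symmDiff_Uset hTabc (m := 0) (by omega)]; decide
  · rw [eSign_etaSet_symmDiff_Uset hTabc (m := -1) (by omega)]; decide
  · rw [eSign_etaSet_symmDiff_Uset hTabc (m := 0) (by omega)]; decide
  · rw [eSign_etaSet_symmDiff_Uset hTabc (m := 0) (by omega)]; decide
  · rw [eSign_etaSet_symmDiff_Uset hTabc (m := 1) (by omega)]; decide

theorem eSign_mul_self {g : ℕ} (η : ThetaChar g) : eSign η * eSign η = 1 := by
  unfold eSign
  split_ifs <;> norm_num

theorem charAdd_charAdd_self_etaSet (g : ℕ) (S T : Finset ℕ) :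
    charAdd (charAdd (etaSet g S) (etaSet g S)) (etaSet g T) = etaSet g T := by
  rw [charAdd_etaSet, charAdd_etaSet, symmDiff_self, bot_symmDiff]

theorem not_azygetic_self_etaSet (g : ℕ) (S T : Finset ℕ) :
    ¬ Azygetic (etaSet g S) (etaSet g S) (etaSet g T) := by
  rw [Azygetic, charAdd_charAdd_self_etaSet, mul_assoc, eSign_mul_self, eSign_mul_self]
  norm_num

/-- **(Gu\`ardia / Mumford).** For any permutation `(i₁,…,i_{2g+2})` of
`(1,…,2g+2)`, the characteristics `η_k := η_{T_k ∘ U}` (with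
`T_k = {i₁,…,i_g} ∖ {i_k}` for `k ≤ g` and `T_k = {i₁,…,i_g} ∪ {i_k}` for
`k ≥ g+1`) are pairwise distinct, the first `g` are odd, the remaining `g+2`
are even, and together they form a fundamental system. -/
theorem fs_from_permutation (g : ℕ) (hg : 2 ≤ g)
    (i : Fin (2 * g + 2) → ℕ) (hi : IsPermIndex g i) :
    Function.Injective (fsChars g i) ∧
      (∀ k : Fin (2 * g + 2), (k : ℕ) < g → IsOddChar (fsChars g i k)) ∧
      (∀ k : Fin (2 * g + 2), g ≤ (k : ℕ) → IsEvenChar (fsChars g i k)) ∧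
      IsFundamentalSystem g (fsSystem g i) := by
  obtain ⟨hinj, himg⟩ := hi
  have hmem (k) : i k ∈ Finset.Icc 1 (2 * g + 2) :=
    himg ▸ Finset.mem_image_of_mem i (Finset.mem_univ k)
  set I : Finset (Fin (2 * g + 2)) := Finset.univ.filter fun l => (l : ℕ) < g with hI
  set T : Finset ℕ := Finset.image i I with hTdef
  have hIcard : I.card = g := by
    rw [hI, Fin.card_filter_val_lt]
    omega
  have hTcard : T.card = g := by
    rw [hTdef, Finset.card_image_of_injective _ hinj, hIcard]
  have hT : T ⊆ Finset.Icc 1 (2 * g + 2) := by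
    intro x hx
    obtain ⟨k, -, rfl⟩ := Finset.mem_image.1 hx
    exact hmem k
  have hiT (k) : i k ∈ T ↔ (k : ℕ) < g := by
    rw [hTdef, hinj.mem_finset_image, hI]
    simp
  have hfs (k) : fsChars g i k = etaSet g (symmDiff (symmDiff T {i k}) (Uset g)) := by
    have hk := hiT k
    simp only [fsChars, ← hI, ← hTdef]
    split_ifs with h <;> congr 2 <;> ext x <;>
      simp only [Finset.mem_symmDiff, Finset.mem_erase, Finset.mem_insert,
        Finset.mem_singleton] <;> grind
  have hparity (k) : IsEvenChar (fsChars g i k) ↔ ¬ (k : ℕ) < g := by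
    have hc := card_symmDiff_singleton T (i k)
    have hsub := symmDiff_singleton_subset hT (hmem k)
    rw [hfs, ← hiT]
    by_cases h : i k ∈ T
    · rw [isEvenChar_etaSet_symmDiff_Uset hsub (m := -1)
        (by simp only [h, if_true] at hc; omega)]
      simp [h]
    · rw [isEvenChar_etaSet_symmDiff_Uset hsub (m := 0)
        (by simp only [h, if_false] at hc; omega)]
      simp [h]
  have hazy (a b c) (hab : a ≠ b) (hac : a ≠ c) (hbc : b ≠ c) :
      Azygetic (fsChars g i a) (fsChars g i b) (fsChars g i c) := by
    rw [hfs, hfs, hfs]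
    exact azygetic_symmDiff_singleton hT hTcard (hmem a) (hmem b) (hmem c)
      (hinj.ne hab) (hinj.ne hac) (hinj.ne hbc)
  have hfsinj : Function.Injective (fsChars g i) := by
    intro a b h
    by_contra hab
    obtain ⟨c, hc⟩ : ∃ c, c ∉ ({a, b} : Finset (Fin (2 * g + 2))) := by
      refine (Finset.exists_mem_notMem_of_card_lt_card (t := Finset.univ) ?_).imp fun _ h => h.2
      exact Finset.card_le_two.trans_lt (by rw [Finset.card_univ, Fintype.card_fin]; omega)
    simp only [Finset.mem_insert, Finset.mem_singleton, not_or] at hc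
    have := hazy a b c hab (Ne.symm hc.1) (Ne.symm hc.2)
    rw [← h, hfs a, hfs c] at this
    exact not_azygetic_self_etaSet _ _ _ this
  refine ⟨hfsinj, fun k hk => ?_, fun k hk => ?_, ?_, ?_, ?_, ?_⟩
  · rw [IsOddChar, hparity]
    exact not_not.2 hk
  · exact (hparity k).2 (not_lt.2 hk)
  · rw [fsSystem, Finset.card_image_of_injective _ hfsinj, Finset.card_univ, Fintype.card_fin]
  · intro η hη
    obtain ⟨k, -, rfl⟩ := Finset.mem_image.1 hη
    rw [hfs]
    exact isChar_etaSet _ _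
  · rw [fsSystem, Finset.filter_image, Finset.card_image_of_injective _ hfsinj]
    refine (congrArg Finset.card ?_).trans hIcard
    ext k
    simp [I, IsOddChar, hparity]
  · intro a ha b hb c hc hab hac hbc
    obtain ⟨a, -, rfl⟩ := Finset.mem_image.1 ha
    obtain ⟨b, -, rfl⟩ := Finset.mem_image.1 hb
    obtain ⟨c, -, rfl⟩ := Finset.mem_image.1 hc
    exact hazy a b c (ne_of_apply_ne _ hab) (ne_of_apply_ne _ hac) (ne_of_apply_ne _ hbc)

end
end
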